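/- For any partitions μ and ν, the skew Jack character satisfies θ_{μ/ν}^{(α)}(v) = [t^{|μ|−|ν|} p_μ] exp(B_∞^{(α)}(−t,p,−αv)) · p_ν, i.e. it is the coefficient of t^{|μ|−|ν|} p_μ in the image of p_ν under the exponential of the operator B_∞^{(α)}(−t,p,−αv). -/

import Mathlib

open scoped Classical

noncomputable section

/-- The base field `ℚ(α)` of rational functions in the Jack parameter `α`. -/
abbrev F : Type := RatFunc ℚ

/-- The Jack deformation parameter `α`. -/
def alpha : F := RatFunc.X

/-- An integer partition, encoded as a multiset of positive integers (its parts). -/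
abbrev JPartition : Type := Multiset ℕ+

/-- The size `|λ|` of a partition. -/
def psize (l : JPartition) : ℕ := (l.map fun i => (i : ℕ)).sum

/-- The length `ℓ(λ)` of a partition. -/
def plen (l : JPartition) : ℕ := Multiset.card l

/-- `m_i(λ)`, the number of parts of `λ` equal to `i`. -/
def pmult (l : JPartition) (i : ℕ+) : ℕ := Multiset.count i l

/-- `λ ∪ 1^k`, adjoining `k` parts equal to `1`. -/
def addOnes (l : JPartition) (k : ℕ) : JPartition := l + Multiset.replicate k 1

/-- `λ̃`, the partition obtained by deleting all parts equal to `1`. -/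
def removeOnes (l : JPartition) : JPartition := Multiset.filter (fun i => i ≠ 1) l

/-- Exponent vectors of monomials in the power-sum generators `p₁, p₂, …`. -/
abbrev Exp : Type := ℕ+ →₀ ℕ

/-- The exponent vector of the monomial `p_λ`. -/
def toExp (l : JPartition) : Exp := l.toFinset.sum fun i => Finsupp.single i (Multiset.count i l)

/-- The partition corresponding to an exponent vector. -/
def toPart (m : Exp) : JPartition := m.sum fun i k => Multiset.replicate k i

/-- The weighted degree (`deg p_i = i`) of an exponent vector; this is the size of the
corresponding partition. -/
def wt (m : Exp) : ℕ := m.sum fun i k => k * (i : ℕ)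

/-- The algebra `ℚ(α)[p₁, p₂, …]` of symmetric functions written in the power-sum basis. -/
abbrev SymA : Type := MvPolynomial ℕ+ F

/-- The power-sum monomial `p_λ`. -/
def pPow (l : JPartition) : SymA := (l.map fun i => MvPolynomial.X i).prod

/-- `z_λ α^{ℓ(λ)}`, attached to the exponent vector of `p_λ`. -/
def zalpha (m : Exp) : F :=
  algebraMap ℚ F (m.prod fun i k => (Nat.factorial k : ℚ) * ((i : ℕ) : ℚ) ^ k) *
    alpha ^ (m.sum fun _ k => k)

/-- The `α`-deformed Hall scalar product: `⟨p_λ, p_μ⟩ = δ_{λμ} z_λ α^{ℓ(λ)}`. -/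
def hall (f g : SymA) : F :=
  ∑ m ∈ f.support, MvPolynomial.coeff m f * MvPolynomial.coeff m g * zalpha m

/-- The parts of a partition, sorted in weakly decreasing order. -/
def sortedParts (l : JPartition) : List ℕ := ((l.map fun i => (i : ℕ)).sort (· ≤ ·)).reverse

/-- The sum of the `k` largest parts of a partition. -/
def topSum (l : JPartition) (k : ℕ) : ℕ := ((sortedParts l).take k).sum

/-- The dominance order on partitions: `μ ⊴ λ`. -/
def dominates (mu lam : JPartition) : Prop :=
  psize mu = psize lam ∧ ∀ k, topSum mu k ≤ topSum lam k

/-- Evaluation of a symmetric function (in power-sum coordinates) in `N` variables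
`x₁, …, x_N`: it sends `p_i ↦ x₁^i + ⋯ + x_N^i`. -/
def evalN (N : ℕ) : SymA →ₐ[F] MvPolynomial (Fin N) F :=
  MvPolynomial.aeval fun i : ℕ+ => ∑ j : Fin N, MvPolynomial.X j ^ (i : ℕ)

/-- The exponent of the monomial `x₁^{μ₁} ⋯ x_s^{μ_s}` in `N` variables, for `μ` a
partition; its coefficient in a symmetric polynomial is the coefficient of the monomial
symmetric function `m_μ` (provided `N ≥ ℓ(μ)`). -/
def xexp (mu : JPartition) (N : ℕ) : Fin N →₀ ℕ :=
  Finsupp.equivFunOnFinite.symm fun j => (sortedParts mu).getD (j : ℕ) 0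

/-- The defining properties of the family of Jack polynomials `J_λ^{(α)}` (Macdonald's
characterization): orthogonality for the `α`-deformed Hall product, triangularity with
respect to monomial symmetric functions in dominance order, and normalization
`[p_{1^n}] J_λ^{(α)} = 1`. -/
structure IsJackFamily (J : JPartition → SymA) : Prop where
  orthogonal : ∀ l m : JPartition, l ≠ m → hall (J l) (J m) = 0
  triangular : ∀ l m : JPartition, ¬ dominates m l →
    MvPolynomial.coeff (xexp m (psize l + psize m + plen m))
      (evalN (psize l + psize m + plen m) (J l)) = 0
  normalized : ∀ l : JPartition, MvPolynomial.coeff (Finsupp.single 1 (psize l)) (J l) = 1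

/-- The Jack character `θ_μ^{(α)}(λ)`. -/
def theta (J : JPartition → SymA) (mu lam : JPartition) : F :=
  if psize lam < psize mu then 0
  else (Nat.choose (psize lam - psize mu + pmult mu 1) (pmult mu 1) : F) *
    MvPolynomial.coeff (toExp (addOnes mu (psize lam - psize mu))) (J lam)

/-- `g` is the family of structure coefficients of Jack characters:
`θ_μ^{(α)} θ_ν^{(α)} = ∑_π g^π_{μ,ν}(α) θ_π^{(α)}` (as functions on Young diagrams,
with finitely many nonzero terms). -/
def IsStructCoeffs (J : JPartition → SymA) (g : JPartition → JPartition → JPartition → F) :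
    Prop :=
  (∀ mu nu : JPartition, {pi : JPartition | g pi mu nu ≠ 0}.Finite) ∧
  ∀ mu nu lam : JPartition,
    theta J mu lam * theta J nu lam = ∑ᶠ pi : JPartition, g pi mu nu * theta J pi lam


/-- The polynomial algebra `ℚ(α)[p₁,p₂,…][y₀,y₁,…]` containing the catalytic variables. -/
abbrev PY : Type := MvPolynomial (ℕ+ ⊕ ℕ) F

/-- The variable `p_i` inside `PY`. -/
def pv (i : ℕ+) : PY := MvPolynomial.X (Sum.inl i)

/-- The catalytic variable `y_j` inside `PY`. -/
def yv (j : ℕ) : PY := MvPolynomial.X (Sum.inr j)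

/-- The operator `Y₊ = ∑_{i≥0} y_{i+1} ∂/∂y_i`. -/
def Yplus (f : PY) : PY := ∑ᶠ j : ℕ, yv (j + 1) * MvPolynomial.pderiv (Sum.inr j) f

/-- The operator
`Γ_Y = (1+b) ∑_{i,j≥1} y_{i+j} j ∂²/(∂y_{i-1}∂p_j) + ∑_{i,j≥1} y_i p_j ∂/∂y_{i+j-1}
      + b ∑_{i≥1} y_{i+1} i ∂/∂y_i`, with `b = α - 1`. -/
def GammaY (f : PY) : PY :=
  alpha • (∑ᶠ i : ℕ+, ∑ᶠ j : ℕ+, ((j : ℕ) : F) •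
      (yv ((i : ℕ) + (j : ℕ)) *
        MvPolynomial.pderiv (Sum.inl j) (MvPolynomial.pderiv (Sum.inr ((i : ℕ) - 1)) f)))
  + (∑ᶠ i : ℕ+, ∑ᶠ j : ℕ+,
      yv (i : ℕ) * pv j * MvPolynomial.pderiv (Sum.inr ((i : ℕ) + (j : ℕ) - 1)) f)
  + (alpha - 1) • (∑ᶠ i : ℕ+, ((i : ℕ) : F) •
      (yv ((i : ℕ) + 1) * MvPolynomial.pderiv (Sum.inr (i : ℕ)) f))

/-- The operator `Θ_Y = ∑_{i≥1} p_i ∂/∂y_i`. -/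
def ThetaY (f : PY) : PY := ∑ᶠ i : ℕ+, pv i * MvPolynomial.pderiv (Sum.inr (i : ℕ)) f

/-- Ordered composite of the operators `Y₊` (for `true`) and `Γ_Y` (for `false`). -/
def wordOp : List Bool → PY → PY
  | [], f => f
  | b :: w, f => (if b then Yplus else GammaY) (wordOp w f)

/-- Projection `PY → SymA` killing the catalytic variables. -/
def dropY : PY →ₐ[F] SymA :=
  MvPolynomial.aeval fun v => match v with
    | Sum.inl i => MvPolynomial.X i
    | Sum.inr _ => 0

/-- `Bc n ℓ` is the coefficient of `u^ℓ` in the operator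
`B_n^{(α)}(p, u) = Θ_Y (Γ_Y + u Y₊)^n (y₀ / (1+b))`, viewed as an operator on `ℚ(α)[p]`. -/
def Bc (n ℓ : ℕ) (f : SymA) : SymA :=
  dropY (ThetaY (∑ s ∈ Finset.univ.filter
      (fun s : Fin n → Bool => (Finset.univ.filter fun i => s i = true).card = ℓ),
    wordOp (List.ofFn s) (alpha⁻¹ • (yv 0 * MvPolynomial.rename Sum.inl f))))

/-- Matrix entries of `Bc n ℓ` in the basis of power-sum monomials. -/
def Bmat (n ℓ : ℕ) (m m' : Exp) : F :=
  MvPolynomial.coeff m (Bc n ℓ (MvPolynomial.monomial m' 1))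

/-- The adjoint of `Bc n ℓ` with respect to the `α`-deformed Hall scalar product
(`⟨Bperp f, g⟩ = ⟨f, Bc g⟩`), given by its matrix in the power-sum basis. -/
def Bperp (n ℓ : ℕ) (f : SymA) : SymA :=
  ∑ m' ∈ f.support, MvPolynomial.coeff m' f •
    ∑ᶠ m : Exp, (Bmat n ℓ m' m * zalpha m' / zalpha m) • (MvPolynomial.monomial m (1 : F))



/-- `Th μ ν` is the family of skew Jack characters `θ_{μ/ν}^{(α)}(v)` (polynomials in the
single variable `v`), defined by the expansion
`θ_μ^{(α)}(v, u₁, u₂, …) = ∑_ν θ_{μ/ν}^{(α)}(v) θ_ν^{(α)}(u₁, u₂, …)`.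
Since shifted symmetric functions are determined by their values on partitions, this is
characterized by: for every partition `λ` and every `v ∈ ℕ₊` at least as large as all
parts of `λ` (so that `(v, λ₁, λ₂, …)` is again a partition),
`θ_μ^{(α)}(v ::ₘ λ) = ∑_ν θ_{μ/ν}^{(α)}(v) θ_ν^{(α)}(λ)`, with finitely many nonzero
summands. -/
def IsSkewTheta (J : JPartition → SymA)
    (Th : JPartition → JPartition → Polynomial F) : Prop :=
  (∀ mu : JPartition, {nu : JPartition | Th mu nu ≠ 0}.Finite) ∧
  ∀ (mu lam : JPartition) (v : ℕ+), (∀ i ∈ lam, i ≤ v) →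
    theta J mu (v ::ₘ lam) =
      ∑ᶠ nu : JPartition, Polynomial.eval (((v : ℕ) : F)) (Th mu nu) * theta J nu lam

/-- `B_n^{(α)}(p, u)` with the variable `u` specialized to the scalar `c`. -/
def Bn (n : ℕ) (c : F) (f : SymA) : SymA := ∑ ℓ ∈ Finset.range (n + 1), c ^ ℓ • Bc n ℓ f

/-- Ordered composite `B_{n₁}(p,c) ∘ B_{n₂}(p,c) ∘ ⋯` over a list of indices. -/
def BnList (c : F) : List ℕ → SymA → SymA
  | [], f => f
  | n :: L, f => Bn n c (BnList c L f)

/-- The coefficient of `t^N` in `exp(B_∞^{(α)}(-t, p, c)) ⬝ f`, where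
`B_∞^{(α)}(t,p,u) = ∑_{n≥1} (t^n/n) B_n^{(α)}(p,u)`:  expanding the exponential,
this is `∑_{k≥0} (1/k!) ∑_{(n₁,…,n_k), nᵢ≥1, ∑nᵢ=N} ∏ᵢ ((-1)^{nᵢ}/nᵢ) ⬝ B_{n₁} ⋯ B_{n_k} f`. -/
def expBcoef (c : F) (N : ℕ) (f : SymA) : SymA :=
  ∑ᶠ L : List ℕ, if L.sum = N ∧ ∀ n ∈ L, 1 ≤ n then
    ((L.map fun n : ℕ => (-1 : F) ^ n / (n : F)).prod / (Nat.factorial L.length : F)) •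
      BnList c L f
  else 0

/-- `B_n^{(α)⊥}(p, u)` (the Hall-adjoint of `B_n`) with `u` specialized to `c`. -/
def BnPerp (n : ℕ) (c : F) (f : SymA) : SymA :=
  ∑ ℓ ∈ Finset.range (n + 1), c ^ ℓ • Bperp n ℓ f

/-- Ordered composite of adjoint operators over a list of indices. -/
def BnPerpList (c : F) : List ℕ → SymA → SymA
  | [], f => f
  | n :: L, f => BnPerp n c (BnPerpList c L f)

/-- The coefficient of `t^N` in `exp(B_∞^{(α)⊥}(-t, p, c)) ⬝ f`. -/
def expBperpCoef (c : F) (N : ℕ) (f : SymA) : SymA :=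
  ∑ᶠ L : List ℕ, if L.sum = N ∧ ∀ n ∈ L, 1 ≤ n then
    ((L.map fun n : ℕ => (-1 : F) ^ n / (n : F)).prod / (Nat.factorial L.length : F)) •
      BnPerpList c L f
  else 0

section
open Polynomial in
abbrev MM : Type := Polynomial SymA

def pX (n : ℕ) : SymA := if h : 0 < n then MvPolynomial.X ⟨n, h⟩ else 0

lemma pX_zero : pX 0 = 0 := by simp [pX]
lemma pX_pnat (i : ℕ+) : pX (i : ℕ) = MvPolynomial.X i := by
  simp only [pX, i.pos, dif_pos]; rfl

lemma exists_pnat {n : ℕ} (hn : 0 < n) : ∃ i : ℕ+, n = (i : ℕ) := ⟨⟨n, hn⟩, rfl⟩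

lemma smulMM (c : F) (p : MM) : c • p = Polynomial.C (MvPolynomial.C c) * p := by
  rw [← Polynomial.smul_eq_C_mul, ← MvPolynomial.algebraMap_eq, algebraMap_smul]

/-- derivation with values on `p_i`. -/
def derS (h : ℕ → SymA) : Derivation F SymA SymA := MvPolynomial.mkDerivation F fun i : ℕ+ => h i

lemma derS_pX (h : ℕ → SymA) (h0 : h 0 = 0) (n : ℕ) : derS h (pX n) = h n := by
  rcases Nat.eq_zero_or_pos n with rfl | hn
  · simp [pX_zero, h0]
  · obtain ⟨i, rfl⟩ := exists_pnat hn
    rw [pX_pnat, derS, MvPolynomial.mkDerivation_X]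

def Q0 : Derivation F SymA MM :=
  MvPolynomial.mkDerivation F fun i : ℕ+ => (alpha * ((i : ℕ) : F)) • (Polynomial.X : MM) ^ (i : ℕ)

lemma Q0_pX (n : ℕ) : Q0 (pX n) = (alpha * (n : F)) • (Polynomial.X : MM) ^ n := by
  rcases Nat.eq_zero_or_pos n with rfl | hn
  · simp [pX_zero]
  · obtain ⟨i, rfl⟩ := exists_pnat hn
    rw [pX_pnat, Q0, MvPolynomial.mkDerivation_X]

/-- linear maps from values on monomials -/
def mkOp (g : ℕ → SymA →ₗ[F] MM) : Module.End F MM := Polynomial.lsum g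

lemma mkOp_monomial (g : ℕ → SymA →ₗ[F] MM) (k : ℕ) (f : SymA) :
    mkOp g (Polynomial.monomial k f) = g k f := by
  simp [mkOp, Polynomial.lsum_apply]

lemma op_ext {A : Type*} [AddCommMonoid A] [Module F A] {O O' : MM →ₗ[F] A}
    (h : ∀ k f, O (Polynomial.monomial k f) = O' (Polynomial.monomial k f)) : O = O' := by
  ext p
  induction p using Polynomial.induction_on' with
  | add p q hp hq => simp [hp, hq]
  | monomial k f => exact h k f

def opS : Module.End F MM := LinearMap.mulLeft F (Polynomial.X : MM)
def opN : Module.End F MM := mkOp fun k => (k : F) • ((Polynomial.monomial k).restrictScalars F)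
def opP : Module.End F MM := mkOp fun k =>
  ∑ j ∈ Finset.range k, ((Polynomial.monomial j).restrictScalars F) ∘ₗ LinearMap.mulLeft F (pX (k - j))
def opQ : Module.End F MM := mkOp fun k =>
  LinearMap.mulLeft F ((Polynomial.X : MM) ^ k) ∘ₗ (Q0 : SymA →ₗ[F] MM)
def mp (f : SymA) : Module.End F MM := LinearMap.mulLeft F (Polynomial.C f)
def fib (T : Module.End F SymA) : Module.End F MM := mkOp fun k =>
  ((Polynomial.monomial k).restrictScalars F) ∘ₗ T
def vac : SymA →ₗ[F] MM := (Polynomial.monomial 0).restrictScalars F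
def cof (m : ℕ) : MM →ₗ[F] SymA := (Polynomial.lcoeff SymA m).restrictScalars F
/-- multiplication operator on SymA -/
def mS (f : SymA) : Module.End F SymA := LinearMap.mulLeft F f

@[simp] lemma mS_apply (f g : SymA) : mS f g = f * g := rfl
@[simp] lemma cof_apply (m : ℕ) (p : MM) : cof m p = p.coeff m := rfl
@[simp] lemma vac_apply (f : SymA) : vac f = Polynomial.monomial 0 f := rfl
@[simp] lemma opS_mon (k : ℕ) (f : SymA) :
    opS (Polynomial.monomial k f) = Polynomial.monomial (k + 1) f := by
  simp [opS, Polynomial.X_mul_monomial]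
@[simp] lemma opN_mon (k : ℕ) (f : SymA) :
    opN (Polynomial.monomial k f) = (k : F) • Polynomial.monomial k f := by
  simp [opN, mkOp_monomial]
lemma opP_mon (k : ℕ) (f : SymA) :
    opP (Polynomial.monomial k f) = ∑ j ∈ Finset.range k, Polynomial.monomial j (pX (k - j) * f) := by
  simp [opP, mkOp_monomial]
@[simp] lemma opQ_mon (k : ℕ) (f : SymA) :
    opQ (Polynomial.monomial k f) = Polynomial.X ^ k * Q0 f := by
  simp [opQ, mkOp_monomial]
@[simp] lemma mp_mon (g : SymA) (k : ℕ) (f : SymA) :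
    mp g (Polynomial.monomial k f) = Polynomial.monomial k (g * f) := by
  simp [mp, Polynomial.C_mul_monomial]
@[simp] lemma fib_mon (T : Module.End F SymA) (k : ℕ) (f : SymA) :
    fib T (Polynomial.monomial k f) = Polynomial.monomial k (T f) := by
  simp [fib, mkOp_monomial]

lemma coeff_opP_mon (k : ℕ) (f : SymA) (m : ℕ) :
    (opP (Polynomial.monomial k f)).coeff m = pX (k - m) * f := by
  rw [opP_mon, Polynomial.finsetSum_coeff]
  simp only [Polynomial.coeff_monomial, Finset.sum_ite_eq', Finset.mem_range]
  split_ifs with h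
  · rfl
  · rw [Nat.sub_eq_zero_of_le (by omega), pX_zero, zero_mul]

lemma cof_opS_succ (m : ℕ) (p : MM) : (opS p).coeff (m + 1) = p.coeff m := by
  simp [opS, Polynomial.coeff_X_mul]
lemma cof_opS_zero (p : MM) : (opS p).coeff 0 = 0 := by
  simp [opS]
lemma cof_opN (m : ℕ) (p : MM) : (opN p).coeff m = (m : F) • p.coeff m := by
  induction p using Polynomial.induction_on' with
  | add p q hp hq => simp [hp, hq]
  | monomial k f =>
    simp [Polynomial.coeff_monomial]
    split_ifs with h
    · rw [h]
    · rfl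
lemma cof_fib (T : Module.End F SymA) (m : ℕ) (p : MM) : (fib T p).coeff m = T (p.coeff m) := by
  induction p using Polynomial.induction_on' with
  | add p q hp hq => simp [hp, hq]
  | monomial k f =>
    simp [Polynomial.coeff_monomial]
    split_ifs <;> simp
lemma cof_mp (g : SymA) (m : ℕ) (p : MM) : (mp g p).coeff m = g * p.coeff m := by
  simp [mp]

lemma Q0_coeff_zero (f : SymA) : (Q0 f).coeff 0 = 0 := by
  induction f using MvPolynomial.induction_on with
  | C a => simp [Q0]
  | add p q hp hq => simp [hp, hq]
  | mul_X p i hp =>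
    rw [Derivation.leibniz, ← pX_pnat, Q0_pX]
    simp [hp, Polynomial.coeff_X_pow, i.ne_zero.symm]

lemma cof_opQ_zero (p : MM) : (opQ p).coeff 0 = 0 := by
  induction p using Polynomial.induction_on' with
  | add p q hp hq => simp [hp, hq]
  | monomial k f => simp [Polynomial.mul_coeff_zero, Q0_coeff_zero]

/-- ext via commutation with the `p_n` -/
lemma op_zero_of_comm {O : Module.End F MM} (hc : ∀ n, O * mp (pX n) = mp (pX n) * O)
    (h1 : ∀ k, O (Polynomial.monomial k 1) = 0) : O = 0 := by
  apply op_ext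
  intro k f
  rw [LinearMap.zero_apply]
  induction f using MvPolynomial.induction_on with
  | C a =>
    have : Polynomial.monomial k (MvPolynomial.C a : SymA) = a • Polynomial.monomial k (1 : SymA) := by
      rw [Polynomial.smul_monomial]; congr 1
      rw [MvPolynomial.smul_eq_C_mul, mul_one]
    rw [this, map_smul, h1, smul_zero]
  | add p q hp hq => rw [map_add, map_add, hp, hq, add_zero]
  | mul_X p i hp =>
    have := LinearMap.congr_fun (hc i) (Polynomial.monomial k p)
    simp only [Module.End.mul_apply, mp_mon, hp, map_zero, pX_pnat] at this
    rw [mul_comm, this]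

/-! basic commutation -/
lemma S_mp (g : SymA) : opS * mp g = mp g * opS := by
  apply op_ext; intro k f; simp
lemma N_mp (g : SymA) : opN * mp g = mp g * opN := by
  apply op_ext; intro k f; simp
lemma P_mp (g : SymA) : opP * mp g = mp g * opP := by
  apply op_ext; intro k f
  ext1 m
  simp only [Module.End.mul_apply, mp_mon, coeff_opP_mon, cof_mp]; ring
lemma Q_mp (n : ℕ) : opQ * mp (pX n) = mp (pX n) * opQ + (alpha * (n : F)) • opS ^ n := by
  apply op_ext; intro k f
  have hS : ∀ n : ℕ, (opS ^ n) (Polynomial.monomial k f) = Polynomial.monomial (k + n) f := by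
    intro n; induction n with
    | zero => simp
    | succ n ih => rw [pow_succ', Module.End.mul_apply, ih, opS_mon]; rfl
  simp only [Module.End.mul_apply, LinearMap.add_apply, LinearMap.smul_apply, mp_mon, opQ_mon, hS,
    Derivation.leibniz, Q0_pX]
  simp only [mp, LinearMap.mulLeft_apply]
  rw [Polynomial.smul_eq_C_mul, Polynomial.smul_eq_C_mul, smulMM, smulMM,
    ← Polynomial.C_mul_X_pow_eq_monomial, pow_add]
  ring
lemma Q_S : opQ * opS = opS * opQ := by
  apply op_ext; intro k f
  simp [opS, Polynomial.X_mul_monomial, pow_succ']; ring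
lemma N_S : opN * opS = opS * opN + opS := by
  apply op_ext; intro k f
  simp [add_smul]
lemma NP_S : opN * opP * opS = opS * opN * opP + opS * opP := by
  apply op_ext; intro k f
  ext1 m
  rcases m with _ | m
  · simp [Module.End.mul_apply, cof_opN, cof_opS_zero]
  · simp only [Module.End.mul_apply, LinearMap.add_apply, opS_mon, cof_opN, coeff_opP_mon,
      Polynomial.coeff_add, cof_opS_succ, Nat.add_sub_add_right]
    push_cast; rw [add_smul, one_smul]
lemma fib_S (T) : fib T * opS = opS * fib T := by
  apply op_ext; intro k f; simp
lemma fib_N (T) : fib T * opN = opN * fib T := by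
  apply op_ext; intro k f; simp
lemma fib_mul (T T') : fib T * fib T' = fib (T * T') := by
  apply op_ext; intro k f; simp
lemma fib_add (T T') : fib (T + T') = fib T + fib T' := by
  apply op_ext; intro k f; simp
lemma fib_smul (c : F) (T) : fib (c • T) = c • fib T := by
  apply op_ext; intro k f; simp only [fib_mon, mp_mon, LinearMap.smul_apply, Polynomial.smul_monomial, smul_mul_assoc]
lemma fib_mS (g : SymA) : fib (mS g) = mp g := by
  apply op_ext; intro k f; simp
lemma mp_add (g h : SymA) : mp (g + h) = mp g + mp h := by
  apply op_ext; intro k f; simp [add_mul]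
lemma mp_smul (c : F) (h : SymA) : mp (c • h) = c • mp h := by
  apply op_ext; intro k f; simp only [fib_mon, mp_mon, LinearMap.smul_apply, Polynomial.smul_monomial, smul_mul_assoc]
lemma mp_mp (g h : SymA) : mp g * mp h = mp h * mp g := by
  apply op_ext; intro k f; simp [mul_left_comm]

lemma opS_pow_mon (n k : ℕ) (f : SymA) :
    (opS ^ n) (Polynomial.monomial k f) = Polynomial.monomial (k + n) f := by
  induction n with
  | zero => simp
  | succ n ih => rw [pow_succ', Module.End.mul_apply, ih, opS_mon]; rfl

lemma cof_opS_pow (n m : ℕ) (p : MM) : ((opS ^ n) p).coeff m = if n ≤ m then p.coeff (m - n) else 0 := by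
  have : (opS ^ n) p = Polynomial.X ^ n * p := by
    induction n with
    | zero => simp
    | succ n ih => rw [pow_succ', Module.End.mul_apply, ih, pow_succ', mul_assoc]; rfl
  rw [this, Polynomial.coeff_X_pow_mul']

def bF : F := alpha - 1
def opL : Module.End F MM := opP + opQ + bF • opN

lemma L_mp (n : ℕ) : opL * mp (pX n) = mp (pX n) * opL + (alpha * (n : F)) • opS ^ n := by
  simp only [opL, add_mul, mul_add, P_mp, Q_mp, smul_mul_assoc, N_mp, mul_smul_comm]
  abel

lemma Spow_mp (n : ℕ) (g : SymA) : opS ^ n * mp g = mp g * opS ^ n := by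
  apply op_ext; intro k f; simp [opS_pow_mon]
lemma N_Spow (n : ℕ) : opN * opS ^ n = opS ^ n * opN + (n : F) • opS ^ n := by
  apply op_ext; intro k f; simp [opS_pow_mon, add_smul]

lemma alpha_ne : alpha ≠ 0 := RatFunc.X_ne_zero
lemma coeff_opL_mon_one (k m : ℕ) : (opL (Polynomial.monomial k 1)).coeff m
    = pX (k - m) + if m = k then (bF * (k : F)) • (1 : SymA) else 0 := by
  simp only [opL, LinearMap.add_apply, LinearMap.smul_apply, Polynomial.coeff_add, coeff_opP_mon, mul_one,
    opQ_mon, opN_mon, Polynomial.coeff_smul, Polynomial.coeff_monomial, smul_smul, Derivation.map_one_eq_zero,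
    mul_zero, Polynomial.coeff_zero, add_zero, smul_ite, smul_zero, eq_comm]

end

section
def dn (n : ℕ) : Derivation F SymA SymA := derS fun i => (i : F) • pX (i + n)
def Eder : Derivation F SymA SymA := derS fun i => (i : F) • pX i
def csum (n : ℕ) : SymA := ∑ j ∈ Finset.range n, pX j * pX (n - j)
def cn (n : ℕ) : SymA := ((n : F) / 2) • (csum n + (bF * ((n : F) - 1)) • pX n)

lemma dn_pX (n i : ℕ) : dn n (pX i) = (i : F) • pX (i + n) := by
  rw [dn, derS_pX]; simp
lemma Eder_pX (i : ℕ) : Eder (pX i) = (i : F) • pX i := by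
  rw [Eder, derS_pX]; simp

def Dop : Module.End F SymA :=
  (2 * alpha)⁻¹ • (cof 0 ∘ₗ (opL ^ 3) ∘ₗ vac) - (bF / 2) • (Eder : SymA →ₗ[F] SymA)

lemma cof0_L (p : MM) : (opL p).coeff 0 = (opP p).coeff 0 := by
  simp [opL, cof_opQ_zero, cof_opN]
lemma P_vac (f : SymA) : opP (Polynomial.monomial 0 f) = 0 := by rw [opP_mon]; simp
lemma N_vac (f : SymA) : opN (Polynomial.monomial 0 f) = 0 := by rw [opN_mon]; simp
lemma Q_vac (f : SymA) : opQ (Polynomial.monomial 0 f) = Q0 f := by rw [opQ_mon]; simp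
lemma L_vac (f : SymA) : opL (Polynomial.monomial 0 f) = Q0 f := by
  simp only [opL, LinearMap.add_apply, LinearMap.smul_apply, P_vac, N_vac, Q_vac]; simp

lemma cof_mul_P (g : SymA) (p : MM) (m : ℕ) : (opP (Polynomial.C g * p)).coeff m = g * (opP p).coeff m := by
  have := LinearMap.congr_fun (P_mp g) p
  rw [Module.End.mul_apply, Module.End.mul_apply] at this
  rw [← cof_mp, ← this]; rfl
lemma Spow_mul (n : ℕ) (g : SymA) (p : MM) : (opS ^ n) (Polynomial.C g * p) = Polynomial.C g * (opS ^ n) p := by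
  have := LinearMap.congr_fun (Spow_mp n g) p
  rw [Module.End.mul_apply, Module.End.mul_apply] at this
  exact this

lemma smulS (c : F) (p : SymA) : c • p = MvPolynomial.C c * p := MvPolynomial.smul_eq_C_mul _ _

lemma coeff0_PSQ (n : ℕ) (f : SymA) : (opP ((opS ^ n) (Q0 f))).coeff 0 = alpha • dn n f := by
  induction f using MvPolynomial.induction_on with
  | C a => simp [Q0, dn, derS]
  | add p q hp hq => simp only [map_add, Polynomial.coeff_add, hp, hq, smul_add]
  | mul_X p i hp =>
    rw [Derivation.leibniz, Derivation.leibniz, ← pX_pnat, Q0_pX, dn_pX, map_add, map_add,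
      Polynomial.smul_eq_C_mul, Polynomial.smul_eq_C_mul, Spow_mul, Spow_mul, Polynomial.coeff_add,
      cof_mul_P, cof_mul_P, hp]
    rw [map_smul, map_smul, Polynomial.X_pow_eq_monomial, opS_pow_mon, Polynomial.coeff_smul,
      coeff_opP_mon]
    simp only [smul_eq_mul, smulS, map_mul, Nat.sub_zero]
    ring

lemma fourterm (n : ℕ) : opL ^ 3 * mp (pX n) = mp (pX n) * opL ^ 3 +
    (alpha * (n : F)) • (opS ^ n * (opL * opL) + opL * opS ^ n * opL + opL * opL * opS ^ n) := by
  have h := L_mp n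
  have : opL ^ 3 = opL * (opL * opL) := by rw [pow_succ, pow_two, mul_assoc]
  rw [this, mul_assoc, mul_assoc, h, mul_add, ← mul_assoc opL (mp _), h, mul_add,
    add_mul, mul_add, mul_assoc (mp _), ← mul_assoc opL (mp _), h]
  simp only [add_mul, mul_add, smul_mul_assoc, mul_smul_comm, mul_assoc, smul_add]
  abel

lemma coeff0_PP (n : ℕ) (f : SymA) : (opP (opP (Polynomial.monomial n f))).coeff 0 = csum n * f := by
  rw [opP_mon, map_sum, Polynomial.finsetSum_coeff, csum, Finset.sum_mul]
  refine Finset.sum_congr rfl fun j _ => ?_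
  rw [coeff_opP_mon, Nat.sub_zero, mul_assoc]

lemma D_mul (n : ℕ) (f : SymA) :
    Dop (pX n * f) = pX n * Dop f + cn n * f + (alpha * (n : F)) • dn n f := by
  rcases Nat.eq_zero_or_pos n with rfl | hn
  · simp [pX_zero, cn]
  have h := LinearMap.congr_fun (fourterm n) (Polynomial.monomial 0 f)
  simp only [Module.End.mul_apply, LinearMap.add_apply, LinearMap.smul_apply, mp_mon] at h
  have h0 := congrArg (fun p : MM => p.coeff 0) h
  simp only [Polynomial.coeff_add, Polynomial.coeff_smul, cof_mp, cof0_L, cof_opS_pow,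
    show ¬ (n ≤ 0) by omega, if_false, L_vac, coeff0_PSQ, opS_pow_mon, zero_add] at h0
  have e1 : (opP (opL (Polynomial.monomial n f))).coeff 0 =
      csum n * f + alpha • dn n f + (bF * (n : F)) • (pX n * f) := by
    have := coeff0_PSQ n f
    rw [show (opS ^ n) (Q0 f) = opQ (Polynomial.monomial n f) by
      rw [opQ_mon]
      ext1 m; rw [cof_opS_pow, Polynomial.coeff_X_pow_mul']] at this
    simp only [opL, LinearMap.add_apply, LinearMap.smul_apply, map_add, Polynomial.coeff_add, coeff0_PP,
      this, opN_mon, map_smul, Polynomial.coeff_smul, coeff_opP_mon, Nat.sub_zero, smul_smul]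
  rw [e1] at h0
  have e2 : ∀ f, Dop f = (2 * alpha)⁻¹ • ((opL ^ 3) (Polynomial.monomial 0 f)).coeff 0 - (bF / 2) • Eder f :=
    fun f => rfl
  rw [e2, e2, h0, Derivation.leibniz, Eder_pX]
  have h2 : (2 : F) ≠ 0 := two_ne_zero
  have ha : alpha ≠ 0 := alpha_ne
  have hh : (2 * alpha)⁻¹ * alpha = 1/2 := by field_simp
  have hh2 : (2 * alpha)⁻¹ * (alpha * alpha) = alpha/2 := by field_simp
  have k1 : ∀ p : SymA, (2 * alpha)⁻¹ • (alpha * (n:F)) • p = ((n : F)/2) • p := by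
    intro p; rw [smul_smul]; congr 1; field_simp
  rw [smul_add, k1, cn]
  have k2 : ∀ p : SymA, alpha • p = MvPolynomial.C (2 : F) * (MvPolynomial.C (alpha / 2)) * p := by
    intro p; rw [← map_mul, ← smulS]; congr 1; field_simp
  simp only [smul_eq_mul, smulS, map_mul, map_sub, map_one, map_div₀, div_eq_mul_inv]
  have h3 : (MvPolynomial.C (2⁻¹ : F) : SymA) * 2 = 1 := by
    rw [← map_ofNat (MvPolynomial.C : F →+* SymA) 2, ← map_mul, inv_mul_cancel₀ h2, map_one]
  linear_combination (MvPolynomial.C (n : F) * MvPolynomial.C alpha * (dn n) f) * h3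

lemma D_one : Dop 1 = 0 := by
  have : Dop 1 = (2 * alpha)⁻¹ • ((opL ^ 3) (Polynomial.monomial 0 1)).coeff 0 - (bF / 2) • Eder 1 := rfl
  rw [this, pow_succ, Module.End.mul_apply, L_vac]; simp

def opM : Module.End F MM := opN * opP + opQ * opN + ((bF / 2) • (opN * opN) + (-(bF / 2)) • opN)
def opDD : Module.End F MM := fib Dop + opM

lemma abs_DD_S {k A : Type*} [Field k] [CharZero k] [Ring A] [Algebra k A] (D N P Q S : A) (b : k)
    (hD : D * S = S * D) (h1 : N * S = S * N + S) (h2 : N * P * S = S * N * P + S * P)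
    (h3 : Q * S = S * Q) :
    (D + (N * P + Q * N + ((b / 2) • (N * N) + (-(b / 2)) • N))) * S =
    S * (D + (N * P + Q * N + ((b / 2) • (N * N) + (-(b / 2)) • N))) + S * (P + Q + b • N) := by
  have e3 : Q * N * S = S * Q * N + S * Q := by
    rw [mul_assoc, h1, mul_add, ← mul_assoc, h3]
  have e4 : N * N * S = S * N * N + (2 : k) • (S * N) + S := by
    rw [mul_assoc, h1, mul_add, ← mul_assoc, h1, add_mul, two_smul]; abel
  simp only [add_mul, mul_add, smul_mul_assoc, mul_smul_comm, hD, e3, e4, h1, h2,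
    smul_add, smul_smul, ← mul_assoc]
  module

lemma DD_S : opDD * opS = opS * opDD + opS * opL :=
  abs_DD_S (fib Dop) opN opP opQ opS bF (fib_S _) N_S NP_S Q_S

/-- `[𝔇,p_n]` -/
def opA (n : ℕ) : Module.End F MM :=
  mp (cn n) + (alpha * (n : F)) • fib (dn n : SymA →ₗ[F] SymA) + (alpha * (n : F)) • (opS ^ n * opN)

lemma DD_mp (n : ℕ) : opDD * mp (pX n) = mp (pX n) * opDD + opA n := by
  have h1 : fib Dop * mp (pX n) = mp (pX n) * fib Dop + mp (cn n) +
      (alpha * (n : F)) • fib (dn n : SymA →ₗ[F] SymA) := by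
    apply op_ext; intro k f
    simp only [Module.End.mul_apply, LinearMap.add_apply, LinearMap.smul_apply, mp_mon, fib_mon, D_mul,
      map_add, Polynomial.smul_monomial]
    rfl
  have h2 : opQ * opN * mp (pX n) = mp (pX n) * opQ * opN + (alpha * (n : F)) • (opS ^ n * opN) := by
    rw [mul_assoc, N_mp, ← mul_assoc, Q_mp, add_mul, smul_mul_assoc]
  have h3 : opN * opP * mp (pX n) = mp (pX n) * opN * opP := by
    rw [mul_assoc, P_mp, ← mul_assoc, N_mp]
  have h4 : opN * opN * mp (pX n) = mp (pX n) * opN * opN := by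
    rw [mul_assoc, N_mp, ← mul_assoc, N_mp]
  rw [opDD, opM, opA]
  simp only [add_mul, mul_add, smul_mul_assoc, mul_smul_comm, h1, h2, h3, h4, N_mp,
    smul_add, smul_smul, ← mul_assoc]
  abel

end

section
lemma coeff_opL_mon (k m : ℕ) (f : SymA) : (opL (Polynomial.monomial k f)).coeff m
    = pX (k - m) * f + (if k ≤ m then (Q0 f).coeff (m - k) else 0) +
      if m = k then (bF * (k : F)) • f else 0 := by
  simp only [opL, LinearMap.add_apply, LinearMap.smul_apply, Polynomial.coeff_add, coeff_opP_mon,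
    opQ_mon, opN_mon, Polynomial.coeff_smul, Polynomial.coeff_monomial, smul_smul,
    Polynomial.coeff_X_pow_mul', smul_ite, smul_zero, eq_comm]

lemma coeff_Q0_csum (n j : ℕ) : (Q0 (csum n)).coeff j = (2 * alpha * (j : F)) • pX (n - j) := by
  rw [csum, map_sum, Polynomial.finsetSum_coeff]
  have h : ∀ i ∈ Finset.range n, (Q0 (pX i * pX (n - i))).coeff j =
      (if i = n - j then (if j ≤ n then (alpha * (j : F)) • pX (n - j) else 0) else 0)
      + (if i = j then (alpha * (j : F)) • pX (n - j) else 0) := by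
    intro i hi
    have hi := Finset.mem_range.mp hi
    rw [Derivation.leibniz, Q0_pX, Q0_pX, Polynomial.coeff_add, Polynomial.coeff_smul, Polynomial.coeff_smul,
      Polynomial.coeff_smul, Polynomial.coeff_smul, Polynomial.coeff_X_pow, Polynomial.coeff_X_pow]
    congr 1
    · by_cases h1 : j = n - i
      · have h2 : i = n - j := by omega
        have h3 : j ≤ n := by omega
        rw [if_pos h1, if_pos h2, if_pos h3, ← h1, ← h2]
        simp [smul_eq_mul, mul_comm]
      · rw [if_neg h1]
        by_cases h2 : i = n - j
        · have h3 : ¬ j ≤ n := by omega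
          rw [if_pos h2, if_neg h3]; simp
        · rw [if_neg h2]; simp
    · by_cases h1 : i = j
      · subst h1; simp
      · rw [if_neg h1, if_neg (Ne.symm h1)]; simp
  rw [Finset.sum_congr rfl h, Finset.sum_add_distrib, Finset.sum_ite_eq', Finset.sum_ite_eq']
  simp only [Finset.mem_range]
  rcases Nat.eq_zero_or_pos j with rfl | hj
  · simp
  rcases Nat.lt_trichotomy j n with h1 | h1 | h1
  · rw [if_pos (by omega), if_pos h1.le, if_pos h1, ← add_smul]; congr 1; ring
  · subst h1; simp [pX_zero]
  · rw [Nat.sub_eq_zero_of_le h1.le, pX_zero]; simp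

lemma coeff_Q0_cn (n j : ℕ) : (Q0 (cn n)).coeff j = ((n : F) * alpha * (j : F)) • pX (n - j) +
    if j = n then ((n : F) / 2 * (bF * ((n : F) - 1)) * (alpha * (n : F))) • 1 else 0 := by
  rw [cn, Derivation.map_smul, map_add, Derivation.map_smul, Q0_pX, Polynomial.coeff_smul, Polynomial.coeff_add, coeff_Q0_csum,
    Polynomial.coeff_smul, Polynomial.coeff_smul, Polynomial.coeff_X_pow, smul_add, smul_smul]
  congr 1
  · congr 1; field_simp
  · split_ifs
    · rw [smul_smul, smul_smul, mul_assoc]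
    · simp

lemma coeff_opM_mon (k m : ℕ) : (opM (Polynomial.monomial k 1)).coeff m = (m : F) • pX (k - m) +
    if m = k then ((bF / 2) * ((k : F) * k - k)) • 1 else 0 := by
  simp only [opM, LinearMap.add_apply, LinearMap.smul_apply, Module.End.mul_apply, opN_mon, map_smul,
    opQ_mon, Derivation.map_one_eq_zero, mul_zero, smul_zero, Polynomial.coeff_add, cof_opN, coeff_opP_mon,
    Polynomial.coeff_smul, Polynomial.coeff_monomial, Polynomial.coeff_zero, mul_one, add_zero]
  congr 1
  by_cases h : k = m
  · subst h; simp only [if_true, smul_smul, ← add_smul]; congr 1; ring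
  · rw [if_neg h, if_neg (Ne.symm h)]; simp

lemma DD_mon (k : ℕ) : opDD (Polynomial.monomial k 1) = opM (Polynomial.monomial k 1) := by
  simp only [opDD, LinearMap.add_apply, fib_mon, D_one, map_zero, zero_add]

/-- generic ring lemmas -/
lemma abs_O_p {k A : Type*} [Field k] [Ring A] [Algebra k A] (D L p a s : A) (c : k)
    (h1 : D * p = p * D + a) (h2 : L * p = p * L + c • s) :
    (D * L - L * D) * p = p * (D * L - L * D) + (a * L - L * a + c • (D * s - s * D)) := by
  have e1 : D * L * p = p * D * L + a * L + c • (D * s) := by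
    rw [mul_assoc, h2, mul_add, ← mul_assoc, h1, add_mul, mul_smul_comm]
  have e2 : L * D * p = p * L * D + c • (s * D) + L * a := by
    rw [mul_assoc, h1, mul_add, ← mul_assoc, h2, add_mul, smul_mul_assoc]
  simp only [sub_mul, e1, e2, mul_sub, smul_sub, ← mul_assoc]
  module

lemma abs_On_p {k A : Type*} [Field k] [Ring A] [Algebra k A] (D L p p2 a a' s s' s2 : A)
    (c c' c2 κ e e' : k)
    (h1 : D * p = p * D + a') (h2 : L * p = p * L + c' • s') (h3 : a * p = p * a + κ • p2)
    (h4 : L * p2 = p2 * L + c2 • s2) (h5 : s * p = p * s) (h6 : a * s' = s' * a + e • s2)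
    (h7 : a' * s = s * a' + e' • s2) (hz : c' * e + c * e' - κ * c2 = 0) :
    (a * L - L * a + c • (D * s - s * D)) * p = p * (a * L - L * a + c • (D * s - s * D)) := by
  have e1 : a * L * p = p * a * L + κ • (p2 * L) + c' • (s' * a) + (c' * e) • s2 := by
    rw [mul_assoc, h2, mul_add, ← mul_assoc, h3, add_mul, mul_smul_comm, h6, smul_mul_assoc]; module
  have e2 : L * a * p = p * L * a + c' • (s' * a) + κ • (p2 * L) + (κ * c2) • s2 := by
    rw [mul_assoc, h3, mul_add, ← mul_assoc, h2, add_mul, mul_smul_comm, h4, smul_mul_assoc]; module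
  have e3 : D * s * p = p * D * s + s * a' + e' • s2 := by
    rw [mul_assoc, h5, ← mul_assoc, h1, add_mul, h7]; module
  have e4 : s * D * p = p * s * D + s * a' := by
    rw [mul_assoc, h1, mul_add, ← mul_assoc, h5]
  simp only [sub_mul, add_mul, smul_mul_assoc, e1, e2, e3, e4, mul_add, mul_sub, mul_smul_comm, ← mul_assoc]
  have : κ * c2 = c' * e + c * e' := by linear_combination -hz
  rw [this]
  module

lemma A_p (n m : ℕ) : opA n * mp (pX m) = mp (pX m) * opA n + (alpha * (n : F) * m) • mp (pX (n + m)) := by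
  apply op_ext; intro k f
  simp only [opA, Module.End.mul_apply, LinearMap.add_apply, LinearMap.smul_apply, mp_mon, fib_mon, map_add,
    map_smul, opN_mon, opS_pow_mon]
  ext1 j
  simp only [Polynomial.coeff_add, Polynomial.coeff_smul, Polynomial.coeff_monomial]
  have : ∀ f, (↑(dn n) : SymA →ₗ[F] SymA) f = dn n f := fun _ => rfl
  simp only [this, Derivation.leibniz, dn_pX, add_comm m n]
  by_cases h : k = j
  · by_cases h' : k + n = j
    · simp only [h, h', if_true, smulS, map_mul, smul_eq_mul]; ring
    · simp only [h, h', if_true, if_false, smulS, map_mul, smul_eq_mul]; ring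
  · by_cases h' : k + n = j
    · simp only [h, h', if_true, if_false, smulS, map_mul, smul_eq_mul]; ring
    · simp only [h, h', if_false, smulS, map_mul, smul_eq_mul]; ring

lemma A_S (n m : ℕ) : opA n * opS ^ m = opS ^ m * opA n + (alpha * (n : F) * m) • opS ^ (n + m) := by
  apply op_ext; intro k f
  simp only [opA, Module.End.mul_apply, LinearMap.add_apply, LinearMap.smul_apply, mp_mon, fib_mon, map_add,
    map_smul, opN_mon, opS_pow_mon]
  rw [show k + m + n = k + (n + m) by ring, show k + n + m = k + (n + m) by ring]
  simp only [smul_smul, add_assoc, ← add_smul]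
  congr 3
  push_cast; ring

lemma On_mon (n k : ℕ) :
    (opA n * opL - opL * opA n + (alpha * (n : F)) • (opDD * opS ^ n - opS ^ n * opDD))
      (Polynomial.monomial k 1) = 0 := by
  have hd : ∀ f, (↑(dn n) : SymA →ₗ[F] SymA) f = dn n f := fun _ => rfl
  ext1 m
  have e1 : ((opA n * opL) (Polynomial.monomial k 1)).coeff m =
      cn n * (opL (Polynomial.monomial k 1)).coeff m + (alpha * (n : F)) • ((k - m : ℕ) : F) • pX (k - m + n)
      + (alpha * (n : F)) • (if n ≤ m then ((m - n : ℕ) : F) • (opL (Polynomial.monomial k 1)).coeff (m - n) else 0) := by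
    simp only [opA, Module.End.mul_apply, LinearMap.add_apply, LinearMap.smul_apply, Polynomial.coeff_add,
      Polynomial.coeff_smul, cof_mp, cof_fib, hd, cof_opS_pow, cof_opN]
    congr 3
    rw [coeff_opL_mon_one, map_add, dn_pX]
    split_ifs <;> simp
  have e2 : ((opL * opA n) (Polynomial.monomial k 1)).coeff m =
      (opL (Polynomial.monomial k (cn n))).coeff m + (alpha * (n : F) * k) • (opL (Polynomial.monomial (k + n) 1)).coeff m := by
    simp only [opA, Module.End.mul_apply, LinearMap.add_apply, LinearMap.smul_apply, mp_mon, fib_mon, hd,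
      opN_mon, map_smul, opS_pow_mon, map_add, Polynomial.coeff_add, Polynomial.coeff_smul, smul_smul, mul_one]
    simp
  have e3 : ((opDD * opS ^ n) (Polynomial.monomial k 1)).coeff m = (opM (Polynomial.monomial (k + n) 1)).coeff m := by
    rw [Module.End.mul_apply, opS_pow_mon, DD_mon]
  have e4 : ((opS ^ n * opDD) (Polynomial.monomial k 1)).coeff m =
      if n ≤ m then (opM (Polynomial.monomial k 1)).coeff (m - n) else 0 := by
    rw [Module.End.mul_apply, DD_mon, cof_opS_pow]
  simp only [LinearMap.add_apply, LinearMap.sub_apply, LinearMap.smul_apply, Polynomial.coeff_add,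
    Polynomial.coeff_sub, Polynomial.coeff_smul, e1, e2, e3, e4]
  rw [coeff_opL_mon_one, coeff_opL_mon_one, coeff_opL_mon_one, coeff_opL_mon, coeff_opM_mon, coeff_opM_mon, coeff_Q0_cn]
  rw [Polynomial.coeff_zero]
  have h2 : (MvPolynomial.C (2⁻¹ : F) : SymA) * 2 = 1 := by
    rw [← map_ofNat (MvPolynomial.C : F →+* SymA) 2, ← map_mul, inv_mul_cancel₀ two_ne_zero, map_one]
  rcases Nat.lt_or_ge m k with hm | hm
  · have a1 : k - m + n = k + n - m := by omega
    rw [if_neg (by omega : ¬ m = k), if_neg (by omega : ¬ k ≤ m), if_neg (by omega : ¬ m = k), if_neg (by omega : ¬ m = k + n),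
       if_neg (by omega : ¬ m = k + n), a1]
    by_cases hn : n ≤ m
    · have a2 : k - (m - n) = k + n - m := by omega
      rw [if_pos hn, if_pos hn, if_neg (by omega : ¬ m - n = k), if_neg (by omega : ¬ m - n = k), a2]
      rw [Nat.cast_sub hm.le, Nat.cast_sub hn]
      simp only [smulS, map_mul, map_sub]
      ring
    · rw [if_neg hn, if_neg hn, Nat.cast_sub hm.le]
      simp only [smulS, map_mul, map_sub]
      ring
  · obtain ⟨d, rfl⟩ := Nat.exists_eq_add_of_le hm
    rw [if_pos (by omega : k ≤ k + d), Nat.sub_eq_zero_of_le hm, Nat.add_sub_cancel_left]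
    rw [pX_zero, Nat.cast_zero]
    have key : cn n * (0 + if k + d = k then (bF * (k : F)) • (1 : SymA) else 0) =
        if k + d = k then (bF * (k : F)) • cn n else 0 := by
      split_ifs
      · rw [zero_add, mul_smul_comm, mul_one]
      · simp
    rw [key, Nat.add_sub_add_left]
    by_cases hd' : d = n
    · subst hd'
      rw [if_pos (by omega : d ≤ k + d), if_pos (by omega : d ≤ k + d), Nat.add_sub_cancel, Nat.sub_self, Nat.sub_self, pX_zero]
      simp only [if_true]
      simp only [smulS, map_mul, map_sub, map_add, map_one, map_zero, div_eq_mul_inv, Nat.cast_add]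
      linear_combination (MvPolynomial.C alpha * MvPolynomial.C (d:F) * MvPolynomial.C bF *
         MvPolynomial.C (d:F) * MvPolynomial.C (k:F)) * h2
    · rw [if_neg hd', if_neg (by omega : ¬ k + d = k + n), if_neg (by omega : ¬ k + d = k + n)]
      by_cases hn : n ≤ k + d
      · have a2 : k - (k + d - n) = n - d := by omega
        rw [if_pos hn, if_pos hn, if_neg (by omega : ¬ k + d - n = k), if_neg (by omega : ¬ k + d - n = k), a2]
        simp only [smulS, map_mul, map_sub, map_add, Nat.cast_add, map_zero]
        ring
      · rw [if_neg hn, if_neg hn]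
        simp only [smulS, map_mul, map_sub, map_add, Nat.cast_add, map_zero]
        ring

lemma csum_symm (d : ℕ) : (2 : F) • ∑ i ∈ Finset.range d, (i : F) • (pX i * pX (d - i)) = (d : F) • csum d := by
  have h1 : ∑ i ∈ Finset.range d, (i : F) • (pX i * pX (d - i)) =
      ∑ i ∈ Finset.range (d + 1), (i : F) • (pX i * pX (d - i)) := by
    rw [Finset.sum_range_succ]; simp [pX_zero]
  have h2 : csum d = ∑ i ∈ Finset.range (d + 1), pX i * pX (d - i) := by
    rw [csum, Finset.sum_range_succ]; simp [pX_zero]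
  have h3 := Finset.sum_range_reflect (fun i => (i : F) • (pX i * pX (d - i))) (d + 1)
  rw [h1, two_smul, h2, Finset.smul_sum]
  nth_rewrite 1 [← h3]
  rw [← Finset.sum_add_distrib]
  refine Finset.sum_congr rfl fun i hi => ?_
  have hi := Finset.mem_range.mp hi
  rw [show d + 1 - 1 - i = d - i by omega, show d - (d - i) = i by omega, mul_comm (pX (d - i)), ← add_smul,
    Nat.cast_sub (by omega)]
  congr 1; ring

lemma L_mon_one (k : ℕ) : opL (Polynomial.monomial k 1) =
    ∑ j ∈ Finset.range k, Polynomial.monomial j (pX (k - j)) + (bF * (k : F)) • Polynomial.monomial k 1 := by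
  simp [opL, opP_mon, smul_smul]

lemma M_mon_one (k : ℕ) : opM (Polynomial.monomial k 1) =
    ∑ j ∈ Finset.range k, (j : F) • Polynomial.monomial j (pX (k - j)) +
      ((bF / 2) * ((k : F) * k - k)) • Polynomial.monomial k 1 := by
  simp only [opM, LinearMap.add_apply, LinearMap.smul_apply, Module.End.mul_apply, opN_mon, map_smul, opP_mon,
    map_sum, mul_one, opQ_mon, Derivation.map_one_eq_zero, mul_zero, smul_zero, add_zero]
  rw [smul_smul, smul_smul, smul_smul, ← add_smul]
  congr 2; ring

lemma DD_pmon (i j : ℕ) : opDD (Polynomial.monomial j (pX i)) = mp (pX i) (opM (Polynomial.monomial j 1)) +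
    Polynomial.monomial j (cn i) + (alpha * (i : F) * j) • Polynomial.monomial (j + i) 1 := by
  have := LinearMap.congr_fun (DD_mp i) (Polynomial.monomial j 1)
  simp only [Module.End.mul_apply, LinearMap.add_apply, mp_mon, mul_one, DD_mon] at this
  rw [this, opA]
  have hd : ∀ f, (↑(dn i) : SymA →ₗ[F] SymA) f = dn i f := fun _ => rfl
  simp only [LinearMap.add_apply, LinearMap.smul_apply, Module.End.mul_apply, mp_mon, fib_mon, hd,
    Derivation.map_one_eq_zero, map_zero, smul_zero, add_zero, opN_mon, map_smul, opS_pow_mon, mul_one, smul_smul]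
  rw [add_assoc]

lemma L_pmon (i j : ℕ) : opL (Polynomial.monomial j (pX i)) = mp (pX i) (opL (Polynomial.monomial j 1)) +
    (alpha * (i : F)) • Polynomial.monomial (j + i) 1 := by
  have := LinearMap.congr_fun (L_mp i) (Polynomial.monomial j 1)
  simpa only [Module.End.mul_apply, LinearMap.add_apply, LinearMap.smul_apply, mp_mon, mul_one, opS_pow_mon] using this

/-- the operator `[𝔇,ℒ]` kills `y_k` -/
lemma O_mon (k : ℕ) : (opDD * opL - opL * opDD) (Polynomial.monomial k 1) = 0 := by
  rw [LinearMap.sub_apply, Module.End.mul_apply, Module.End.mul_apply, DD_mon, L_mon_one, map_add, map_sum,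
    M_mon_one, map_add opL, map_sum opL, map_smul, map_smul opL, DD_mon]
  have e1 : ∑ j ∈ Finset.range k, opDD (Polynomial.monomial j (pX (k - j))) =
    ∑ j ∈ Finset.range k, (mp (pX (k - j)) (opM (Polynomial.monomial j 1)) + Polynomial.monomial j (cn (k - j))) +
    ∑ j ∈ Finset.range k, (alpha * ((k - j : ℕ) : F) * j) • Polynomial.monomial k 1 := by
    rw [← Finset.sum_add_distrib]
    refine Finset.sum_congr rfl fun j hj => ?_
    have hj := Finset.mem_range.mp hj
    rw [DD_pmon, show j + (k - j) = k by omega]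
  have e2 : ∑ j ∈ Finset.range k, opL ((j : F) • Polynomial.monomial j (pX (k - j))) =
    ∑ j ∈ Finset.range k, (j : F) • (mp (pX (k - j)) (opL (Polynomial.monomial j 1))) +
    ∑ j ∈ Finset.range k, (alpha * ((k - j : ℕ) : F) * j) • Polynomial.monomial k 1 := by
    rw [← Finset.sum_add_distrib]
    refine Finset.sum_congr rfl fun j hj => ?_
    have hj := Finset.mem_range.mp hj
    rw [map_smul, L_pmon, show j + (k - j) = k by omega, smul_add, smul_smul]
    congr 2; ring
  rw [e1, e2]
  ext1 m
  simp only [Polynomial.coeff_add, Polynomial.coeff_sub, Polynomial.coeff_zero, Polynomial.finsetSum_coeff,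
    Polynomial.coeff_smul, cof_mp, coeff_opM_mon, coeff_opL_mon_one, Polynomial.coeff_monomial]
  rw [Finset.sum_add_distrib, Finset.sum_ite_eq']
  rcases Nat.lt_or_ge m k with hm | hm
  · rw [if_neg (by omega : ¬ m = k), if_neg (by omega : ¬ m = k), if_pos (Finset.mem_range.mpr hm)]
    have s1 : ∑ j ∈ Finset.range k, pX (k - j) * ((m : F) • pX (j - m) + if m = j then (bF / 2 * ((j : F) * j - j)) • 1 else 0)
       - ∑ j ∈ Finset.range k, (j : F) • (pX (k - j) * (pX (j - m) + if m = j then (bF * (j : F)) • 1 else 0))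
       = - ∑ j ∈ Finset.range k, ((j : F) - m) • (pX (j - m) * pX (k - j)) +
         (bF / 2 * ((m : F) * m - m) - bF * (m : F) * m) • pX (k - m) := by
      rw [← Finset.sum_sub_distrib]
      have : ∀ j ∈ Finset.range k, pX (k - j) * ((m : F) • pX (j - m) + if m = j then (bF / 2 * ((j : F) * j - j)) • 1 else 0)
       - (j : F) • (pX (k - j) * (pX (j - m) + if m = j then (bF * (j : F)) • 1 else 0))
        = - (((j : F) - m) • (pX (j - m) * pX (k - j))) + if m = j then
         (bF / 2 * ((m : F) * m - m) - bF * (m : F) * m) • pX (k - m) else 0 := by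
        intro j _
        by_cases h : m = j
        · subst h; simp only [if_true, smulS, map_sub, map_mul, mul_one]; ring
        · simp only [if_neg h, smulS, map_sub]; ring
      rw [Finset.sum_congr rfl this, Finset.sum_add_distrib, Finset.sum_neg_distrib, Finset.sum_ite_eq,
        if_pos (Finset.mem_range.mpr hm)]
    have s2 : ∑ j ∈ Finset.range k, ((j : F) - m) • (pX (j - m) * pX (k - j)) =
        ((k - m : ℕ) / 2 : F) • csum (k - m) := by
      have := csum_symm (k - m)
      rw [div_eq_inv_mul, mul_smul, ← this, smul_smul, inv_mul_cancel₀ two_ne_zero, one_smul]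
      obtain ⟨d, rfl⟩ := Nat.exists_eq_add_of_le hm.le
      rw [Finset.sum_range_add]
      have z : ∑ x ∈ Finset.range m, ((x : F) - m) • (pX (x - m) * pX (m + d - x)) = 0 := by
        apply Finset.sum_eq_zero; intro x hx
        have := Finset.mem_range.mp hx
        rw [Nat.sub_eq_zero_of_le (by omega), pX_zero]; simp
      rw [z, zero_add, Nat.add_sub_cancel_left]
      refine Finset.sum_congr rfl fun i _ => ?_
      rw [Nat.add_sub_cancel_left, Nat.add_sub_add_left]; congr 1; push_cast; ring
    rw [s2] at s1
    rw [cn]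
    rw [sub_eq_iff_eq_add] at s1
    rw [s1, Nat.cast_sub hm.le]
    generalize Finset.sum (Finset.range k) (fun j => (j : F) • (pX (k - j) * (pX (j - m) + if m = j then (bF * (j : F)) • 1 else 0))) = T1
    generalize (Finset.sum (Finset.range k) _ : SymA) = T2
    have h2 : (MvPolynomial.C (2⁻¹ : F) : SymA) * 2 = 1 := by
      rw [← map_ofNat (MvPolynomial.C : F →+* SymA) 2, ← map_mul, inv_mul_cancel₀ two_ne_zero, map_one]
    simp only [smulS, map_mul, map_sub, map_add, map_one, div_eq_mul_inv]
    linear_combination (MvPolynomial.C bF * pX (k-m) * (MvPolynomial.C (m:F)^2 - MvPolynomial.C (m : F) * MvPolynomial.C (k:F))) * h2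
  · rw [if_neg (by simpa using hm), Nat.sub_eq_zero_of_le hm, pX_zero]
    have z1 : ∀ x ∈ Finset.range k, pX (k - x) * ((m : F) • pX (x - m) + if m = x then (bF / 2 * ((x : F) * x - x)) • 1 else 0) = 0 := by
      intro x hx
      have := Finset.mem_range.mp hx
      rw [Nat.sub_eq_zero_of_le (by omega : x ≤ m), pX_zero, if_neg (by omega)]; simp
    have z2 : ∀ x ∈ Finset.range k, (x : F) • (pX (k - x) * (pX (x - m) + if m = x then (bF * (x : F)) • 1 else 0)) = 0 := by
      intro x hx
      have := Finset.mem_range.mp hx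
      rw [Nat.sub_eq_zero_of_le (by omega : x ≤ m), pX_zero, if_neg (by omega)]; simp
    rw [Finset.sum_eq_zero z1, Finset.sum_eq_zero z2]
    by_cases h : k = m
    · subst h
      simp only [if_true]
      generalize (Finset.sum (Finset.range k) _ : SymA) = T2
      simp only [smulS, map_mul, map_sub]; ring
    · rw [if_neg h, if_neg (Ne.symm h), if_neg (Ne.symm h)]; simp

lemma DD_L : opDD * opL = opL * opDD := by
  have h : opDD * opL - opL * opDD = 0 := by
    apply op_zero_of_comm _ O_mon
    intro n
    have hn : opA n * opL - opL * opA n + (alpha * (n : F)) • (opDD * opS ^ n - opS ^ n * opDD) = 0 := by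
      apply op_zero_of_comm _ (On_mon n)
      intro m
      exact abs_On_p opDD opL (mp (pX m)) (mp (pX (n + m))) (opA n) (opA m) (opS ^ n) (opS ^ m) (opS ^ (n + m))
        (alpha * (n : F)) (alpha * (m : F)) (alpha * ((n + m : ℕ) : F)) (alpha * (n : F) * m) (alpha * (n : F) * m)
        (alpha * (m : F) * n) (DD_mp m) (L_mp m) (A_p n m) (L_mp (n + m)) (Spow_mp n _) (A_S n m)
        (by rw [add_comm n m]; exact A_S m n) (by push_cast; ring)
    have := abs_O_p opDD opL (mp (pX n)) (opA n) (opS ^ n) (alpha * (n : F)) (DD_mp n) (L_mp n)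
    rw [hn] at this
    rw [this, add_zero]
  exact sub_eq_zero.mp h

end

section
def b1 (u : F) : Module.End F SymA := (u / alpha) • mS (pX 1) + (dn 1 : SymA →ₗ[F] SymA)
def opX (u : F) : Module.End F MM := fib (b1 u) + opS * opN
def opK (u : F) : Module.End F MM := opS * (opL + u • 1)
def Bop (n : ℕ) (u : F) : Module.End F SymA := alpha⁻¹ • (cof 0 ∘ₗ (opL * opK u ^ n) ∘ₗ vac)

lemma dn_coe (n : ℕ) (f) : (↑(dn n) : SymA →ₗ[F] SymA) f = dn n f := rfl

def opX0 : Module.End F MM := fib (dn 1 : SymA →ₗ[F] SymA) + opS * opN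

lemma X0_mp (n : ℕ) : opX0 * mp (pX n) = mp (pX n) * opX0 + (n : F) • mp (pX (n + 1)) := by
  apply op_ext; intro k f
  simp only [opX0, Module.End.mul_apply, LinearMap.add_apply, LinearMap.smul_apply, mp_mon, fib_mon, dn_coe,
    Derivation.leibniz, dn_pX, opN_mon, map_smul, opS_mon, map_add, smul_eq_mul]
  rw [mul_smul_comm, mul_comm f, Polynomial.smul_monomial, Polynomial.smul_monomial]
  abel

lemma X0_S (n : ℕ) : opX0 * opS ^ n = opS ^ n * opX0 + (n : F) • opS ^ (n + 1) := by
  apply op_ext; intro k f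
  simp only [opX0, Module.End.mul_apply, LinearMap.add_apply, LinearMap.smul_apply, fib_mon, opN_mon, map_smul,
    opS_mon, map_add, opS_pow_mon]
  rw [show k + n + 1 = k + (n + 1) by ring, show k + 1 + n = k + (n + 1) by ring, Nat.cast_add, add_smul]
  abel

lemma abs_X0 {k A : Type*} [Field k] [Ring A] [Algebra k A] (X L S p p' s s' : A) (c n c' : k)
    (h1 : X * p = p * X + n • p') (h2 : L * p = p * L + c • s) (h3 : L * p' = p' * L + c' • s')
    (h4 : X * s = s * X + n • s') (h5 : S * p = p * S) (h6 : S * s = s') (hz : c * n + c - n * c' = 0) :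
    (X * L - L * X + S * L) * p = p * (X * L - L * X + S * L) := by
  have e1 : X * L * p = p * X * L + n • (p' * L) + c • (s * X) + (c * n) • s' := by
    rw [mul_assoc, h2, mul_add, ← mul_assoc, h1, add_mul, mul_smul_comm, h4, smul_mul_assoc]; module
  have e2 : L * X * p = p * L * X + c • (s * X) + n • (p' * L) + (n * c') • s' := by
    rw [mul_assoc, h1, mul_add, ← mul_assoc, h2, add_mul, mul_smul_comm, h3, smul_mul_assoc]; module
  have e3 : S * L * p = p * S * L + c • s' := by
    rw [mul_assoc, h2, mul_add, ← mul_assoc, h5, mul_smul_comm, h6]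
  simp only [sub_mul, add_mul, e1, e2, e3, mul_add, mul_sub, ← mul_assoc]
  have : n * c' = c * n + c := by linear_combination -hz
  rw [this]
  module

lemma abs_e {A : Type*} [AddCommGroup A] (a b c : A) (h : a - b + c = 0) : a = b - c := by
  have : a = (a - b + c) + b - c := by abel
  rw [this, h, zero_add]

lemma X0_L : opX0 * opL = opL * opX0 - opS * opL := by
  have : opX0 * opL - opL * opX0 + opS * opL = 0 := by
    apply op_zero_of_comm
    · intro n
      exact abs_X0 opX0 opL opS (mp (pX n)) (mp (pX (n + 1))) (opS ^ n) (opS ^ (n + 1)) (alpha * (n : F)) n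
        (alpha * ((n + 1 : ℕ) : F)) (X0_mp n) (L_mp n) (L_mp (n + 1)) (X0_S n) (S_mp _) (pow_succ' _ _).symm
        (by push_cast; ring)
    · intro k
      ext1 m
      have e1 : ((opX0 * opL) (Polynomial.monomial k 1)).coeff m =
          ((k - m : ℕ) : F) • pX (k - m + 1) + if 1 ≤ m then ((m - 1 : ℕ) : F) • (opL (Polynomial.monomial k 1)).coeff (m - 1) else 0 := by
        rw [opX0, Module.End.mul_apply, LinearMap.add_apply, Polynomial.coeff_add, cof_fib, dn_coe, coeff_opL_mon_one,
          Module.End.mul_apply, ← pow_one opS, cof_opS_pow, cof_opN, map_add, dn_pX]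
        congr 1
        split_ifs <;> simp
      have e2 : ((opL * opX0) (Polynomial.monomial k 1)).coeff m = (k : F) • (opL (Polynomial.monomial (k + 1) 1)).coeff m := by
        simp only [opX0, Module.End.mul_apply, LinearMap.add_apply, fib_mon, dn_coe, Derivation.map_one_eq_zero,
          map_zero, zero_add, opN_mon, map_smul, opS_mon, Polynomial.coeff_smul]
      have e3 : ((opS * opL) (Polynomial.monomial k 1)).coeff m = if 1 ≤ m then (opL (Polynomial.monomial k 1)).coeff (m - 1) else 0 := by
        rw [Module.End.mul_apply, ← pow_one opS, cof_opS_pow]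
      rw [LinearMap.add_apply, LinearMap.sub_apply, Polynomial.coeff_add, Polynomial.coeff_sub, e1, e2, e3,
        coeff_opL_mon_one, coeff_opL_mon_one, Polynomial.coeff_zero]
      rcases m with _ | m
      · rw [if_neg (by omega), if_neg (by omega), if_neg (by omega), Nat.sub_zero, Nat.sub_zero]; simp
      · rw [if_pos (by omega : 1 ≤ m + 1), if_pos (by omega : 1 ≤ m + 1), Nat.add_sub_cancel, Nat.add_sub_add_right]
        rcases Nat.lt_trichotomy m k with h | h | h
        · rw [if_neg (by omega : ¬ m = k), if_neg (by omega : ¬ m + 1 = k + 1), show k - (m + 1) + 1 = k - m by omega, Nat.cast_sub (by omega)]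
          simp only [smulS, map_sub]; push_cast; simp only [map_add, map_one]; ring
        · subst h
          rw [if_pos rfl, if_pos rfl, Nat.sub_self, pX_zero, Nat.sub_eq_zero_of_le (by omega)]
          simp only [smulS, map_mul, map_zero, Nat.cast_add, map_add, Nat.cast_zero, Nat.cast_one, map_one]; ring
        · rw [if_neg (by omega : ¬ m = k), if_neg (by omega : ¬ m + 1 = k + 1), Nat.sub_eq_zero_of_le (by omega), Nat.sub_eq_zero_of_le (by omega), pX_zero]
          simp
  exact abs_e (opX0 * opL) (opL * opX0) (opS * opL) this

lemma opX_eq (u : F) : opX u = (u / alpha) • mp (pX 1) + opX0 := by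
  rw [opX, opX0, b1, fib_add, fib_smul, fib_mS, add_assoc]

lemma abs_X {k A : Type*} [Field k] [Ring A] [Algebra k A] (X L S p : A) (u a : k) (ha : a ≠ 0)
    (h1 : X * L = L * X - S * L) (h2 : L * p = p * L + a • S) :
    ((u / a) • p + X) * L = L * ((u / a) • p + X) - S * (L + u • 1) := by
  simp only [add_mul, mul_add, h1, smul_mul_assoc, mul_smul_comm, h2, smul_add, smul_smul,
    div_mul_cancel₀ u ha, mul_one]
  abel

lemma X_L (u : F) : opX u * opL = opL * opX u - opK u := by
  rw [opX_eq, opK]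
  have := L_mp 1
  rw [Nat.cast_one, mul_one, pow_one] at this
  exact abs_X opX0 opL opS (mp (pX 1)) u alpha alpha_ne X0_L this

lemma X_S (u : F) : opX u * opS = opS * opX u + opS * opS := by
  have := X0_S 1
  rw [Nat.cast_one, one_smul, pow_one, pow_two] at this
  rw [opX_eq, add_mul, this, mul_add, smul_mul_assoc, mul_smul_comm, S_mp]
  abel

lemma abs_Y {k A : Type*} [Field k] [Ring A] [Algebra k A] (X L S D : A) (u : k)
    (h1 : X * L = L * X - S * (L + u • 1)) (h2 : X * S = S * X + S * S)
    (h3 : D * S = S * D + S * L) (h4 : D * L = L * D) (n : ℕ) :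
    (D * X - X * D) * (L * (S * (L + u • 1)) ^ n) = L * (S * (L + u • 1)) ^ n * (D * X - X * D) +
      (n : k) • (L * (S * (L + u • 1)) ^ (n + 1)) - (S * (L + u • 1)) * (L * (S * (L + u • 1)) ^ n) := by
  generalize hK : S * (L + u • 1) = K at *
  have hXL' : X * (L + u • 1) = (L + u • 1) * X - K := by
    rw [mul_add, h1, add_mul, mul_smul_comm, smul_mul_assoc, mul_one, one_mul]; abel
  have hXK : X * K = K * X := by
    rw [← hK, ← mul_assoc, h2, add_mul, mul_assoc S X, hXL', mul_sub, ← hK, mul_assoc S S]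
    simp only [mul_assoc]; abel
  have hDK : D * K = K * D + K * L := by
    rw [← hK, ← mul_assoc, h3, add_mul, mul_assoc S D, mul_add D, h4]
    simp only [mul_add, add_mul, mul_smul_comm, smul_mul_assoc, mul_one, mul_assoc]
  have hYK : (D * X - X * D) * K = K * (D * X - X * D) + K * K := by
    have e1 : D * X * K = K * D * X + K * L * X := by
      rw [mul_assoc, hXK, ← mul_assoc, hDK, add_mul]
    have e2 : X * D * K = K * X * D + K * L * X - K * K := by
      rw [mul_assoc, hDK, mul_add, ← mul_assoc, ← mul_assoc, hXK, mul_assoc K X L, h1, mul_sub, mul_assoc K L X]; abel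
    rw [sub_mul, e1, e2, mul_sub]; simp only [mul_assoc]; abel
  have hYL : (D * X - X * D) * L = L * (D * X - X * D) - K * L := by
    have e1 : D * X * L = L * D * X - K * D - K * L := by
      rw [mul_assoc, h1, mul_sub, ← mul_assoc, h4, hDK]; abel
    have e2 : X * D * L = L * X * D - K * D := by
      rw [mul_assoc, h4, ← mul_assoc, h1, sub_mul]
    rw [sub_mul, e1, e2, mul_sub]; simp only [mul_assoc]; abel
  generalize D * X - X * D = Y at *
  have hYKn : ∀ n : ℕ, Y * K ^ n = K ^ n * Y + (n : k) • K ^ (n + 1) := by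
    intro n
    induction n with
    | zero => simp
    | succ n ih =>
      rw [pow_succ, ← mul_assoc, ih, add_mul, mul_assoc, hYK, mul_add, smul_mul_assoc, ← pow_succ, ← mul_assoc,
       ← mul_assoc, ← pow_succ, ← pow_succ, add_assoc, Nat.cast_succ, add_smul, one_smul]
      rw [add_comm (K ^ (n+1+1))]
  rw [← mul_assoc, hYL, sub_mul, mul_assoc, hYKn, mul_add, mul_smul_comm, mul_assoc K L]
  simp only [mul_assoc]

lemma cof0_X (u : F) (p : MM) : (opX u p).coeff 0 = b1 u (p.coeff 0) := by
  simp only [opX, LinearMap.add_apply, Module.End.mul_apply, Polynomial.coeff_add, cof_fib, cof_opS_zero, add_zero]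
lemma X_vac (u : F) (f : SymA) : opX u (Polynomial.monomial 0 f) = Polynomial.monomial 0 (b1 u f) := by
  simp only [opX, LinearMap.add_apply, Module.End.mul_apply, fib_mon, N_vac, map_zero, add_zero]
lemma cof0_DD (p : MM) : (opDD p).coeff 0 = Dop (p.coeff 0) := by
  simp only [opDD, opM, LinearMap.add_apply, LinearMap.smul_apply, Module.End.mul_apply, Polynomial.coeff_add, cof_fib,
    cof_opN, cof_opQ_zero, Polynomial.coeff_smul]
  simp
lemma DD_vac (f : SymA) : opDD (Polynomial.monomial 0 f) = Polynomial.monomial 0 (Dop f) := by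
  simp only [opDD, opM, LinearMap.add_apply, LinearMap.smul_apply, Module.End.mul_apply, fib_mon, N_vac, P_vac, map_zero,
    smul_zero, add_zero]

def Gop (u : F) : Module.End F SymA := Dop * b1 u - b1 u * Dop

lemma Bop_apply (n : ℕ) (u : F) (f : SymA) :
    Bop n u f = alpha⁻¹ • ((opL * opK u ^ n) (Polynomial.monomial 0 f)).coeff 0 := rfl

lemma G_B (n : ℕ) (u : F) : Gop u * Bop n u = Bop n u * Gop u + (n : F) • Bop (n + 1) u := by
  refine LinearMap.ext fun f => ?_
  have h := LinearMap.congr_fun (abs_Y (opX u) opL opS opDD u (X_L u) (X_S u) DD_S DD_L n) (Polynomial.monomial 0 f)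
  have h0 := congrArg (fun p : MM => p.coeff 0) h
  change Polynomial.coeff ((opDD * opX u - opX u * opDD) ((opL * opK u ^ n) (Polynomial.monomial 0 f))) 0 =
    Polynomial.coeff ((opL * opK u ^ n) ((opDD * opX u - opX u * opDD) (Polynomial.monomial 0 f)) +
      (n : F) • (opL * opK u ^ (n + 1)) (Polynomial.monomial 0 f) -
      opS ((opL + u • 1) ((opL * opK u ^ n) (Polynomial.monomial 0 f)))) 0 at h0
  have e : (opDD * opX u - opX u * opDD) (Polynomial.monomial 0 f) = Polynomial.monomial 0 (Gop u f) := by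
    simp only [LinearMap.sub_apply, Module.End.mul_apply, X_vac, DD_vac, Gop, map_sub]
  rw [e, Polynomial.coeff_sub, cof_opS_zero, sub_zero, Polynomial.coeff_add, Polynomial.coeff_smul] at h0
  have e2 : ∀ q, ((opDD * opX u - opX u * opDD) q).coeff 0 = Gop u (q.coeff 0) := fun q => by
    simp only [LinearMap.sub_apply, Module.End.mul_apply, Polynomial.coeff_sub, cof0_X, cof0_DD, Gop]
  rw [e2] at h0
  rw [LinearMap.add_apply, Module.End.mul_apply, Module.End.mul_apply, LinearMap.smul_apply, Bop_apply, Bop_apply,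
    Bop_apply, map_smul, h0, smul_add, smul_comm (n : F)]

lemma Bop_one (u : F) : Bop 1 u = b1 u := by
  refine LinearMap.ext fun f => ?_
  rw [Bop_apply, pow_one, Module.End.mul_apply, opK, Module.End.mul_apply, LinearMap.add_apply, L_vac, cof0_L,
    LinearMap.smul_apply, Module.End.one_apply, map_add, map_add, map_smul, map_smul, opS_mon, Polynomial.coeff_add,
    Polynomial.coeff_smul, coeff_opP_mon, Nat.sub_zero, zero_add]
  have := coeff0_PSQ 1 f
  rw [pow_one] at this
  rw [this, smul_add, smul_smul, inv_mul_cancel₀ alpha_ne, one_smul, smul_smul, add_comm, b1, LinearMap.add_apply,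
    LinearMap.smul_apply, mS_apply, dn_coe, inv_mul_eq_div]

end

section
lemma coeff_Q0 (f : SymA) (j : ℕ+) : (Q0 f).coeff (j : ℕ) = (alpha * ((j : ℕ) : F)) • MvPolynomial.pderiv j f := by
  induction f using MvPolynomial.induction_on with
  | C a => simp [Q0]
  | add p q hp hq => simp only [map_add, Polynomial.coeff_add, hp, hq, smul_add]
  | mul_X p i hp =>
    rw [Derivation.leibniz, Derivation.leibniz, ← pX_pnat, Q0_pX, Polynomial.smul_eq_C_mul, Polynomial.smul_eq_C_mul,
      Polynomial.coeff_add, Polynomial.coeff_C_mul, Polynomial.coeff_C_mul, hp, Polynomial.coeff_smul,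
      Polynomial.coeff_X_pow, pX_pnat, MvPolynomial.pderiv_X]
    by_cases h : i = j
    · subst h
      simp only [smul_eq_mul, smulS, if_true, Pi.single_eq_same]; ring
    · rw [if_neg (by rw [PNat.coe_inj]; exact fun h' => h h'.symm), Pi.single_eq_of_ne h]
      simp only [smul_eq_mul, smulS]; ring

def ren : SymA →ₐ[F] PY := MvPolynomial.rename Sum.inl
lemma pd_ren (j : ℕ+) (f : SymA) : MvPolynomial.pderiv (Sum.inl j) (ren f) = ren (MvPolynomial.pderiv j f) := by
  rw [ren, MvPolynomial.pderiv_rename Sum.inl_injective]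
lemma pd_ren' (j : ℕ) (f : SymA) : MvPolynomial.pderiv (Sum.inr j) (ren f) = 0 := by
  induction f using MvPolynomial.induction_on with
  | C a => simp [ren]
  | add p q hp hq => simp only [map_add, hp, hq, add_zero]
  | mul_X p i hp => 
    rw [map_mul, Derivation.leibniz, hp, ren, MvPolynomial.rename_X, MvPolynomial.pderiv_X, Pi.single_eq_of_ne (by simp)]
    simp

def iota : MM →ₗ[F] PY := Polynomial.lsum fun k => LinearMap.mulLeft F (yv k) ∘ₗ ren.toLinearMap
lemma iota_mon (k : ℕ) (f : SymA) : iota (Polynomial.monomial k f) = yv k * ren f := by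
  simp [iota, Polynomial.lsum_apply]
lemma sumrep {A : Type*} [AddCommMonoid A] [Module F A] (O : MM →ₗ[F] A) (p : MM) :
    O p = ∑ᶠ k : ℕ, O (Polynomial.monomial k (p.coeff k)) := by
  rw [finsum_eq_sum_of_support_subset (s := p.support), ← map_sum, ← Polynomial.as_sum_support p]
  intro k hk
  simp only [Function.mem_support, ne_eq] at hk
  simp only [Finset.mem_coe, Polynomial.mem_support_iff]
  rintro h; exact hk (by rw [h]; simp)
lemma pd_iota (j : ℕ) (p : MM) : MvPolynomial.pderiv (Sum.inr j) (iota p) = ren (p.coeff j) := by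
  induction p using Polynomial.induction_on' with
  | add p q hp hq => simp [hp, hq]
  | monomial k f => 
    rw [iota_mon, Derivation.leibniz, pd_ren', yv, MvPolynomial.pderiv_X, Polynomial.coeff_monomial]
    by_cases h : k = j
    · subst h; simp
    · rw [if_neg h, Pi.single_eq_of_ne (by simpa using h)]; simp
lemma iota_S (p : MM) : iota (opS p) = ∑ᶠ j : ℕ, yv (j + 1) * ren (p.coeff j) := by
  have := sumrep (iota ∘ₗ opS) p
  simp only [LinearMap.comp_apply, opS_mon, iota_mon] at this
  exact this
lemma Yplus_iota (p : MM) : Yplus (iota p) = iota (opS p) := by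
  simp only [Yplus, pd_iota, iota_S]

lemma finsum_inj {A ι κ : Type*} [AddCommMonoid A] (e : ι → κ) (he : Function.Injective e) (g : κ → A)
    (h : ∀ x, x ∉ Set.range e → g x = 0) : ∑ᶠ i, g (e i) = ∑ᶠ x, g x := by
  rw [← finsum_mem_range he, ← finsum_mem_univ g]
  apply finsum_mem_inter_support_eq
  ext x
  simp only [Set.mem_inter_iff, Function.mem_support, Set.mem_univ, true_and]
  constructor
  · exact fun h => h.2
  · intro hx; exact ⟨by by_contra h'; exact hx (h x h'), hx⟩
lemma finsum_pnat {A : Type*} [AddCommMonoid A] (g : ℕ → A) (h : g 0 = 0) : ∑ᶠ i : ℕ+, g (i : ℕ) = ∑ᶠ n, g n := by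
  apply finsum_inj _ PNat.coe_injective
  intro x hx
  rcases Nat.eq_zero_or_pos x with rfl | hp
  · exact h
  · exact absurd ⟨⟨x, hp⟩, rfl⟩ hx
lemma finsum_pnat' {A : Type*} [AddCommMonoid A] (g : ℕ → A) : ∑ᶠ i : ℕ+, g ((i : ℕ) - 1) = ∑ᶠ n, g n :=
  finsum_comp_equiv (f := g) Equiv.pnatEquivNat

lemma coeff_P (p : MM) (m : ℕ) : (opP p).coeff m = ∑ᶠ j : ℕ, pX j * p.coeff (m + j) := by
  have := sumrep (cof m ∘ₗ opP) p
  simp only [LinearMap.comp_apply, cof_apply, coeff_opP_mon] at this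
  rw [this, ← finsum_inj (fun j => m + j) (fun a b h => by simpa using h)]
  · simp
  · intro x hx
    have : x < m := by
      by_contra h; exact hx ⟨x - m, by simp; omega⟩
    rw [Nat.sub_eq_zero_of_le this.le, pX_zero, zero_mul]

lemma supp_fin (p : MM) (m : ℕ) : {j | p.coeff (m + j) ≠ 0}.Finite := by
  refine Set.Finite.subset (Finset.range (p.natDegree + 1)).finite_toSet fun j hj => ?_
  have := Polynomial.le_natDegree_of_ne_zero hj
  simp; omega
lemma ren_P (p : MM) (m : ℕ) : ren ((opP p).coeff m) = ∑ᶠ j : ℕ, ren (pX j) * ren (p.coeff (m + j)) := by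
  rw [coeff_P]
  refine (AddMonoidHom.map_finsum (ren : SymA →+ PY) ?_).trans ?_
  · refine (supp_fin p m).subset fun j hj => ?_
    simp only [Function.mem_support] at hj
    exact right_ne_zero_of_mul hj
  · simp

lemma dropTheta_iota (p : MM) : dropY (ThetaY (iota p)) = (opL p).coeff 0 := by
  rw [cof0_L]
  have : ThetaY (iota p) = ren ((opP p).coeff 0) := by
    rw [ren_P, ThetaY]
    simp only [pd_iota, zero_add]
    rw [← finsum_pnat (fun j => ren (pX j) * ren (p.coeff j))]
    · simp [pX_pnat, ren, pv]
    · simp [pX_zero]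
  rw [this, dropY, ren, MvPolynomial.aeval_rename]
  have : ((fun v => match v with
    | Sum.inl i => MvPolynomial.X i
    | Sum.inr _ => 0 : ℕ+ ⊕ ℕ → SymA) ∘ Sum.inl) = MvPolynomial.X := by ext; rfl
  convert MvPolynomial.aeval_X_left_apply _
  all_goals exact this

lemma pd_fin (f : SymA) : {j | MvPolynomial.pderiv j f ≠ 0}.Finite := by
  refine f.vars.finite_toSet.subset fun j hj => ?_
  by_contra h
  exact hj (MvPolynomial.pderiv_eq_zero_of_notMem_vars h)

lemma term1 (n : ℕ) (f : SymA) : (∑ᶠ j : ℕ+, ((j : ℕ) : F) • (yv (n + 1 + (j : ℕ)) * ren (MvPolynomial.pderiv j f)))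
    = alpha⁻¹ • iota (opS (opQ (Polynomial.monomial n f))) := by
  have h := sumrep (iota ∘ₗ opS ^ (n + 1)) (Q0 f)
  simp only [LinearMap.comp_apply, opS_pow_mon, iota_mon] at h
  rw [← finsum_pnat (fun k => yv (k + (n + 1)) * ren ((Q0 f).coeff k)) (by rw [Q0_coeff_zero]; simp)] at h
  have e : opS (opQ (Polynomial.monomial n f)) = (opS ^ (n + 1)) (Q0 f) := by
    have : Polynomial.monomial n f = (opS ^ n) (Polynomial.monomial 0 f) := by rw [opS_pow_mon, zero_add]
    have hc : opQ * opS ^ n = opS ^ n * opQ := (Commute.pow_right (show Commute opQ opS from Q_S) n)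
    rw [this, ← Module.End.mul_apply opQ, hc, Module.End.mul_apply, Q_vac, pow_succ' opS, Module.End.mul_apply]
  rw [e, h, smul_finsum]
  refine finsum_congr fun j => ?_
  rw [coeff_Q0, map_smul, mul_smul_comm, smul_smul, ← mul_assoc, inv_mul_cancel₀ alpha_ne, one_mul, add_comm (n+1)]

lemma Gamma_iota (p : MM) : GammaY (iota p) = iota (opS (opL p)) := by
  have e1 : (∑ᶠ i : ℕ+, ∑ᶠ j : ℕ+, ((j : ℕ) : F) •
      (yv ((i : ℕ) + (j : ℕ)) *
        MvPolynomial.pderiv (Sum.inl j) (MvPolynomial.pderiv (Sum.inr ((i : ℕ) - 1)) (iota p)))) = 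
        alpha⁻¹ • iota (opS (opQ p)) := by
    simp only [pd_iota, pd_ren]
    have := finsum_pnat' (fun n => ∑ᶠ j : ℕ+, ((j : ℕ) : F) • (yv (n + 1 + (j : ℕ)) * ren (MvPolynomial.pderiv j (p.coeff n))))
    rw [finsum_congr (fun i : ℕ+ => by rw [Nat.sub_add_cancel i.pos])] at this
    rw [this]
    simp only [term1]
    rw [← smul_finsum]
    exact congrArg _ (sumrep (iota ∘ₗ opS ∘ₗ opQ) p).symm
  have e2 : (∑ᶠ i : ℕ+, ∑ᶠ j : ℕ+,
      yv (i : ℕ) * pv j * MvPolynomial.pderiv (Sum.inr ((i : ℕ) + (j : ℕ) - 1)) (iota p)) = iota (opS (opP p)) := by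
    rw [iota_S, ← finsum_pnat']
    refine finsum_congr fun i => ?_
    rw [Nat.sub_add_cancel i.pos, ren_P, ← finsum_pnat _ (by simp [pX_zero]), mul_finsum]
    · refine finsum_congr fun j => ?_
      rw [pd_iota, pX_pnat, mul_assoc, ren, MvPolynomial.rename_X, pv, Nat.sub_add_comm i.pos]
  have e3 : (∑ᶠ i : ℕ+, ((i : ℕ) : F) •
      (yv ((i : ℕ) + 1) * MvPolynomial.pderiv (Sum.inr (i : ℕ)) (iota p))) = iota (opS (opN p)) := by
    rw [iota_S]
    simp only [pd_iota, cof_opN, map_smul, mul_smul_comm]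
    exact finsum_pnat (fun i => (i : F) • (yv (i + 1) * ren (p.coeff i))) (by simp)
  rw [GammaY, e1, e2, e3, smul_smul, mul_inv_cancel₀ alpha_ne, one_smul, opL, ← bF]
  simp only [LinearMap.add_apply, LinearMap.smul_apply, map_add, map_smul]
  abel

def wordM : List Bool → Module.End F MM
  | [] => 1
  | b :: w => (if b then opS else opS * opL) * wordM w

lemma wordOp_iota (w : List Bool) (p : MM) : wordOp w (iota p) = iota (wordM w p) := by
  induction w with
  | nil => rfl
  | cons b w ih =>
    rw [wordOp, wordM, ih]
    cases b
    · simp [Gamma_iota]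
    · simp [Yplus_iota]

lemma word_sum (c : F) (n : ℕ) : ∑ s : Fin n → Bool, c ^ (Finset.univ.filter fun i => s i = true).card • wordM (List.ofFn s)
    = opK c ^ n := by
  induction n with
  | zero => simp [wordM]
  | succ n ih =>
    rw [← (Fin.consEquiv (fun _ => Bool)).sum_comp, Fintype.sum_prod_type, Fintype.sum_bool]
    have e : ∀ (b : Bool) (s : Fin n → Bool), c ^ (Finset.univ.filter fun i => (Fin.consEquiv (fun _ => Bool)) (b, s) i = true).card • 
       wordM (List.ofFn ((Fin.consEquiv (fun _ => Bool)) (b, s))) = (if b then c • opS else opS * opL) * 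
       (c ^ (Finset.univ.filter fun i => s i = true).card • wordM (List.ofFn s)) := by
      intro b s
      rw [Finset.card_filter, Finset.card_filter, Fin.sum_univ_succ, List.ofFn_succ, wordM]
      simp only [Fin.consEquiv_apply, Fin.cons_zero, Fin.cons_succ]
      cases b
      · simp
      · simp only [if_true, smul_mul_assoc, mul_smul_comm, smul_smul, pow_add, pow_one]
        rw [mul_comm]
    simp only [e]
    rw [← Finset.mul_sum, ← Finset.mul_sum, ih, ← add_mul, pow_succ', opK]
    congr 1
    rw [if_pos trivial, if_neg (by simp), mul_add, mul_smul_comm, mul_one, add_comm]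

lemma Bc_eq (n l : ℕ) (f : SymA) : Bc n l f = ∑ s ∈ Finset.univ.filter
      (fun s : Fin n → Bool => (Finset.univ.filter fun i => s i = true).card = l),
      alpha⁻¹ • (opL (wordM (List.ofFn s) (Polynomial.monomial 0 f))).coeff 0 := by
  rw [Bc]
  have : alpha⁻¹ • (yv 0 * MvPolynomial.rename Sum.inl f) = iota (alpha⁻¹ • Polynomial.monomial 0 f) := by
    rw [map_smul, iota_mon, ren]
  simp only [this, wordOp_iota]
  rw [← map_sum, dropTheta_iota, map_sum, Polynomial.finsetSum_coeff]
  simp only [map_smul, Polynomial.coeff_smul]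

lemma Bn_eq (n : ℕ) (c : F) (f : SymA) : Bn n c f = Bop n c f := by
  rw [Bn, Bop_apply, Module.End.mul_apply, ← word_sum, LinearMap.sum_apply, map_sum, Polynomial.finsetSum_coeff,
    Finset.smul_sum]
  rw [← Finset.sum_fiberwise_of_maps_to (s := Finset.univ) (t := Finset.range (n+1))
    (g := fun s : Fin n → Bool => (Finset.univ.filter fun i => s i = true).card)]
  · refine Finset.sum_congr rfl fun l _ => ?_
    rw [Bc_eq, Finset.smul_sum]
    refine Finset.sum_congr rfl fun s hs => ?_
    rw [Finset.mem_filter] at hs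
    rw [LinearMap.smul_apply, map_smul, Polynomial.coeff_smul, hs.2, smul_comm]
  · intro s _
    rw [Finset.mem_range]
    have := Finset.card_filter_le (Finset.univ : Finset (Fin n)) (fun i => s i = true)
    simp at this; omega

end

section
lemma hall_of_subset (f g : SymA) (s : Finset Exp) (h : f.support ⊆ s) :
    hall f g = ∑ m ∈ s, MvPolynomial.coeff m f * MvPolynomial.coeff m g * zalpha m := by
  refine Finset.sum_subset h fun m _ hm => ?_
  rw [MvPolynomial.notMem_support_iff.1 hm]; ring
lemma hall_comm (f g : SymA) : hall f g = hall g f := by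
  rw [hall_of_subset f g _ Finset.subset_union_left, hall_of_subset g f (f.support ∪ g.support) Finset.subset_union_right]
  exact Finset.sum_congr rfl fun m _ => by ring
lemma hall_add_right (f g h : SymA) : hall f (g + h) = hall f g + hall f h := by
  simp only [hall, MvPolynomial.coeff_add, ← Finset.sum_add_distrib]
  exact Finset.sum_congr rfl fun m _ => by ring
lemma hall_smul_right (c : F) (f g : SymA) : hall f (c • g) = c • hall f g := by
  simp only [hall, MvPolynomial.coeff_smul, smul_eq_mul, Finset.mul_sum]
  exact Finset.sum_congr rfl fun m _ => by ring

/-- the Hall product as a bilinear map -/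
def hB : SymA →ₗ[F] SymA →ₗ[F] F := LinearMap.mk₂ F hall
  (fun f g h => by rw [hall_comm, hall_add_right, hall_comm, hall_comm h g])
  (fun c f g => by rw [hall_comm, hall_smul_right, hall_comm])
  hall_add_right (fun c f g => hall_smul_right c f g)
lemma hall_eq (f g : SymA) : hall f g = hB f g := rfl
lemma hB_comm (f g : SymA) : hB f g = hB g f := hall_comm f g
lemma hB_mon (m : Exp) (g : SymA) : hB (MvPolynomial.monomial m 1) g = MvPolynomial.coeff m g * zalpha m := by
  rw [← hall_eq, hall_of_subset _ _ {m} MvPolynomial.support_monomial_subset]; simp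

lemma zalpha_succ (m : Exp) (i : ℕ+) : zalpha (m + Finsupp.single i 1) = zalpha m * ((m i + 1 : ℕ) : F) * ((i : ℕ) : F) * alpha := by
  have h1 : (m + Finsupp.single i 1).prod (fun i k => (Nat.factorial k : ℚ) * ((i : ℕ) : ℚ) ^ k) =
     m.prod (fun i k => (Nat.factorial k : ℚ) * ((i : ℕ) : ℚ) ^ k) * ((m i + 1 : ℕ) * (i : ℕ)) := by
    have e : ∀ m : Exp, ∀ s : Finset ℕ+, m.support ⊆ s → m.prod (fun i k => (Nat.factorial k : ℚ) * ((i : ℕ) : ℚ) ^ k) =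
        ∏ j ∈ s, ((Nat.factorial (m j) : ℚ) * ((j : ℕ) : ℚ) ^ (m j)) := fun m s hs =>
      Finsupp.prod_of_support_subset _ hs _ (by simp)
    rw [e (m + Finsupp.single i 1) (insert i m.support) ?_, e m (insert i m.support) (Finset.subset_insert _ _)]
    · rw [← Finset.mul_prod_erase _ _ (Finset.mem_insert_self i _),
        ← Finset.mul_prod_erase _ _ (Finset.mem_insert_self i _)]
      have : ∀ j ∈ (insert i m.support).erase i, ((Nat.factorial ((m + Finsupp.single i 1 : Exp) j) : ℚ) * ((j : ℕ) : ℚ) ^ ((m + Finsupp.single i 1 : Exp) j)) = ((Nat.factorial (m j) : ℚ) * ((j : ℕ) : ℚ) ^ (m j)) := by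
        intro j hj
        have : i ≠ j := (Finset.ne_of_mem_erase hj).symm
        simp [Finsupp.single_apply, this]
      rw [Finset.prod_congr rfl this]
      simp only [Finsupp.add_apply, Finsupp.single_eq_same, Nat.factorial_succ, pow_succ]
      push_cast; ring
    · intro j hj
      simp only [Finsupp.mem_support_iff, Finsupp.add_apply, Finset.mem_insert] at *
      by_contra h; push Not at h
      exact hj (by simp [Finsupp.single_apply, h.2, Ne.symm h.1])
  have h2 : (m + Finsupp.single i 1).sum (fun _ k => k) = m.sum (fun _ k => k) + 1 := by
    rw [Finsupp.sum_add_index' (by simp) (by simp)]; simp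
  rw [zalpha, h1, h2, zalpha, map_mul, map_mul, pow_succ]
  simp only [map_natCast]; ring

lemma zalpha_ne (m : Exp) : zalpha m ≠ 0 := by
  rw [zalpha]
  refine mul_ne_zero ?_ (pow_ne_zero _ alpha_ne)
  rw [map_ne_zero]
  refine Finset.prod_ne_zero_iff.2 fun i _ => ?_
  positivity

def qn (n : ℕ) : Derivation F SymA SymA := derS fun i => if i = n then MvPolynomial.C (alpha * (n : F)) else 0
lemma qn_pX (n m : ℕ) : qn n (pX m) = if m = n then MvPolynomial.C (alpha * (n : F)) else 0 := by
  rw [qn, derS_pX]; split_ifs with h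
  · subst h; simp
  · rfl
lemma coeffQ0 (f : SymA) (n : ℕ) : (Q0 f).coeff n = qn n f := by
  induction f using MvPolynomial.induction_on with
  | C a => simp [Q0, qn, derS]
  | add p q hp hq => simp only [map_add, Polynomial.coeff_add, hp, hq]
  | mul_X p i hp =>
    rw [Derivation.leibniz, Derivation.leibniz, ← pX_pnat, Q0_pX, Polynomial.smul_eq_C_mul, Polynomial.smul_eq_C_mul,
      Polynomial.coeff_add, Polynomial.coeff_C_mul, Polynomial.coeff_C_mul, hp, Polynomial.coeff_smul,
      Polynomial.coeff_X_pow, qn_pX]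
    by_cases h : (i : ℕ) = n
    · rw [if_pos h, if_pos h.symm, h]; simp [smulS]
    · rw [if_neg h, if_neg (Ne.symm h)]; simp
lemma qn_pnat (i : ℕ+) (f : SymA) : qn i f = (alpha * ((i : ℕ) : F)) • MvPolynomial.pderiv i f := by
  rw [← coeffQ0, coeff_Q0]

lemma der_ext {D D' : Derivation F SymA SymA} (h : ∀ n, D (pX n) = D' (pX n)) : D = D' := by
  apply MvPolynomial.derivation_ext
  intro i; rw [← pX_pnat]; exact h i

lemma qn_zero : qn 0 = 0 := der_ext fun n => by rw [qn_pX]; simp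

lemma S_ext {A : Type*} [AddCommGroup A] [Module F A] {O O' : SymA →ₗ[F] A}
    (h : ∀ m : Exp, O (MvPolynomial.monomial m 1) = O' (MvPolynomial.monomial m 1)) : O = O' := by
  refine LinearMap.ext fun f => ?_
  rw [f.as_sum, map_sum, map_sum]
  refine Finset.sum_congr rfl fun m _ => ?_
  have : MvPolynomial.monomial m (MvPolynomial.coeff m f) = MvPolynomial.coeff m f • MvPolynomial.monomial m 1 := by
    rw [MvPolynomial.smul_monomial]; simp
  rw [this, map_smul, map_smul, h]

lemma hB_p (n : ℕ) (f g : SymA) : hB (pX n * f) g = hB f (qn n g) := by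
  rcases Nat.eq_zero_or_pos n with rfl | hn
  · rw [qn_zero, pX_zero]; simp
  obtain ⟨i, rfl⟩ := exists_pnat hn
  suffices h : hB ∘ₗ mS (pX i) = LinearMap.compl₂ hB (qn i : SymA →ₗ[F] SymA) from
    LinearMap.congr_fun (LinearMap.congr_fun h f) g
  refine S_ext fun m => S_ext fun m' => ?_
  have e : pX i * MvPolynomial.monomial m (1 : F) = MvPolynomial.monomial (m + Finsupp.single i 1) 1 := by
    rw [pX_pnat, MvPolynomial.X, MvPolynomial.monomial_mul, add_comm, mul_one]
  rw [LinearMap.comp_apply, mS_apply, e, hB_mon, LinearMap.compl₂_apply, hB_mon]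
  change _ = MvPolynomial.coeff m (qn i _) * _
  rw [qn_pnat, MvPolynomial.coeff_smul, MvPolynomial.pderiv_monomial, MvPolynomial.coeff_monomial, MvPolynomial.coeff_monomial]
  by_cases h : m' = m + Finsupp.single i 1
  · subst h
    rw [if_pos rfl, if_pos (by simp), zalpha_succ, smul_eq_mul]
    simp only [Finsupp.add_apply, Finsupp.single_eq_same]; ring
  · rw [if_neg h, zero_mul]
    split_ifs with h2
    · have : m' i = 0 := by
        by_contra h3
        refine h ?_
        rw [← h2, tsub_add_cancel_of_le]
        simpa [Nat.one_le_iff_ne_zero] using h3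
      rw [this]; simp
    · simp

lemma coeff_L (k m : ℕ) (f : SymA) : (opL (Polynomial.monomial k f)).coeff m = pX (k - m) * f + 
    (qn (m - k) f + if m = k then (bF * (k : F)) • f else 0) := by
  rw [opL, LinearMap.add_apply, LinearMap.add_apply, LinearMap.smul_apply, opQ_mon, opN_mon, Polynomial.coeff_add, 
    Polynomial.coeff_add, coeff_opP_mon, Polynomial.coeff_X_pow_mul', coeffQ0, Polynomial.coeff_smul,
    Polynomial.coeff_smul, Polynomial.coeff_monomial, smul_smul, add_assoc]
  congr 1; congr 1
  · split_ifs with h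
    · rfl
    · rw [Nat.sub_eq_zero_of_le (by omega), qn_zero]; rfl
  · by_cases h : m = k
    · rw [if_pos h, if_pos h.symm]
    · rw [if_neg h, if_neg (Ne.symm h), smul_zero]

def hM : MM →ₗ[F] MM →ₗ[F] F := Polynomial.lsum fun k => (LinearMap.lcomp F F (cof k)) ∘ₗ hB
lemma hM_mon (k : ℕ) (f : SymA) (q : MM) : hM (Polynomial.monomial k f) q = hB f (q.coeff k) := by
  simp only [hM, Polynomial.lsum_apply]
  rw [Polynomial.sum_monomial_index]
  · rfl
  · simp
lemma hM_mon' (m : ℕ) (p : MM) (g : SymA) : hM p (Polynomial.monomial m g) = hB (p.coeff m) g := by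
  induction p using Polynomial.induction_on' with
  | add p q hp hq => simp [hp, hq]
  | monomial k f => 
    rw [hM_mon, Polynomial.coeff_monomial, Polynomial.coeff_monomial]
    by_cases h : m = k
    · rw [if_pos h, if_pos h.symm]
    · rw [if_neg h, if_neg (Ne.symm h)]; simp

lemma L_sa (p q : MM) : hM (opL p) q = hM p (opL q) := by
  suffices h : hM ∘ₗ opL = LinearMap.compl₂ hM opL from LinearMap.congr_fun (LinearMap.congr_fun h p) q
  refine op_ext fun k f => op_ext fun m g => ?_
  rw [LinearMap.comp_apply, LinearMap.compl₂_apply, hM_mon', hM_mon, coeff_L, coeff_L]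
  rw [map_add, LinearMap.add_apply, hB_p, map_add, map_add, LinearMap.add_apply, map_add]
  rw [hB_comm f (pX (m - k) * g), hB_p (m - k), hB_comm g]
  have : hB (if m = k then (bF * (k : F)) • f else 0) g = hB f (if k = m then (bF * (m : F)) • g else 0) := by
    by_cases h : m = k
    · subst h; simp
    · rw [if_neg h, if_neg (Ne.symm h)]; simp
  rw [this]; ring

lemma vac_sa (n : ℕ) (f g : SymA) : hB (((opL ^ n) (vac f)).coeff 0) g = hB f (((opL ^ n) (vac g)).coeff 0) := by
  rw [← hM_mon', ← hM_mon]
  have : ∀ p q, hM ((opL ^ n) p) q = hM p ((opL ^ n) q) := by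
    induction n with
    | zero => simp
    | succ n ih => intro p q; rw [pow_succ', Module.End.mul_apply, L_sa, ih, ← Module.End.mul_apply, ← pow_succ, pow_succ']
  exact this _ _

lemma E_eq (f : SymA) : Eder f = alpha⁻¹ • ((opL ^ 2) (vac f)).coeff 0 := by
  rw [pow_two, Module.End.mul_apply, vac_apply, L_vac, cof0_L]
  have := coeff0_PSQ 0 f
  rw [pow_zero, Module.End.one_apply] at this
  rw [this, smul_smul, inv_mul_cancel₀ alpha_ne, one_smul]; rfl
lemma E_sa (f g : SymA) : hB (Eder f) g = hB f (Eder g) := by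
  rw [E_eq, E_eq, map_smul, map_smul, LinearMap.smul_apply, vac_sa]
lemma Dop_apply (f : SymA) : Dop f = (2 * alpha)⁻¹ • ((opL ^ 3) (vac f)).coeff 0 - (bF / 2) • Eder f := rfl
lemma D_sa (f g : SymA) : hB (Dop f) g = hB f (Dop g) := by
  rw [Dop_apply, Dop_apply, map_sub, map_sub, map_smul, map_smul, LinearMap.sub_apply, LinearMap.smul_apply, LinearMap.smul_apply, vac_sa,
    E_sa, LinearMap.map_smul, LinearMap.map_smul]

def Tder : Derivation F SymA SymA := derS fun n => (alpha * (n : F)) • pX (n - 1)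
lemma T_pX (n : ℕ) : Tder (pX n) = (alpha * (n : F)) • pX (n - 1) := by
  rw [Tder, derS_pX]; simp
lemma qT (n : ℕ) (f : SymA) : qn n (Tder f) = Tder (qn n f) + (alpha * (n : F)) • qn (n + 1) f := by
  have : ⁅qn n, Tder⁆ = (alpha * (n : F)) • qn (n + 1) := by
    apply der_ext
    intro m
    rw [Derivation.commutator_apply, T_pX, qn_pX, Derivation.map_smul, qn_pX, Derivation.smul_apply, qn_pX]
    rcases m with _ | m
    · have e : Tder (if 0 = n then MvPolynomial.C (alpha * (n : F)) else 0) = 0 := by split_ifs <;> simp [Tder, derS]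
      rw [e]; simp
    · have e : Tder (if m + 1 = n then MvPolynomial.C (alpha * (n : F)) else 0) = 0 := by split_ifs <;> simp [Tder, derS]
      rw [e, sub_zero, Nat.add_sub_cancel]
      by_cases h : m = n
      · subst h; simp only [if_true, smulS, ← map_mul]; congr 1; ring
      · rw [if_neg h, if_neg (by omega)]; simp
  have h := congrArg (fun D : Derivation F SymA SymA => D f) this
  simp only [Derivation.commutator_apply, Derivation.smul_apply] at h
  rw [← h]; ring

lemma S_ind {P : SymA → Prop} (h1 : P 1) (ha : ∀ f g, P f → P g → P (f + g)) (hs : ∀ (c : F) f, P f → P (c • f))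
    (hp : ∀ n f, P f → P (pX n * f)) (f : SymA) : P f := by
  induction f using MvPolynomial.induction_on with
  | C a => have := hs a 1 h1; rwa [smulS, mul_one] at this
  | add p q hp hq => exact ha _ _ hp hq
  | mul_X p i h => rw [mul_comm, ← pX_pnat]; exact hp _ _ h

lemma hB_one (g : SymA) : hB 1 g = MvPolynomial.coeff 0 g := by
  have := hB_mon 0 g
  rw [show (MvPolynomial.monomial 0 (1 : F) : SymA) = 1 from rfl] at this
  rw [this]; simp [zalpha]

lemma hB_one_p (n : ℕ) (g : SymA) : hB 1 (pX n * g) = 0 := by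
  rw [hB_comm, hB_p]; simp

lemma dn1_adj (f g : SymA) : alpha * hB (dn 1 f) g = hB f (Tder g) := by
  induction f using S_ind generalizing g with
  | h1 =>
    rw [Derivation.map_one_eq_zero]
    simp only [map_zero, LinearMap.zero_apply, mul_zero]
    symm
    induction g using S_ind with
    | h1 => simp
    | ha f g hf hg => simp only [map_add, hf, hg, add_zero]
    | hs c f hf => rw [Derivation.map_smul, map_smul, hf, smul_zero]
    | hp n f hf => 
      rw [Derivation.leibniz, T_pX, smul_eq_mul, smul_eq_mul, map_add, hB_one_p, zero_add, mul_smul_comm, map_smul,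
        mul_comm f, hB_one_p, smul_zero]
  | ha f g hf hg => simp only [map_add, LinearMap.add_apply, mul_add, hf, hg]
  | hs c f hf => rw [Derivation.map_smul, map_smul, map_smul, LinearMap.smul_apply, LinearMap.smul_apply, ← hf]; simp only [smul_eq_mul]; ring
  | hp n f hf =>
    rw [Derivation.leibniz, dn_pX, smul_eq_mul, smul_eq_mul, mul_smul_comm, map_add, map_smul, LinearMap.add_apply,
      LinearMap.smul_apply, hB_p, mul_comm f, hB_p, hB_p, qT, mul_add, hf, map_add, map_smul, smul_eq_mul, smul_eq_mul]
    ring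

def tau (u : F) : Derivation F SymA SymA := u • qn 1 + Tder
lemma b1_adj (u : F) (f g : SymA) : alpha * hB (b1 u f) g = hB f (tau u g) := by
  rw [b1, LinearMap.add_apply, dn_coe, map_add, LinearMap.add_apply, mul_add, dn1_adj, LinearMap.smul_apply, map_smul, LinearMap.smul_apply,
    mS_apply, hB_p, tau, Derivation.add_apply, Derivation.smul_apply, map_add, map_smul, smul_eq_mul, smul_eq_mul,
    ← mul_assoc, mul_div_cancel₀ _ alpha_ne]

end

section
def gg : ℕ → SymA
  | 0 => 1
  | n + 1 => (alpha * ((n + 1 : ℕ) : F))⁻¹ • ∑ i : Fin (n + 1), pX (i + 1) * gg (n - i)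
decreasing_by omega

lemma gg_zero : gg 0 = 1 := by rw [gg]
lemma gg_newton (n : ℕ) : (alpha * (n : F)) • gg n = ∑ x ∈ Finset.HasAntidiagonal.antidiagonal n, pX x.1 * gg x.2 := by
  rcases n with _ | n
  · simp [pX_zero]
  · rw [gg, smul_smul, mul_inv_cancel₀ (mul_ne_zero alpha_ne (Nat.cast_ne_zero.2 (by omega))), one_smul,
      Finset.Nat.sum_antidiagonal_eq_sum_range_succ (fun i j => pX i * gg j), Finset.sum_range_succ',
      pX_zero, zero_mul, add_zero, Finset.sum_range]
    refine Finset.sum_congr rfl fun i _ => ?_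
    rw [show n + 1 - (i + 1) = n - i by omega]

abbrev Ser : Type := PowerSeries SymA
def thS : Derivation SymA Ser Ser := (PowerSeries.X : Ser) • PowerSeries.derivative SymA
lemma th_coeff (f : Ser) (n : ℕ) : PowerSeries.coeff n (thS f) = (n : SymA) * PowerSeries.coeff n f := by
  rw [thS, Derivation.smul_apply, smul_eq_mul]
  rcases n with _ | n
  · simp
  · rw [PowerSeries.coeff_succ_X_mul, PowerSeries.coeff_derivative]; push_cast; ring
lemma th_X : thS PowerSeries.X = PowerSeries.X := by simp [thS, PowerSeries.derivative_X]
def aS : Ser := PowerSeries.C (MvPolynomial.C alpha)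
lemma th_C (x : SymA) : thS (PowerSeries.C x) = 0 := by
  ext1 n; rw [th_coeff, PowerSeries.coeff_C]; split_ifs with h
  · simp [h]
  · simp
def aP : Ser := PowerSeries.mk pX
def aG : Ser := PowerSeries.mk gg
lemma th_mul (f g : Ser) : thS (f * g) = f * thS g + g * thS f := by
  rw [Derivation.leibniz, smul_eq_mul, smul_eq_mul]
lemma coeff_aS (f : Ser) (n : ℕ) : PowerSeries.coeff n (aS * f) = alpha • PowerSeries.coeff n f := by
  rw [aS, PowerSeries.coeff_C_mul, smulS]
lemma aG_newton : aS * thS aG = aP * aG := by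
  ext1 n
  rw [coeff_aS, th_coeff, PowerSeries.coeff_mul, aG, PowerSeries.coeff_mk]
  simp only [aP, PowerSeries.coeff_mk]
  rw [← gg_newton, smulS, smulS, map_mul, map_natCast]; ring

lemma ser_uniq (Y : Ser) (h : aS * thS Y = aP * Y) (h0 : PowerSeries.coeff 0 Y = 0) : Y = 0 := by
  ext1 n
  induction n using Nat.strong_induction_on with
  | _ n ih =>
    rcases Nat.eq_zero_or_pos n with rfl | hn
    · simp [h0]
    · have h1 := congrArg (PowerSeries.coeff n) h
      rw [coeff_aS, th_coeff, PowerSeries.coeff_mul, Finset.sum_eq_zero] at h1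
      · have : (alpha * (n : F)) • PowerSeries.coeff n Y = 0 := by
          rw [← h1, smulS, smulS, map_mul, map_natCast]; ring
        rcases smul_eq_zero.1 this with h2 | h2
        · exact absurd h2 (mul_ne_zero alpha_ne (Nat.cast_ne_zero.2 hn.ne'))
        · rw [h2]; simp
      · intro x hx
        rw [Finset.HasAntidiagonal.mem_antidiagonal] at hx
        rcases Nat.eq_zero_or_pos x.1 with h2 | h2
        · rw [h2, aP, PowerSeries.coeff_mk, pX_zero, zero_mul]
        · rw [ih x.2 (by omega)]; simp
lemma ser_uniq' (Y Z R : Ser) (hY : aS * thS Y = aP * Y + R) (hZ : aS * thS Z = aP * Z + R) 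
    (h0 : PowerSeries.coeff 0 Y = PowerSeries.coeff 0 Z) : Y = Z := by
  rw [← sub_eq_zero]
  apply ser_uniq
  · rw [map_sub, mul_sub, hY, hZ]; ring
  · rw [map_sub, h0, sub_self]

def lS (O : SymA →ₗ[F] SymA) (f : Ser) : Ser := PowerSeries.mk fun n => O (PowerSeries.coeff n f)
lemma lS_coeff (O : SymA →ₗ[F] SymA) (f : Ser) (n : ℕ) : PowerSeries.coeff n (lS O f) = O (PowerSeries.coeff n f) := by
  rw [lS, PowerSeries.coeff_mk]
lemma lS_leib (d : Derivation F SymA SymA) (f g : Ser) : lS d (f * g) = f * lS d g + g * lS d f := by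
  rw [mul_comm g]
  ext1 n
  rw [lS_coeff, map_add, PowerSeries.coeff_mul, PowerSeries.coeff_mul, PowerSeries.coeff_mul, map_sum, ← Finset.sum_add_distrib]
  refine Finset.sum_congr rfl fun x _ => ?_
  rw [Derivation.coeFn_coe, Derivation.leibniz, lS_coeff, lS_coeff, Derivation.coeFn_coe, smul_eq_mul, smul_eq_mul]; ring
lemma lS_ath (O : SymA →ₗ[F] SymA) (f : Ser) : lS O (aS * thS f) = aS * thS (lS O f) := by
  ext1 n
  rw [lS_coeff, coeff_aS, coeff_aS, th_coeff, th_coeff, map_smul, lS_coeff, ← map_natCast (MvPolynomial.C : F →+* SymA), ← smulS, map_smul,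
    smulS (n : F)]
lemma lS_newton (d : Derivation F SymA SymA) : aS * thS (lS d aG) = aP * lS d aG + lS d aP * aG := by
  rw [← lS_ath, aG_newton, lS_leib]; ring

/-- (a) -/
lemma qn_gg (i : ℕ) (hi : 0 < i) (n : ℕ) : qn i (gg n) = if i ≤ n then gg (n - i) else 0 := by
  have h : lS (qn i) aG = PowerSeries.X ^ i * aG := by
    refine ser_uniq' _ _ _ (lS_newton _) ?_ ?_
    · have e : lS (qn i) aP = (i : Ser) * aS * PowerSeries.X ^ i := by
        ext1 n
        rw [lS_coeff, aP, PowerSeries.coeff_mk, Derivation.coeFn_coe, qn_pX, PowerSeries.coeff_mul_X_pow', mul_comm _ aS, coeff_aS,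
          ← map_natCast (PowerSeries.C : SymA →+* Ser), PowerSeries.coeff_C]
        by_cases h : n = i
        · subst h; rw [if_pos rfl, if_pos le_rfl, if_pos (by omega), smulS, map_mul, map_natCast]
        · rw [if_neg h]; split_ifs with h1 h2
          · omega
          · simp
          · simp
      have e2 : thS (PowerSeries.X ^ i) = (i : Ser) * PowerSeries.X ^ i := by
        ext1 n
        rw [th_coeff, ← map_natCast (PowerSeries.C : SymA →+* Ser), PowerSeries.coeff_C_mul, PowerSeries.coeff_X_pow]
        split_ifs with h
        · rw [h]
        · simp
      rw [e, th_mul, e2]; linear_combination PowerSeries.X ^ i * aG_newton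
    · rw [lS_coeff, PowerSeries.coeff_X_pow_mul', if_neg (by omega), aG, PowerSeries.coeff_mk, gg_zero]; simp
  have := congrArg (PowerSeries.coeff n) h
  rw [lS_coeff, PowerSeries.coeff_X_pow_mul'] at this
  simp only [aG, PowerSeries.coeff_mk] at this
  exact this

lemma T_gg (n : ℕ) : Tder (gg (n + 1)) = (alpha * (n : F)) • gg n := by
  have h : lS Tder aG = aS * PowerSeries.X * thS aG := by
    refine ser_uniq' _ _ _ (lS_newton _) ?_ ?_
    · have e : lS Tder aP = aS * PowerSeries.X * (thS aP + aP) := by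
        ext1 n
        rw [lS_coeff, aP, PowerSeries.coeff_mk, Derivation.coeFn_coe, T_pX, mul_assoc, coeff_aS]
        rcases n with _ | n
        · simp
        · rw [PowerSeries.coeff_succ_X_mul, map_add, th_coeff, PowerSeries.coeff_mk, smulS, smulS, map_mul, map_natCast, Nat.add_sub_cancel]
          push_cast; ring
      have h1 : aS * thS (thS aG) = aP * thS aG + aG * thS aP := by
        rw [← th_mul, ← aG_newton, th_mul, aS, th_C]; ring
      rw [e, mul_assoc aS, th_mul, th_mul, th_X, aS, th_C, ← aS]
      linear_combination (aS * PowerSeries.X) * h1 + (aS * PowerSeries.X) * aG_newton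
    · rw [lS_coeff, mul_assoc, coeff_aS, aG, PowerSeries.coeff_mk, gg_zero]; simp
  have := congrArg (PowerSeries.coeff (n + 1)) h
  rw [lS_coeff, mul_assoc, coeff_aS, PowerSeries.coeff_succ_X_mul, th_coeff, aG, PowerSeries.coeff_mk, PowerSeries.coeff_mk] at this
  rw [Derivation.coeFn_coe] at this
  rw [this, smulS, smulS, map_mul, map_natCast, mul_assoc]

lemma T_gg0 : Tder (gg 0) = 0 := by rw [gg_zero]; simp

lemma tau_gg (u : F) (n : ℕ) : tau u (gg (n + 1)) = (alpha * (n : F) + u) • gg n := by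
  rw [tau, Derivation.add_apply, Derivation.smul_apply, qn_gg 1 one_pos, if_pos (by omega), T_gg, Nat.add_sub_cancel,
    add_smul, add_comm]

lemma dn_finsum (i : ℕ) (f : SymA) : alpha • dn i f = ∑ᶠ j : ℕ, pX (j + i) * qn j f := by
  rw [← coeff0_PSQ, coeff_P]
  simp only [zero_add, cof_opS_pow, coeffQ0]
  rw [← finsum_inj (fun j => j + i) (fun a b h => by simpa using h)]
  · simp
  · intro x hx
    rw [if_neg, mul_zero]
    intro h; exact hx ⟨x - i, by simp; omega⟩

lemma dn_gg (i m : ℕ) : alpha • dn i (gg m) = ∑ x ∈ Finset.HasAntidiagonal.antidiagonal m, (if x.1 = 0 then 0 else pX (x.1 + i)) * gg x.2 := by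
  rw [dn_finsum, finsum_eq_sum_of_support_subset (s := Finset.range (m + 1)), 
    Finset.Nat.sum_antidiagonal_eq_sum_range_succ (fun a b => (if a = 0 then 0 else pX (a + i)) * gg b)]
  · refine Finset.sum_congr rfl fun j hj => ?_
    rw [Finset.mem_range] at hj
    rcases Nat.eq_zero_or_pos j with rfl | h
    · rw [qn_zero]; simp
    · rw [if_neg h.ne', qn_gg j h, if_pos (by omega)]
  · intro j hj
    simp only [Function.mem_support] at hj
    simp only [Finset.coe_range, Set.mem_Iio]
    by_contra h
    exact hj (by rw [qn_gg j (by omega), if_neg (by omega), mul_zero])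

end

section
lemma tri_sum {A : Type*} [AddCommMonoid A] (f : ℕ → ℕ → ℕ → A) (n : ℕ) :
    ∑ x ∈ Finset.HasAntidiagonal.antidiagonal n, ∑ y ∈ Finset.HasAntidiagonal.antidiagonal x.2, f x.1 y.1 y.2 =
    ∑ x ∈ Finset.HasAntidiagonal.antidiagonal n, ∑ y ∈ Finset.HasAntidiagonal.antidiagonal x.1, f y.1 y.2 x.2 := by
  rw [Finset.sum_sigma', Finset.sum_sigma']
  refine Finset.sum_nbij' (fun z => ⟨(z.1.1 + z.2.1, z.2.2), (z.1.1, z.2.1)⟩) (fun z => ⟨(z.2.1, z.2.2 + z.1.2), (z.2.2, z.1.2)⟩) ?_ ?_ ?_ ?_ ?_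
  · rintro ⟨⟨a, b⟩, c, d⟩ h
    simp only [Finset.mem_sigma, Finset.HasAntidiagonal.mem_antidiagonal] at h ⊢
    obtain ⟨rfl, rfl⟩ := h
    constructor
    · simp only [add_assoc]
    · trivial
  · rintro ⟨⟨a, b⟩, c, d⟩ h
    simp only [Finset.mem_sigma, Finset.HasAntidiagonal.mem_antidiagonal] at h ⊢
    obtain ⟨rfl, rfl⟩ := h
    constructor
    · simp only [add_assoc]
    · trivial
  · rintro ⟨⟨a, b⟩, c, d⟩ h
    simp only [Finset.mem_sigma, Finset.HasAntidiagonal.mem_antidiagonal] at h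
    obtain ⟨rfl, rfl⟩ := h; rfl
  · rintro ⟨⟨a, b⟩, c, d⟩ h
    simp only [Finset.mem_sigma, Finset.HasAntidiagonal.mem_antidiagonal] at h
    obtain ⟨rfl, rfl⟩ := h; rfl
  · rintro ⟨⟨a, b⟩, c, d⟩ h; rfl

def h2S : Ser := PowerSeries.C (MvPolynomial.C (2⁻¹ : F))
lemma h2S_two : h2S * 2 = 1 := by
  have : (2 : Ser) = PowerSeries.C (MvPolynomial.C (2 : F)) := by rw [map_ofNat, map_ofNat]
  rw [this, h2S, ← map_mul, ← map_mul, inv_mul_cancel₀ two_ne_zero, map_one, map_one]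
lemma coeff_h2 (f : Ser) (n : ℕ) : PowerSeries.coeff n (h2S * f) = (2⁻¹ : F) • PowerSeries.coeff n f := by
  rw [h2S, PowerSeries.coeff_C_mul, smulS]

lemma cn_series : PowerSeries.mk cn = h2S * (thS (aP * aP) + (aS - 1) * (thS (thS aP) - thS aP)) := by
  ext1 n
  have e : csum n = PowerSeries.coeff n (aP * aP) := by
    rw [PowerSeries.coeff_mul]
    simp only [aP, PowerSeries.coeff_mk]
    rw [Finset.Nat.sum_antidiagonal_eq_sum_range_succ (fun i j => pX i * pX j), Finset.sum_range_succ, Nat.sub_self, pX_zero, mul_zero, add_zero, csum]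
  rw [PowerSeries.coeff_mk, cn, coeff_h2, map_add, sub_mul, one_mul, map_sub, coeff_aS, map_sub, th_coeff, th_coeff, th_coeff, ← e, aP,
    PowerSeries.coeff_mk, bF]
  simp only [smulS, map_mul, map_sub, map_natCast, map_one, div_eq_mul_inv]
  ring

lemma W_series : PowerSeries.mk (fun n => ∑ x ∈ Finset.HasAntidiagonal.antidiagonal n, (alpha * (x.1 : F)) • dn x.1 (gg x.2)) =
    h2S * ((thS (thS aP) - thS aP) * aG) := by
  ext1 n
  rw [PowerSeries.coeff_mk, coeff_h2, PowerSeries.coeff_mul, Finset.smul_sum]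
  simp only [mul_comm alpha, mul_smul, dn_gg, Finset.smul_sum]
  rw [tri_sum (fun i j l => (i : F) • ((if j = 0 then 0 else pX (j + i)) * gg l))]
  refine Finset.sum_congr rfl fun x _ => ?_
  rw [Finset.Nat.sum_antidiagonal_eq_sum_range_succ (fun i j => (i : F) • ((if j = 0 then 0 else pX (j + i)) * gg x.2)),
    Finset.sum_range_succ, Nat.sub_self, if_pos rfl, zero_mul, smul_zero, add_zero]
  have : ∀ i ∈ Finset.range x.1, (i : F) • ((if x.1 - i = 0 then 0 else pX (x.1 - i + i)) * gg x.2) = (i : F) • (pX x.1 * gg x.2) := by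
    intro i hi
    rw [Finset.mem_range] at hi
    rw [if_neg (by omega), Nat.sub_add_cancel hi.le]
  rw [Finset.sum_congr rfl this, ← Finset.sum_smul, map_sub, th_coeff, th_coeff, aP, aG, PowerSeries.coeff_mk, PowerSeries.coeff_mk]
  have h3 : (∑ i ∈ Finset.range x.1, (i : F)) = 2⁻¹ * ((x.1 : F) * (x.1 - 1)) := by
    generalize x.1 = k
    induction k with
    | zero => simp
    | succ k ih => rw [Finset.sum_range_succ, ih]; push_cast; field_simp; ring
  rw [h3, smulS, smulS, map_mul, map_mul, map_sub, map_natCast, map_one]; ring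

lemma D_gg (n : ℕ) : Dop (gg n) = (alpha * (n : F) * ((n : F) - 1) / 2) • gg n := by
  have h : lS Dop aG = h2S * aS * (thS (thS aG) - thS aG) := by
    have e : lS Dop (aP * aG) = aP * lS Dop aG + (PowerSeries.mk cn * aG + 
        PowerSeries.mk (fun n => ∑ x ∈ Finset.HasAntidiagonal.antidiagonal n, (alpha * (x.1 : F)) • dn x.1 (gg x.2))) := by
      ext1 n
      rw [lS_coeff, map_add, map_add, PowerSeries.coeff_mul, PowerSeries.coeff_mul, PowerSeries.coeff_mul, PowerSeries.coeff_mk, map_sum,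
        ← Finset.sum_add_distrib, ← Finset.sum_add_distrib]
      refine Finset.sum_congr rfl fun x _ => ?_
      rw [lS_coeff, aP, aG]
      simp only [PowerSeries.coeff_mk, D_mul]
      ring
    refine ser_uniq' _ _ (PowerSeries.mk cn * aG + 
        PowerSeries.mk (fun n => ∑ x ∈ Finset.HasAntidiagonal.antidiagonal n, (alpha * (x.1 : F)) • dn x.1 (gg x.2))) ?_ ?_ ?_
    · rw [← lS_ath, aG_newton, e]
    · rw [cn_series, W_series]
      have h1 : aS * thS (thS aG) = aP * thS aG + aG * thS aP := by
        rw [← th_mul, ← aG_newton, th_mul, aS, th_C]; ring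
      have h2 : aS * thS (thS (thS aG)) = aP * thS (thS aG) + 2 * thS aG * thS aP + aG * thS (thS aP) := by
        have : thS (aS * thS (thS aG)) = aS * thS (thS (thS aG)) := by rw [th_mul, aS, th_C]; ring
        rw [← this, h1, map_add, th_mul, th_mul]; ring
      have h3 : thS (h2S * aS * (thS (thS aG) - thS aG)) = h2S * aS * (thS (thS (thS aG)) - thS (thS aG)) := by
        rw [th_mul, th_mul, h2S, aS, th_C, th_C, map_sub]; ring
      rw [h3, th_mul]
      linear_combination (h2S * aS) * h2 - (h2S * aS) * h1 + (2 * h2S * thS aP) * aG_newton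
    · rw [lS_coeff, mul_assoc, coeff_h2, coeff_aS, map_sub, th_coeff, th_coeff, aG, PowerSeries.coeff_mk, gg_zero, D_one]; simp
  have := congrArg (PowerSeries.coeff n) h
  rw [lS_coeff, mul_assoc, coeff_h2, coeff_aS, map_sub, th_coeff, th_coeff, aG, PowerSeries.coeff_mk] at this
  rw [this]
  simp only [smulS, map_mul, map_sub, map_natCast, map_one, div_eq_mul_inv]; ring

/-- second-order Leibniz rule -/
lemma qn_fin (f : SymA) : {j | qn j f ≠ 0}.Finite := by
  have := supp_fin (Q0 f) 0
  simpa only [zero_add, coeffQ0] using this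
def cross (f h : SymA) : SymA := ∑ᶠ j : ℕ, qn j f * dn j h
lemma cross_fin (f h : SymA) : (Function.support fun j => qn j f * dn j h).Finite :=
  (qn_fin f).subset fun j hj => left_ne_zero_of_mul hj
lemma cross_add (f g h : SymA) : cross (f + g) h = cross f h + cross g h := by
  rw [cross, cross, cross, ← finsum_add_distrib (cross_fin _ _) (cross_fin _ _)]
  exact finsum_congr fun j => by rw [map_add, add_mul]
lemma cross_smul (c : F) (f h : SymA) : cross (c • f) h = c • cross f h := by
  rw [cross, cross, smul_finsum]
  exact finsum_congr fun j => by rw [Derivation.map_smul, smul_mul_assoc]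
lemma cross_p (n : ℕ) (f h : SymA) : cross (pX n * f) h = pX n * cross f h + (alpha * (n : F)) • (f * dn n h) := by
  have e : ∀ j, qn j (pX n * f) * dn j h = pX n * (qn j f * dn j h) + if j = n then (alpha * (n : F)) • (f * dn n h) else 0 := by
    intro j
    rw [Derivation.leibniz, qn_pX, smul_eq_mul, smul_eq_mul]
    by_cases hj : j = n
    · subst hj; simp only [if_true, smulS]; ring
    · rw [if_neg hj, if_neg (Ne.symm hj)]; ring
  rw [cross, finsum_congr e, finsum_add_distrib, ← mul_finsum]
  · congr 1
    exact (finsum_eq_single _ n (fun j hj => if_neg hj)).trans (if_pos rfl)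
  · exact (cross_fin f h).subset fun j hj => right_ne_zero_of_mul hj
  · refine (Set.finite_singleton n).subset fun j hj => ?_
    by_contra hn; exact hj (if_neg hn)
lemma cross_one (h : SymA) : cross 1 h = 0 := by simp [cross]
lemma D_prod (f h : SymA) : Dop (f * h) = f * Dop h + h * Dop f + cross f h := by
  induction f using S_ind with
  | h1 => rw [one_mul, one_mul, D_one, cross_one]; ring
  | ha f g hf hg => rw [add_mul, map_add, hf, hg, map_add, cross_add]; ring
  | hs c f hf => rw [smul_mul_assoc, map_smul, hf, map_smul, cross_smul]; simp only [smulS]; ring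
  | hp n f hf =>
    rw [mul_assoc, D_mul, hf, D_mul, cross_p, Derivation.leibniz, smul_eq_mul, smul_eq_mul]
    simp only [smulS]; ring

lemma cross_mul_left (f g h : SymA) : cross (f * g) h = f * cross g h + g * cross f h := by
  induction f using S_ind with
  | h1 => rw [one_mul, one_mul, cross_one]; ring
  | ha f g hf hg => rw [add_mul, cross_add, hf, hg, cross_add]; ring
  | hs c f hf => rw [smul_mul_assoc, cross_smul, hf, cross_smul]; simp only [smulS]; ring
  | hp n f hf => rw [mul_assoc, cross_p, hf, cross_p]; simp only [smulS]; ring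

lemma alpha_smul_inj {x y : SymA} (h : alpha • x = alpha • y) : x = y := by
  have := congrArg (fun z => alpha⁻¹ • z) h
  simpa only [smul_smul, inv_mul_cancel₀ alpha_ne, one_smul] using this

lemma cross_gg (m k : ℕ) : alpha • cross (gg m) (gg k) = ∑ x ∈ Finset.HasAntidiagonal.antidiagonal m, ∑ y ∈ Finset.HasAntidiagonal.antidiagonal k,
    (if x.1 = 0 then 0 else if y.1 = 0 then 0 else pX (x.1 + y.1)) * gg x.2 * gg y.2 := by
  have : cross (gg m) (gg k) = ∑ x ∈ Finset.HasAntidiagonal.antidiagonal m, (if x.1 = 0 then 0 else gg x.2) * dn x.1 (gg k) := by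
    rw [cross, finsum_eq_sum_of_support_subset (s := Finset.range (m + 1)),
      Finset.Nat.sum_antidiagonal_eq_sum_range_succ (fun a b => (if a = 0 then 0 else gg b) * dn a (gg k))]
    · refine Finset.sum_congr rfl fun j hj => ?_
      rw [Finset.mem_range] at hj
      rcases Nat.eq_zero_or_pos j with rfl | h
      · rw [qn_zero]; simp
      · rw [if_neg h.ne', qn_gg j h, if_pos (by omega)]
    · intro j hj
      simp only [Function.mem_support] at hj
      simp only [Finset.coe_range, Set.mem_Iio]
      by_contra h
      exact hj (by rw [qn_gg j (by omega), if_neg (by omega), zero_mul])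
  rw [this, Finset.smul_sum]
  refine Finset.sum_congr rfl fun x _ => ?_
  rw [← mul_smul_comm, dn_gg, Finset.mul_sum]
  refine Finset.sum_congr rfl fun y _ => ?_
  split_ifs
  · simp
  · simp
  · simp
  · rw [add_comm y.1]; ring

lemma cross_gg_zero (m : ℕ) : cross (gg m) (gg 0) = 0 := by
  apply alpha_smul_inj
  rw [cross_gg, smul_zero]
  refine Finset.sum_eq_zero fun x _ => Finset.sum_eq_zero fun y hy => ?_
  rw [Finset.HasAntidiagonal.mem_antidiagonal] at hy
  rw [if_pos (show y.1 = 0 by omega)]; simp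

lemma cross_rec (m k : ℕ) : cross (gg m) (gg (k + 1)) = cross (gg (m + 1)) (gg k) + ((m + 1 : ℕ) : F) • (gg (m + 1) * gg k)
    - ((k + 1 : ℕ) : F) • (gg m * gg (k + 1)) := by
  apply alpha_smul_inj
  have h1 := gg_newton (m + 1)
  have h2 := gg_newton (k + 1)
  rw [Finset.Nat.sum_antidiagonal_succ, pX_zero, zero_mul, zero_add] at h1 h2
  have e1 : alpha • cross (gg m) (gg (k + 1)) = ∑ x ∈ Finset.HasAntidiagonal.antidiagonal m, ∑ y ∈ Finset.HasAntidiagonal.antidiagonal k,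
      pX (x.1 + y.1 + 1) * gg x.2 * gg y.2 - gg m * ∑ y ∈ Finset.HasAntidiagonal.antidiagonal k, pX (y.1 + 1) * gg y.2 := by
    rw [cross_gg]
    have : ∀ x ∈ Finset.HasAntidiagonal.antidiagonal m, ∑ y ∈ Finset.HasAntidiagonal.antidiagonal (k + 1),
      (if x.1 = 0 then 0 else if y.1 = 0 then 0 else pX (x.1 + y.1)) * gg x.2 * gg y.2 =
      ∑ y ∈ Finset.HasAntidiagonal.antidiagonal k, pX (x.1 + y.1 + 1) * gg x.2 * gg y.2 - 
       if x.1 = 0 then gg m * ∑ y ∈ Finset.HasAntidiagonal.antidiagonal k, pX (y.1 + 1) * gg y.2 else 0 := by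
      intro x hx
      rw [Finset.HasAntidiagonal.mem_antidiagonal] at hx
      rw [Finset.Nat.sum_antidiagonal_succ]
      by_cases h : x.1 = 0
      · have : x.2 = m := by omega
        simp only [h, if_true, this, zero_mul, Finset.sum_const_zero, add_zero, zero_add, Finset.mul_sum]
        rw [eq_comm, sub_eq_zero]
        exact Finset.sum_congr rfl fun y _ => by ring
      · simp only [h, if_false, if_true, zero_mul, zero_add, sub_zero, Nat.add_eq_zero_iff, one_ne_zero, and_false, add_assoc]
    rw [Finset.sum_congr rfl this, Finset.sum_sub_distrib]
    congr 1
    rw [Finset.sum_eq_single (0, m)]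
    · simp
    · rintro ⟨a, b⟩ hx hne
      rw [if_neg]; rintro rfl
      rw [Finset.HasAntidiagonal.mem_antidiagonal] at hx
      simp at hx hne; exact hne hx
    · simp
  have e2 : alpha • cross (gg (m + 1)) (gg k) = ∑ x ∈ Finset.HasAntidiagonal.antidiagonal m, ∑ y ∈ Finset.HasAntidiagonal.antidiagonal k,
      pX (x.1 + y.1 + 1) * gg x.2 * gg y.2 - gg k * ∑ x ∈ Finset.HasAntidiagonal.antidiagonal m, pX (x.1 + 1) * gg x.2 := by
    rw [cross_gg, Finset.Nat.sum_antidiagonal_succ]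
    simp only [if_true, zero_mul, Finset.sum_const_zero, zero_add, Nat.add_eq_zero_iff, one_ne_zero, and_false, if_false]
    rw [Finset.mul_sum, ← Finset.sum_sub_distrib]
    refine Finset.sum_congr rfl fun x _ => ?_
    have : ∀ y ∈ Finset.HasAntidiagonal.antidiagonal k, (if y.1 = 0 then 0 else pX (x.1 + 1 + y.1)) * gg x.2 * gg y.2 =
      pX (x.1 + y.1 + 1) * gg x.2 * gg y.2 - if y.1 = 0 then gg k * (pX (x.1 + 1) * gg x.2) else 0 := by
      intro y hy
      rw [Finset.HasAntidiagonal.mem_antidiagonal] at hy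
      by_cases h : y.1 = 0
      · have : y.2 = k := by omega
        simp only [h, if_true, this, add_zero]; ring
      · simp only [h, if_false, sub_zero]; rw [add_right_comm]
    rw [Finset.sum_congr rfl this, Finset.sum_sub_distrib]
    congr 1
    rw [Finset.sum_eq_single (0, k)]
    · simp
    · rintro ⟨a, b⟩ hx hne
      rw [if_neg]; rintro rfl
      rw [Finset.HasAntidiagonal.mem_antidiagonal] at hx
      simp at hx hne; exact hne hx
    · simp
  rw [smul_sub, smul_add, e1, e2, ← h1, ← h2]
  simp only [smulS, map_mul]; ring

end

section
/-- truncated excess statistic -/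
def PP (M : Multiset ℕ) (t : ℕ) : ℕ := (M.map fun x => x - t).sum
def sM (M : Multiset ℕ) : ℕ := (M.map fun x => x.choose 2).sum
def mm (M : Multiset ℕ) : ℕ := (M.map fun a => (M.map fun b => min a b).sum).sum
def eM (M : Multiset ℕ) : F := alpha * (sM M : F) - ((mm M : F) - (PP M 0 : F)) / 2
def ple (M M' : Multiset ℕ) : Prop := PP M 0 = PP M' 0 ∧ ∀ t, PP M t ≤ PP M' t
def plt (M M' : Multiset ℕ) : Prop := ple M M' ∧ sM M < sM M'

@[simp] lemma PP_zero (t : ℕ) : PP 0 t = 0 := rfl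
@[simp] lemma PP_cons (x : ℕ) (M : Multiset ℕ) (t : ℕ) : PP (x ::ₘ M) t = (x - t) + PP M t := by simp [PP]
@[simp] lemma PP_add (M N : Multiset ℕ) (t : ℕ) : PP (M + N) t = PP M t + PP N t := by simp [PP]
@[simp] lemma sM_zero : sM 0 = 0 := rfl
@[simp] lemma sM_cons (x : ℕ) (M : Multiset ℕ) : sM (x ::ₘ M) = x.choose 2 + sM M := by simp [sM]
@[simp] lemma sM_add (M N : Multiset ℕ) : sM (M + N) = sM M + sM N := by simp [sM]
@[simp] lemma mm_zero : mm 0 = 0 := rfl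
lemma mm_cons (x : ℕ) (M : Multiset ℕ) : mm (x ::ₘ M) = x + 2 * (M.map fun b => min x b).sum + mm M := by
  simp only [mm, Multiset.map_cons, Multiset.sum_cons, min_self, Multiset.sum_map_add]
  have : (M.map fun a => min a x) = M.map fun b => min x b := by simp only [min_comm]
  rw [this]; ring

lemma eM_zero : eM 0 = 0 := by simp [eM]
lemma eM_cons (x : ℕ) (M : Multiset ℕ) : eM (x ::ₘ M) = alpha * x * (x - 1) / 2 + eM M - ((M.map fun b => min x b).sum : ℕ) := by
  simp only [eM, sM_cons, mm_cons, PP_cons, Nat.cast_add, Nat.cast_choose_two, Nat.cast_mul, Nat.sub_zero]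
  push_cast
  ring

lemma PP_size (M : Multiset ℕ) : PP M 0 = M.sum := by simp [PP]

lemma min_sum_of_le (v : ℕ) (M : Multiset ℕ) (h : ∀ i ∈ M, i ≤ v) : (M.map fun b => min v b).sum = PP M 0 := by
  rw [PP_size]
  congr 1
  conv_rhs => rw [← Multiset.map_id M]
  exact Multiset.map_congr rfl fun i hi => min_eq_right (h i hi)

lemma choose_two_eq (x T : ℕ) (h : x ≤ T) : x.choose 2 = ∑ t ∈ Finset.range T, (x - (t + 1)) := by
  induction x generalizing T with
  | zero => simp
  | succ x ih =>
    obtain ⟨T, rfl⟩ : ∃ T', T = T' + 1 := ⟨T - 1, by omega⟩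
    rw [Finset.sum_range_succ', Nat.choose_succ_succ' x 1, ih T (by omega)]
    have : ∀ t, x + 1 - (t + 1 + 1) = x - (t + 1) := fun t => by omega
    simp only [this, zero_add, Nat.add_sub_cancel, Nat.choose_one_right]; ring

lemma sM_eq (M : Multiset ℕ) (T : ℕ) (h : PP M 0 ≤ T) : sM M = ∑ t ∈ Finset.range T, PP M (t + 1) := by
  induction M using Multiset.induction_on with
  | empty => simp
  | cons x M ih =>
    rw [PP_cons] at h
    simp only [sM_cons, PP_cons, Finset.sum_add_distrib]
    rw [ih (by omega), choose_two_eq x T (by omega)]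

lemma ple.refl (M : Multiset ℕ) : ple M M := ⟨rfl, fun _ => le_rfl⟩
lemma ple.trans {M N K : Multiset ℕ} (h : ple M N) (h' : ple N K) : ple M K :=
  ⟨h.1.trans h'.1, fun t => (h.2 t).trans (h'.2 t)⟩

lemma ple.sM_le {M N : Multiset ℕ} (h : ple M N) : sM M ≤ sM N := by
  rw [sM_eq M _ le_rfl, sM_eq N (PP M 0) h.1.ge]
  exact Finset.sum_le_sum fun t _ => h.2 _

lemma PP_big (M : Multiset ℕ) (t : ℕ) (h : PP M 0 ≤ t) : PP M t = 0 := by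
  induction M using Multiset.induction_on with
  | empty => simp
  | cons x M ih => rw [PP_cons] at *; rw [ih (by omega)]; omega

lemma ple.eq_of_sM {M N : Multiset ℕ} (h : ple M N) (hs : sM N ≤ sM M) (t : ℕ) : PP M t = PP N t := by
  rcases t with _ | t
  · exact h.1
  by_cases ht : t < PP M 0
  · have := hs.antisymm h.sM_le
    rw [sM_eq M _ le_rfl, sM_eq N (PP M 0) h.1.ge] at this
    exact ((Finset.sum_eq_sum_iff_of_le (fun t _ => h.2 (t + 1))).1 this.symm) t (by simpa using ht)
  · rw [PP_big M _ (by omega), PP_big N _ (by have := h.1; omega)]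

lemma count_PP (M : Multiset ℕ) (x : ℕ) : M.count (x + 1) + 2 * PP M (x + 1) = PP M x + PP M (x + 2) := by
  induction M using Multiset.induction_on with
  | empty => simp
  | cons y M ih =>
    rw [Multiset.count_cons]; simp only [PP_cons]
    split_ifs <;> omega

lemma PP_eq_zero (M : Multiset ℕ) (v : ℕ) : PP M v = 0 ↔ ∀ i ∈ M, i ≤ v := by
  rw [PP, Multiset.sum_eq_zero_iff]
  simp [Nat.sub_eq_zero_iff_le]

/-- parts as naturals -/
def lN (l : JPartition) : Multiset ℕ := Multiset.map (fun i : ℕ+ => (i : ℕ)) l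
lemma lN_raw (l : JPartition) : (l.map fun i => (i : ℕ)) = lN l := by
  rw [Multiset.map_id', lN]
  simp only [Multiset.bind_def, Multiset.pure_def, Multiset.bind_singleton]
@[simp] lemma lN_zero : lN 0 = 0 := rfl
@[simp] lemma lN_cons (v : ℕ+) (l : JPartition) : lN (v ::ₘ l) = (v : ℕ) ::ₘ lN l := by simp [lN]
lemma lN_size (l : JPartition) : PP (lN l) 0 = psize l := by rw [PP_size, psize, lN_raw]

lemma lN_inj_PP {l m : JPartition} (h : ∀ t, PP (lN l) t = PP (lN m) t) : l = m := by
  refine Multiset.ext' fun i => ?_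
  have key : ∀ l : JPartition, l.count i = (lN l).count (i : ℕ) := fun l =>
    (Multiset.count_map_eq_count' (fun i : ℕ+ => (i : ℕ)) l PNat.coe_injective i).symm
  obtain ⟨x, hx⟩ : ∃ x, (i : ℕ) = x + 1 := ⟨(i : ℕ) - 1, by have := i.pos; omega⟩
  rw [key, key, hx]
  have h1 := count_PP (lN l) x
  have h2 := count_PP (lN m) x
  rw [h, h, h] at h1
  omega

lemma lN_ple_eq {l m : JPartition} (h : ple (lN l) (lN m)) (hs : sM (lN m) ≤ sM (lN l)) : l = m :=
  lN_inj_PP (h.eq_of_sM hs)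

lemma lN_antisymm {l m : JPartition} (h : ple (lN l) (lN m)) (h' : ple (lN m) (lN l)) : l = m :=
  lN_ple_eq h h'.sM_le

lemma take_le (L : List ℕ) (k t : ℕ) : (L.take k).sum ≤ k * t + (L.map fun x => x - t).sum := by
  induction L generalizing k with
  | nil => simp
  | cons a L ih =>
    rcases k with _ | k
    · simp
    · have := ih k
      simp only [List.take_succ_cons, List.sum_cons, List.map_cons]
      have : (k + 1) * t = k * t + t := by ring
      omega

lemma exists_take (L : List ℕ) (hL : L.Pairwise (· ≥ ·)) (t : ℕ) :
    ∃ k, k * t + (L.map fun x => x - t).sum ≤ (L.take k).sum := by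
  induction L with
  | nil => exact ⟨0, by simp⟩
  | cons a L ih =>
    rw [List.pairwise_cons] at hL
    by_cases h : a ≤ t
    · refine ⟨0, ?_⟩
      have : ∀ x ∈ ((a :: L).map fun x => x - t), x = 0 := by
        intro x hx
        rw [List.mem_map] at hx
        obtain ⟨y, hy, rfl⟩ := hx
        rcases List.mem_cons.1 hy with rfl | hy
        · omega
        · have := hL.1 y hy; omega
      rw [List.sum_eq_zero this]; simp
    · obtain ⟨k, hk⟩ := ih hL.2
      refine ⟨k + 1, ?_⟩
      simp only [List.take_succ_cons, List.sum_cons, List.map_cons]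
      have : (k + 1) * t = k * t + t := by ring
      omega

lemma sp_pairwise (l : JPartition) : (sortedParts l).Pairwise (· ≥ ·) := by
  rw [sortedParts, List.pairwise_reverse]
  exact Multiset.pairwise_sort _ _

lemma sp_coe (l : JPartition) : ((sortedParts l : List ℕ) : Multiset ℕ) = lN l := by
  rw [sortedParts, Multiset.coe_reverse, Multiset.sort_eq, lN_raw]

lemma PP_sp (l : JPartition) (t : ℕ) : PP (lN l) t = ((sortedParts l).map fun x => x - t).sum := by
  rw [← sp_coe, PP, Multiset.map_coe, Multiset.sum_coe]

lemma ple_of_dominates {m l : JPartition} (h : dominates m l) : ple (lN m) (lN l) := by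
  refine ⟨by rw [lN_size, lN_size, h.1], fun t => ?_⟩
  rw [PP_sp, PP_sp]
  obtain ⟨k, hk⟩ := exists_take _ (sp_pairwise m) t
  have h1 := h.2 k
  have h2 := take_le (sortedParts l) k t
  rw [topSum, topSum] at h1
  omega

lemma sp_cons (v : ℕ+) (l : JPartition) (h : ∀ i ∈ l, i ≤ v) : sortedParts (v ::ₘ l) = (v : ℕ) :: sortedParts l := by
  refine List.Perm.eq_of_pairwise (le := (· ≥ ·)) (fun a b _ _ h1 h2 => le_antisymm h2 h1) (sp_pairwise _) ?_ ?_
  · rw [List.pairwise_cons]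
    refine ⟨fun a ha => ?_, sp_pairwise _⟩
    have : a ∈ lN l := by rw [← sp_coe]; exact ha
    obtain ⟨i, hi, rfl⟩ := Multiset.mem_map.1 this
    exact h i hi
  · rw [← Multiset.coe_eq_coe, sp_coe, ← Multiset.cons_coe, sp_coe, lN_cons]

lemma jp_ind {p : JPartition → Prop} (h0 : p 0) (h1 : ∀ (v : ℕ+) l, (∀ i ∈ l, i ≤ v) → p l → p (v ::ₘ l)) (l : JPartition) : p l := by
  induction hn : Multiset.card l generalizing l with
  | zero => rw [Multiset.card_eq_zero] at hn; rw [hn]; exact h0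
  | succ n ih =>
    have hne : l ≠ 0 := by rintro rfl; simp at hn
    obtain ⟨v, hv, hm⟩ := l.toFinset.exists_max_image id (by simpa [Multiset.toFinset_nonempty] using hne)
    rw [Multiset.mem_toFinset] at hv
    obtain ⟨l', rfl⟩ := Multiset.exists_cons_of_mem hv
    refine h1 v l' (fun i hi => hm i (by simp [hi])) (ih l' (by simpa using hn))

/-- in `ℚ(α)`, comparing coefficients of `α` -/
lemma alpha_indep (c d : ℚ) (h : alpha * algebraMap ℚ F c = algebraMap ℚ F d) : c = 0 := by
  have h' : (algebraMap (Polynomial ℚ) F) (Polynomial.X * Polynomial.C c) = algebraMap (Polynomial ℚ) F (Polynomial.C d) := by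
    rw [map_mul, RatFunc.algebraMap_X, RatFunc.algebraMap_C, RatFunc.algebraMap_C]
    have e : ∀ q : ℚ, algebraMap ℚ F q = RatFunc.C q := fun q => by simp
    rw [e, e] at h; exact h
  have := RatFunc.algebraMap_injective ℚ h'
  have := congrArg (Polynomial.coeff · 1) this
  simpa [Polynomial.coeff_C] using this

lemma sM_of_eM {M N : Multiset ℕ} (k : ℕ) (h : eM M = eM N + alpha * k) : sM M = sM N + k := by
  have := alpha_indep ((sM M : ℚ) - sM N - k) (((mm M : ℚ) - PP M 0) / 2 - ((mm N : ℚ) - PP N 0) / 2) (by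
    simp only [eM] at h
    simp only [map_sub, map_div₀, map_natCast, map_ofNat]
    linear_combination h)
  have h2 : (sM M : ℚ) = ((sM N + k : ℕ) : ℚ) := by push_cast; linarith
  exact_mod_cast h2

/-- products of `g`'s -/
def gM (M : Multiset ℕ) : SymA := (M.map gg).prod
@[simp] lemma gM_zero : gM 0 = 1 := by simp [gM]
@[simp] lemma gM_cons (x : ℕ) (M : Multiset ℕ) : gM (x ::ₘ M) = gg x * gM M := by simp [gM]
@[simp] lemma gM_add (M N : Multiset ℕ) : gM (M + N) = gM M * gM N := by simp [gM]

lemma gg_mem_adjoin (A : Subalgebra F SymA) (h : ∀ n, gg n ∈ A) : A = ⊤ := by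
  have hp : ∀ n, pX n ∈ A := by
    intro n
    induction n using Nat.strong_induction_on with
    | _ n ih =>
      rcases Nat.eq_zero_or_pos n with rfl | hn
      · rw [pX_zero]; exact A.zero_mem
      have h1 := gg_newton n
      obtain ⟨m, rfl⟩ : ∃ m, n = m + 1 := ⟨n - 1, by omega⟩
      rw [Finset.Nat.sum_antidiagonal_succ'] at h1
      simp only [gg_zero, mul_one] at h1
      rw [eq_comm, add_comm] at h1
      rw [eq_sub_of_add_eq' h1]
      refine A.sub_mem (A.smul_mem (h _) _) (A.sum_mem fun x hx => ?_)
      have := Finset.HasAntidiagonal.mem_antidiagonal.1 hx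
      exact A.mul_mem (ih _ (by omega)) (h _)
  rw [eq_top_iff, ← MvPolynomial.adjoin_range_X]
  refine Algebra.adjoin_le ?_
  rintro _ ⟨i, rfl⟩
  have := hp i
  rwa [pX_pnat] at this

lemma gM_span : Submodule.span F (Set.range gM) = ⊤ := by
  have h := gg_mem_adjoin (Algebra.adjoin F (Set.range gg)) fun n => Algebra.subset_adjoin ⟨n, rfl⟩
  rw [eq_top_iff]
  have h2 := Algebra.adjoin_eq_span F (Set.range gg)
  rw [h] at h2
  intro x _
  have : x ∈ (⊤ : Subalgebra F SymA).toSubmodule := trivial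
  rw [h2] at this
  refine Submodule.span_mono ?_ this
  intro y hy
  induction hy using Submonoid.closure_induction with
  | mem x hx => obtain ⟨n, rfl⟩ := hx; exact ⟨{n}, by simp [gM]⟩
  | one => exact ⟨0, by simp⟩
  | mul x y _ _ hx hy => obtain ⟨M, rfl⟩ := hx; obtain ⟨N, rfl⟩ := hy; exact ⟨M + N, by simp⟩

lemma gM_lN (M : Multiset ℕ) : ∃ l : JPartition, gM M = gM (lN l) ∧ ∀ t, PP M t = PP (lN l) t := by
  induction M using Multiset.induction_on with
  | empty => exact ⟨0, by simp⟩
  | cons x M ih =>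
    obtain ⟨l, h1, h2⟩ := ih
    rcases Nat.eq_zero_or_pos x with rfl | hx
    · exact ⟨l, by simp [gg_zero, h1], fun t => by simp [h2]⟩
    · obtain ⟨i, rfl⟩ := exists_pnat hx
      exact ⟨i ::ₘ l, by simp [h1], fun t => by simp [h2]⟩

lemma gM_span' : Submodule.span F (Set.range fun l : JPartition => gM (lN l)) = ⊤ := by
  rw [eq_top_iff, ← gM_span]
  refine Submodule.span_mono ?_
  rintro _ ⟨M, rfl⟩
  obtain ⟨l, h, _⟩ := gM_lN M
  exact ⟨l, h.symm⟩

end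

section
lemma cross_comm (f g : SymA) : cross f g = cross g f := by
  have h1 := D_prod f g
  have h2 := D_prod g f
  rw [mul_comm g f] at h2
  linear_combination h2 - h1

lemma cross_mul_right (f g h : SymA) : cross f (g * h) = g * cross f h + h * cross f g := by
  rw [cross_comm, cross_mul_left, cross_comm h, cross_comm g]

lemma cross_span (m k : ℕ) : cross (gg m) (gg k) + (k : F) • (gg m * gg k) ∈
    Submodule.span F {f | ∃ m' k', f = gg m' * gg k' ∧ m' + k' = m + k ∧ m < m'} := by
  induction k generalizing m with
  | zero => rw [cross_gg_zero]; simp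
  | succ k ih =>
    have h := ih (m + 1)
    have e : cross (gg m) (gg (k + 1)) + ((k + 1 : ℕ) : F) • (gg m * gg (k + 1)) =
      (cross (gg (m + 1)) (gg k) + (k : F) • (gg (m + 1) * gg k)) + (((m + 1 : ℕ) : F) - k) • (gg (m + 1) * gg k) := by
      rw [cross_rec]; simp only [smulS, map_sub]; ring
    rw [e]
    refine Submodule.add_mem _ (Submodule.span_mono ?_ h) (Submodule.smul_mem _ _ (Submodule.subset_span ⟨m + 1, k, rfl, by omega, by omega⟩))
    rintro f ⟨m', k', rfl, h1, h2⟩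
    exact ⟨m', k', rfl, by omega, by omega⟩

/-- span of strictly dominating products -/
def Tsp (M : Multiset ℕ) : Submodule F SymA := Submodule.span F {f | ∃ M', f = gM M' ∧ plt M M'}

lemma plt_pair (m k m' k' : ℕ) (h : m' + k' = m + k) (hm : m < m') (hk : k ≤ m) : plt {m, k} {m', k'} := by
  have e : ∀ a b : ℕ, ({a, b} : Multiset ℕ) = a ::ₘ b ::ₘ 0 := fun a b => rfl
  simp only [e, plt, ple, PP_cons, sM_cons, PP_zero, sM_zero]
  refine ⟨⟨by omega, fun t => by omega⟩, ?_⟩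
  obtain ⟨d, rfl⟩ : ∃ d, m' = m + d := ⟨m' - m, by omega⟩
  have hk' : k = k' + d := by omega
  subst hk'
  have : ((m.choose 2 + ((k' + d).choose 2 + 0) : ℕ) : ℚ) < (((m + d).choose 2 + (k'.choose 2 + 0) : ℕ) : ℚ) := by
    push_cast [Nat.cast_choose_two]
    have h1 : (k' : ℚ) + d ≤ m := by exact_mod_cast hk
    have h2 : (1 : ℚ) ≤ d := by exact_mod_cast (by omega : 1 ≤ d)
    nlinarith
  exact_mod_cast this

lemma cross_T (m k : ℕ) : cross (gg m) (gg k) + ((min m k : ℕ) : F) • (gg m * gg k) ∈ Tsp {m, k} := by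
  wlog h : k ≤ m generalizing m k
  · have := this k m (by omega)
    rwa [cross_comm, min_comm, mul_comm (gg k), Multiset.pair_comm] at this
  rw [min_eq_right h]
  refine Submodule.span_mono ?_ (cross_span m k)
  rintro f ⟨m', k', rfl, h1, h2⟩
  exact ⟨{m', k'}, by simp [gM], plt_pair _ _ _ _ h1 h2 h⟩

lemma T_mul (N M : Multiset ℕ) {f : SymA} (hf : f ∈ Tsp M) : gM N * f ∈ Tsp (N + M) := by
  induction hf using Submodule.span_induction with
  | mem x hx =>
    obtain ⟨M', rfl, h⟩ := hx
    refine Submodule.subset_span ⟨N + M', by simp, ⟨⟨?_, fun t => ?_⟩, ?_⟩⟩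
    · simp [h.1.1]
    · simp [h.1.2 t]
    · simp [h.2]
  | zero => simp
  | add x y _ _ hx hy => rw [mul_add]; exact Submodule.add_mem _ hx hy
  | smul c x _ hx => rw [mul_smul_comm]; exact Submodule.smul_mem _ _ hx

lemma cross_gM (x : ℕ) (M : Multiset ℕ) : cross (gg x) (gM M) + ((M.map fun b => min x b).sum : ℕ) • (gg x * gM M) ∈ Tsp (x ::ₘ M) := by
  induction M using Multiset.induction_on with
  | empty => rw [gM_zero, cross_comm, cross_one]; simp
  | cons y M ih =>
    rw [gM_cons, cross_mul_right, Multiset.map_cons, Multiset.sum_cons]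
    have h1 := T_mul {y} _ ih
    have h2 := T_mul M _ (cross_T x y)
    have e1 : ({y} : Multiset ℕ) + (x ::ₘ M) = x ::ₘ y ::ₘ M := by
      rw [Multiset.singleton_add, Multiset.cons_swap]
    have e2 : M + {x, y} = x ::ₘ y ::ₘ M := by
      rw [add_comm, show ({x, y} : Multiset ℕ) = x ::ₘ {y} from rfl, Multiset.cons_add, Multiset.singleton_add]
    rw [e1] at h1; rw [e2] at h2
    have := Submodule.add_mem _ h1 h2
    convert this using 1
    simp only [gM, Multiset.map_singleton, Multiset.prod_singleton, smulS, nsmul_eq_mul, map_natCast, Nat.cast_add]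
    ring

lemma D_gM (M : Multiset ℕ) : Dop (gM M) - eM M • gM M ∈ Tsp M := by
  induction M using Multiset.induction_on with
  | empty => rw [gM_zero, D_one, eM_zero]; simp
  | cons x M ih =>
    rw [gM_cons, D_prod, D_gg, eM_cons]
    have h1 := T_mul {x} _ ih
    have h2 := cross_gM x M
    rw [Multiset.singleton_add] at h1
    have := Submodule.add_mem _ h1 h2
    convert this using 1
    simp only [gM, Multiset.map_singleton, Multiset.prod_singleton, smulS, nsmul_eq_mul, map_natCast, Nat.cast_add, map_sub, map_add]
    ring

lemma dn_zero : dn 0 = Eder := der_ext fun n => by rw [dn_pX, Eder_pX]; rfl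

lemma E_gg (n : ℕ) : Eder (gg n) = (n : F) • gg n := by
  apply alpha_smul_inj
  rw [← dn_zero, dn_gg, smul_smul, gg_newton]
  refine Finset.sum_congr rfl fun x _ => ?_
  split_ifs with h
  · rw [h, pX_zero]
  · rfl

lemma E_gM (M : Multiset ℕ) : Eder (gM M) = (PP M 0 : F) • gM M := by
  induction M using Multiset.induction_on with
  | empty => simp
  | cons x M ih =>
    rw [gM_cons, Derivation.leibniz, ih, E_gg, PP_cons]
    simp only [smulS, smul_eq_mul, map_natCast, Nat.cast_add, Nat.sub_zero, map_add]; ring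

/-- the ideal generated by `g_n`, `n > v` -/
def Iv (v : ℕ) : Ideal SymA := Ideal.span {f | ∃ n, v < n ∧ f = gg n}
lemma gg_Iv {v n : ℕ} (h : v < n) : gg n ∈ Iv v := Ideal.subset_span ⟨n, h, rfl⟩
lemma smul_Iv {v : ℕ} {f : SymA} (c : F) (h : f ∈ Iv v) : c • f ∈ Iv v := by
  rw [smulS]; exact Ideal.mul_mem_left _ _ h
lemma of_smul_Iv {v : ℕ} {f : SymA} (h : alpha • f ∈ Iv v) : f ∈ Iv v := by
  have := smul_Iv alpha⁻¹ h
  rwa [smul_smul, inv_mul_cancel₀ alpha_ne, one_smul] at this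

lemma dn_gg_Iv (v j : ℕ) (hj : 0 < j) : alpha • dn j (gg v) + pX j * gg v ∈ Iv v := by
  have h := gg_newton (v + j)
  rw [Finset.Nat.sum_antidiagonal_eq_sum_range_succ (fun a b => pX a * gg b), show (v + j).succ = j + (v + 1) by omega,
    Finset.sum_range_add] at h
  have e : alpha • dn j (gg v) + pX j * gg v = ∑ x ∈ Finset.range (v + 1), pX (j + x) * gg (v + j - (j + x)) := by
    rw [dn_gg, Finset.Nat.sum_antidiagonal_eq_sum_range_succ (fun a b => (if a = 0 then 0 else pX (a + j)) * gg b),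
      Finset.sum_range_succ', Finset.sum_range_succ']
    simp only [Nat.succ_ne_zero, if_false, if_true, zero_mul, add_zero, Nat.sub_zero, Nat.add_sub_cancel]
    congr 1
    refine Finset.sum_congr rfl fun x _ => ?_
    rw [show v + j - (j + (x + 1)) = v - (x + 1) by omega, add_comm j]
  rw [e, ← sub_eq_iff_eq_add'.2 h]
  refine Submodule.sub_mem _ (smul_Iv _ (gg_Iv (by omega))) (Submodule.sum_mem _ fun x hx => ?_)
  rw [Finset.mem_range] at hx
  exact Ideal.mul_mem_left _ _ (gg_Iv (by omega))

lemma D_mod_Iv (v : ℕ) (h : SymA) : Dop (gg v * h) - gg v * (Dop h + (alpha * v * (v - 1) / 2) • h - Eder h) ∈ Iv v := by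
  have key : cross h (gg v) + gg v * Eder h ∈ Iv v := by
    apply of_smul_Iv
    have e : alpha • (cross h (gg v) + gg v * Eder h) = ∑ᶠ j, qn j h * (alpha • dn j (gg v) + pX j * gg v) := by
      rw [smul_add, ← mul_smul_comm, ← dn_zero, dn_finsum, mul_finsum, cross, smul_finsum, ← finsum_add_distrib]
      · refine finsum_congr fun j => ?_
        simp only [smulS, add_zero]; ring
      · exact (cross_fin h (gg v)).subset fun j hj => right_ne_zero_of_smul hj
      · refine (qn_fin h).subset fun j hj => right_ne_zero_of_mul (right_ne_zero_of_mul hj)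
    rw [e]
    refine finsum_induction (p := (· ∈ Iv v)) (zero_mem _) (fun _ _ => add_mem) fun j => ?_
    rcases Nat.eq_zero_or_pos j with rfl | hj
    · rw [qn_zero]; simp
    · exact Ideal.mul_mem_left _ _ (dn_gg_Iv v j hj)
  convert key using 1
  rw [mul_comm, D_prod, D_gg]
  simp only [smulS]; ring

lemma Iv_span (v : ℕ) (f : SymA) (hf : f ∈ Iv v) : f ∈ Submodule.span F {f | ∃ M, f = gM M ∧ PP M v ≠ 0} := by
  have : (Iv v : Set SymA) ⊆ (Submodule.span F {f | ∃ M, f = gM M ∧ PP M v ≠ 0} : Submodule F SymA) := by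
    intro f hf
    refine Submodule.span_induction (p := fun f _ => f ∈ (Submodule.span F {f | ∃ M, f = gM M ∧ PP M v ≠ 0} : Submodule F SymA)) ?_ (zero_mem _) (fun _ _ _ _ => add_mem) ?_ hf
    · rintro _ ⟨n, hn, rfl⟩
      refine Submodule.subset_span ⟨n ::ₘ 0, by rw [gM_cons, gM_zero, mul_one], by rw [PP_cons, PP_zero]; omega⟩
    · intro a x hx' hx
      clear hx'
      have ha : a ∈ Submodule.span F (Set.range gM) := by rw [gM_span]; trivial
      induction ha using Submodule.span_induction with
      | mem a ha =>
        obtain ⟨N, rfl⟩ := ha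
        rw [smul_eq_mul]
        induction hx using Submodule.span_induction with
        | mem x hx =>
          obtain ⟨M, rfl, h⟩ := hx
          exact Submodule.subset_span ⟨N + M, by simp, by simp [h]⟩
        | zero => simp
        | add x y _ _ hx hy => rw [mul_add]; exact Submodule.add_mem _ hx hy
        | smul c x _ hx => rw [mul_smul_comm]; exact Submodule.smul_mem _ _ hx
      | zero => simp
      | add x y _ _ hx hy => rw [add_smul]; exact Submodule.add_mem _ hx hy
      | smul c x _ hx => rw [smul_assoc]; exact Submodule.smul_mem _ _ hx
  exact this hf

lemma gM_Iv (M : Multiset ℕ) (v : ℕ) (h : PP M v ≠ 0) : gM M ∈ Iv v := by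
  rw [Ne, PP_eq_zero] at h
  push Not at h
  obtain ⟨i, hi, hv⟩ := h
  obtain ⟨M', rfl⟩ := Multiset.exists_cons_of_mem hi
  rw [gM_cons]
  exact Ideal.mul_mem_right _ _ (gg_Iv hv)

/-- coefficient extraction in finitely many variables -/
lemma der_prod {ι : Type*} (d : Derivation F SymA SymA) (s : Finset ι) (f : ι → SymA) :
    d (∏ i ∈ s, f i) = ∑ j ∈ s, ∏ i ∈ s, if i = j then d (f i) else f i := by
  induction s using Finset.induction_on with
  | empty => simp
  | insert a s ha ih =>
    rw [Finset.prod_insert ha, Derivation.leibniz, ih, Finset.sum_insert ha, Finset.prod_insert ha, if_pos rfl, smul_eq_mul, smul_eq_mul, add_comm, Finset.mul_sum, mul_comm]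
    congr 1
    · congr 1
      refine Finset.prod_congr rfl fun i hi => (if_neg ?_).symm
      rintro rfl; exact ha hi
    · refine Finset.sum_congr rfl fun j hj => ?_
      rw [Finset.prod_insert ha, if_neg]
      rintro rfl; exact ha hj

lemma gg_coeff0 (n : ℕ) : MvPolynomial.coeff 0 (gg n) = if n = 0 then 1 else 0 := by
  split_ifs with h
  · rw [h, gg_zero]; simp
  · have := congrArg (MvPolynomial.coeff 0) (gg_newton n)
    rw [MvPolynomial.coeff_smul, MvPolynomial.coeff_sum, Finset.sum_eq_zero, smul_eq_zero] at this
    · rcases this with h1 | h1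
      · exact absurd h1 (mul_ne_zero alpha_ne (Nat.cast_ne_zero.2 h))
      · exact h1
    · intro x _
      rw [← hB_one, hB_one_p]

lemma evalN_coeff (N : ℕ) (a : Fin N →₀ ℕ) (f : SymA) :
    MvPolynomial.coeff a (evalN N f) = hB (∏ i, gg (a i)) f := by
  induction f using S_ind generalizing a with
  | h1 =>
    rw [map_one, hB_comm, hB_one, MvPolynomial.coeff_one]
    have : MvPolynomial.coeff 0 (∏ i, gg (a i)) = ∏ i, MvPolynomial.coeff 0 (gg (a i)) :=
      map_prod (MvPolynomial.constantCoeff) _ _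
    rw [this]
    simp only [gg_coeff0]
    by_cases h : a = 0
    · subst h; simp
    · rw [if_neg (Ne.symm h)]
      obtain ⟨i, hi⟩ : ∃ i, a i ≠ 0 := by
        by_contra hc; push Not at hc; exact h (Finsupp.ext hc)
      rw [Finset.prod_eq_zero (Finset.mem_univ i) (if_neg hi)]
  | ha f g hf hg => rw [map_add, MvPolynomial.coeff_add, hf, hg, map_add]
  | hs c f hf => rw [map_smul, MvPolynomial.coeff_smul, hf, map_smul]
  | hp n f hf =>
    rcases Nat.eq_zero_or_pos n with rfl | hn
    · rw [pX_zero]; simp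
    rw [hB_comm, hB_p, hB_comm, der_prod, map_mul]
    have e : evalN N (pX n) = ∑ j : Fin N, MvPolynomial.X j ^ n := by
      obtain ⟨i, rfl⟩ := exists_pnat hn
      rw [pX_pnat, evalN, MvPolynomial.aeval_X]
    rw [e, Finset.sum_mul, MvPolynomial.coeff_sum, map_sum, LinearMap.sum_apply]
    refine Finset.sum_congr rfl fun j _ => ?_
    rw [MvPolynomial.X_pow_eq_monomial, MvPolynomial.coeff_monomial_mul', one_mul, hf]
    split_ifs with h
    · rw [Finsupp.single_le_iff] at h
      congr 2
      refine Finset.prod_congr rfl fun i _ => ?_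
      split_ifs with hij
      · subst hij
        rw [qn_gg n hn, if_pos h]; simp
      · rw [Finsupp.tsub_apply, Finsupp.single_eq_of_ne hij, Nat.sub_zero]
    · rw [Finsupp.single_le_iff] at h
      rw [Finset.prod_eq_zero (Finset.mem_univ j)]
      · simp
      · rw [if_pos rfl, qn_gg n hn, if_neg h]

lemma prod_getD (L : List ℕ) (N : ℕ) (h : L.length ≤ N) : ∏ j : Fin N, gg (L.getD j 0) = (L.map gg).prod := by
  induction L generalizing N with
  | nil => simp [gg_zero]
  | cons a L ih =>
    obtain ⟨N, rfl⟩ : ∃ N', N = N' + 1 := ⟨N - 1, by simp at h; omega⟩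
    rw [Fin.prod_univ_succ, List.map_cons, List.prod_cons, ← ih N (by simpa using h)]
    rfl

lemma J_tri {J : JPartition → SymA} (hJ : IsJackFamily J) (l m : JPartition) (h : hB (gM (lN m)) (J l) ≠ 0) : ple (lN m) (lN l) := by
  by_contra hn
  have h1 := hJ.triangular l m fun hd => hn (ple_of_dominates hd)
  rw [evalN_coeff] at h1
  apply h
  rw [← h1]
  congr 2
  have : ∀ j : Fin (psize l + psize m + plen m), xexp m (psize l + psize m + plen m) j = (sortedParts m).getD j 0 := fun j => rfl
  simp only [this]
  rw [prod_getD, gM, ← sp_coe, Multiset.map_coe, Multiset.prod_coe]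
  have : (sortedParts m).length = plen m := by
    rw [← Multiset.coe_card, sp_coe, lN, Multiset.card_map, plen]
  omega

end

section
lemma exists_of_span {S : Set SymA} {f : SymA} (hf : f ∈ Submodule.span F S) (φ : SymA →ₗ[F] F) (h : φ f ≠ 0) : ∃ x ∈ S, φ x ≠ 0 := by
  by_contra hn
  push Not at hn
  have : Submodule.span F S ≤ LinearMap.ker φ := Submodule.span_le.2 fun x hx => hn x hx
  exact h (this hf)

lemma sos {ι : Type*} (s : Finset ι) (c : ι → F) (a : ι → ℚ) (ha : ∀ i, 0 < a i) (k : ι → ℕ)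
    (h : ∑ i ∈ s, c i * c i * (algebraMap ℚ F (a i) * alpha ^ k i) = 0) : ∀ i ∈ s, c i = 0 := by
  obtain ⟨b, hb⟩ := IsLocalization.exist_integer_multiples (nonZeroDivisors (Polynomial ℚ)) s c
  have hb0 : algebraMap (Polynomial ℚ) F (b : Polynomial ℚ) ≠ 0 := by
    simpa using nonZeroDivisors.ne_zero b.2
  have hb' : ∀ i, ∃ P : Polynomial ℚ, i ∈ s → algebraMap (Polynomial ℚ) F P = algebraMap (Polynomial ℚ) F b * c i := by
    intro i
    by_cases hi : i ∈ s
    · obtain ⟨P, hP⟩ := hb i hi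
      refine ⟨P, fun _ => ?_⟩
      rw [hP, Algebra.smul_def]
    · exact ⟨0, fun h => absurd h hi⟩
  choose P hP using hb'
  have e : ∀ q : ℚ, algebraMap ℚ F q = algebraMap (Polynomial ℚ) F (Polynomial.C q) := fun q => by simp
  have h2 : ∑ i ∈ s, P i * P i * (Polynomial.C (a i) * Polynomial.X ^ k i) = 0 := by
    apply RatFunc.algebraMap_injective ℚ
    rw [map_sum, map_zero]
    have : ∑ i ∈ s, (algebraMap (Polynomial ℚ) F b * c i) * (algebraMap (Polynomial ℚ) F b * c i) * (algebraMap ℚ F (a i) * alpha ^ k i) = 0 := by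
      rw [← mul_zero (algebraMap (Polynomial ℚ) F b * algebraMap (Polynomial ℚ) F b), ← h, Finset.mul_sum]
      exact Finset.sum_congr rfl fun i _ => by ring
    rw [← this]
    refine Finset.sum_congr rfl fun i hi => ?_
    rw [map_mul, map_mul, map_mul, map_pow, hP i hi, RatFunc.algebraMap_X, e]; rfl
  intro i hi
  have hPi : P i = 0 := by
    refine Polynomial.eq_zero_of_infinite_isRoot _ (Set.Infinite.mono ?_ (Set.Ioi_infinite (0 : ℚ)))
    intro x hx
    have hx : 0 < x := hx
    have h3 := congrArg (Polynomial.eval x) h2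
    rw [Polynomial.eval_finset_sum, Polynomial.eval_zero, Finset.sum_eq_zero_iff_of_nonneg] at h3
    · have := h3 i hi
      simp only [Polynomial.eval_mul, Polynomial.eval_C, Polynomial.eval_pow, Polynomial.eval_X] at this
      have h4 : a i * x ^ k i ≠ 0 := (mul_pos (ha i) (pow_pos hx _)).ne'
      simpa [h4, (ha i).ne', hx.ne'] using this
    · intro j _
      simp only [Polynomial.eval_mul, Polynomial.eval_C, Polynomial.eval_pow, Polynomial.eval_X]
      exact mul_nonneg (mul_self_nonneg _) (mul_pos (ha j) (pow_pos hx _)).le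
  have := hP i hi
  rw [hPi, map_zero] at this
  exact (mul_eq_zero.1 this.symm).resolve_left hb0

lemma hB_aniso (f : SymA) (h : hB f f = 0) : f = 0 := by
  rw [← hall_eq, hall] at h
  have := sos f.support (fun m => MvPolynomial.coeff m f) (fun m => m.prod fun i k => (Nat.factorial k : ℚ) * ((i : ℕ) : ℚ) ^ k)
    (fun m => Finset.prod_pos fun i _ => mul_pos (by exact_mod_cast Nat.factorial_pos _) (pow_pos (by exact_mod_cast i.pos) _))
    (fun m => m.sum fun _ k => k) h
  ext m
  by_cases hm : m ∈ f.support
  · rw [this m hm]; simp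
  · rw [MvPolynomial.notMem_support_iff.1 hm]; simp

lemma hB_nondeg (f : SymA) (h : ∀ l : JPartition, hB (gM (lN l)) f = 0) : f = 0 := by
  apply hB_aniso
  by_contra hn
  have hf : f ∈ Submodule.span F (Set.range fun l : JPartition => gM (lN l)) := by rw [gM_span']; trivial
  obtain ⟨_, ⟨l, rfl⟩, hx⟩ := exists_of_span hf (hB.flip f) hn
  exact hx (h l)

lemma wt_add (m : Exp) (i : ℕ+) : wt (m + Finsupp.single i 1) = wt m + i := by
  rw [wt, Finsupp.sum_add_index' (by simp) (by intros; ring), Finsupp.sum_single_index (by simp), one_mul]; rfl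

lemma E_coeff (f : SymA) : ∀ m, MvPolynomial.coeff m (Eder f) = (wt m : F) * MvPolynomial.coeff m f := by
  induction f using S_ind with
  | h1 =>
    intro m
    rw [Derivation.map_one_eq_zero, MvPolynomial.coeff_one]
    split_ifs with h
    · subst h; simp [wt]
    · simp
  | ha f g hf hg => intro m; rw [map_add, MvPolynomial.coeff_add, hf, hg, MvPolynomial.coeff_add]; ring
  | hs c f hf => intro m; rw [Derivation.map_smul, MvPolynomial.coeff_smul, hf, MvPolynomial.coeff_smul]; simp only [smul_eq_mul]; ring
  | hp n f hf =>
    intro m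
    rcases Nat.eq_zero_or_pos n with rfl | hn
    · rw [pX_zero]; simp
    obtain ⟨i, rfl⟩ := exists_pnat hn
    rw [Derivation.leibniz, Eder_pX, pX_pnat, smul_eq_mul, smul_eq_mul, mul_smul_comm, MvPolynomial.coeff_add, MvPolynomial.coeff_smul,
      mul_comm f, MvPolynomial.coeff_X_mul', MvPolynomial.coeff_X_mul', hf]
    split_ifs with h
    · have hm : m = (m - Finsupp.single i 1 : Exp) + Finsupp.single i 1 := by
        rw [tsub_add_cancel_of_le]
        rw [Finsupp.single_le_iff]
        have := Finsupp.mem_support_iff.1 h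
        omega
      have : wt m = wt (m - Finsupp.single i 1 : Exp) + i := by
        conv_lhs => rw [hm]
        rw [wt_add]
      rw [this]; push_cast; simp only [smul_eq_mul]; ring
    · simp

/-- degree projection -/
def piD (d : ℕ) : SymA →ₗ[F] SymA := MvPolynomial.weightedHomogeneousComponent (fun i : ℕ+ => (i : ℕ)) d
lemma piD_coeff (d : ℕ) (f : SymA) (m : Exp) : MvPolynomial.coeff m (piD d f) = if wt m = d then MvPolynomial.coeff m f else 0 := by
  rw [piD, MvPolynomial.coeff_weightedHomogeneousComponent]; rfl
lemma coeff_of_E {k : ℕ} {f : SymA} (h : Eder f = (k : F) • f) (m : Exp) (hm : wt m ≠ k) : MvPolynomial.coeff m f = 0 := by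
  have h1 := E_coeff f m
  rw [h, MvPolynomial.coeff_smul, smul_eq_mul] at h1
  have : ((wt m : F) - k) * MvPolynomial.coeff m f = 0 := by linear_combination -h1
  rcases mul_eq_zero.1 this with h2 | h2
  · exact absurd (by exact_mod_cast sub_eq_zero.1 h2) hm
  · exact h2
lemma piD_eig {k : ℕ} (d : ℕ) {f : SymA} (h : Eder f = (k : F) • f) : piD d f = if k = d then f else 0 := by
  ext m
  rw [piD_coeff]
  by_cases hm : wt m = k
  · rw [hm]; split_ifs <;> simp
  · rw [coeff_of_E h m hm]; split_ifs <;> simp [coeff_of_E h m hm]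

lemma Sd_finite (d : ℕ) : {l : JPartition | psize l = d}.Finite := by
  have : Finite {l : JPartition // psize l = d} := by
    refine Finite.of_injective (β := Nat.Partition d) (fun l => ⟨lN l.1, fun {i} hi => ?_, ?_⟩) ?_
    · obtain ⟨j, _, rfl⟩ := Multiset.mem_map.1 hi; exact j.pos
    · rw [← PP_size, lN_size]; exact l.2
    · intro l m h
      have h2 : lN l.1 = lN m.1 := congrArg Nat.Partition.parts h
      exact Subtype.ext (lN_inj_PP fun t => by rw [h2])
  exact Set.finite_coe_iff.1 this

variable {J : JPartition → SymA}

lemma J_ne (hJ : IsJackFamily J) (l : JPartition) : J l ≠ 0 := by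
  intro h
  have := hJ.normalized l
  rw [h] at this
  simp at this

lemma J_norm (hJ : IsJackFamily J) (l : JPartition) : hB (J l) (J l) ≠ 0 := fun h => J_ne hJ l (hB_aniso _ h)
lemma J_orth (hJ : IsJackFamily J) {l m : JPartition} (h : l ≠ m) : hB (J l) (J m) = 0 := hJ.orthogonal l m h

lemma J_indep (hJ : IsJackFamily J) : LinearIndependent F J :=
  LinearMap.linearIndependent_of_isOrthoᵢ (B := hB) (fun _ _ h => J_orth hJ h) (fun i => J_norm hJ i)

lemma J_E (hJ : IsJackFamily J) (l : JPartition) : Eder (J l) = (psize l : F) • J l := by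
  rw [← sub_eq_zero]
  apply hB_nondeg
  intro m
  rw [map_sub, ← E_sa, E_gM, map_smul, map_smul, LinearMap.smul_apply, ← sub_smul]
  by_cases h : hB (gM (lN m)) (J l) = 0
  · rw [h, smul_zero]
  · have := (J_tri hJ l m h).1
    rw [this, lN_size, sub_self, zero_smul]

abbrev Sd (d : ℕ) : Type := {l : JPartition // psize l = d}
instance (d : ℕ) : Fintype (Sd d) := (Sd_finite d).fintype

lemma J_le_g (hJ : IsJackFamily J) (d : ℕ) :
    Submodule.span F (Set.range fun l : Sd d => J l.1) ≤ Submodule.span F (Set.range fun l : Sd d => gM (lN l.1)) := by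
  rw [Submodule.span_le]
  rintro _ ⟨l, rfl⟩
  have h1 : J l.1 ∈ Submodule.span F (Set.range fun l : JPartition => gM (lN l)) := by rw [gM_span']; trivial
  have h2 := Submodule.mem_map_of_mem (f := piD d) h1
  rw [piD_eig d (J_E hJ l.1), if_pos l.2, Submodule.map_span] at h2
  refine Submodule.span_le.2 ?_ h2
  rintro _ ⟨_, ⟨m, rfl⟩, rfl⟩
  have h3 := E_gM (lN m)
  rw [piD_eig d h3]
  split_ifs with h
  · exact Submodule.subset_span ⟨⟨m, by rw [← h, lN_size]⟩, rfl⟩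
  · exact zero_mem _

lemma J_eq_g (hJ : IsJackFamily J) (d : ℕ) :
    Submodule.span F (Set.range fun l : Sd d => J l.1) = Submodule.span F (Set.range fun l : Sd d => gM (lN l.1)) := by
  have h1 : LinearIndependent F (fun l : Sd d => J l.1) := (J_indep hJ).comp (fun l : Sd d => l.1) Subtype.val_injective
  haveI : FiniteDimensional F (Submodule.span F (Set.range fun l : Sd d => gM (lN l.1))) :=
    FiniteDimensional.span_of_finite F (Set.finite_range _)
  refine Submodule.eq_of_le_of_finrank_le (J_le_g hJ d) ?_
  rw [finrank_span_eq_card h1]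
  exact finrank_range_le_card _

lemma J_span (hJ : IsJackFamily J) : Submodule.span F (Set.range J) = ⊤ := by
  rw [eq_top_iff, ← gM_span', Submodule.span_le]
  rintro _ ⟨l, rfl⟩
  have : gM (lN l) ∈ Submodule.span F (Set.range fun l : Sd (psize l) => J l.1) := by
    rw [J_eq_g hJ]; exact Submodule.subset_span ⟨⟨l, rfl⟩, rfl⟩
  refine Submodule.span_mono ?_ this
  rintro _ ⟨m, rfl⟩; exact ⟨m.1, rfl⟩

lemma J_nondeg (hJ : IsJackFamily J) (f : SymA) (h : ∀ l, hB (J l) f = 0) : f = 0 := by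
  apply hB_aniso
  by_contra hn
  have hf : f ∈ Submodule.span F (Set.range J) := by rw [J_span hJ]; trivial
  obtain ⟨_, ⟨l, rfl⟩, hx⟩ := exists_of_span hf (hB.flip f) hn
  exact hx (h l)

lemma J_expand (hJ : IsJackFamily J) (f : SymA) : f ∈ Submodule.span F {g | ∃ m, g = J m ∧ hB (J m) f ≠ 0} := by
  have hf : f ∈ Submodule.span F (Set.range J) := by rw [J_span hJ]; trivial
  rw [Finsupp.mem_span_range_iff_exists_finsupp] at hf
  obtain ⟨c, rfl⟩ := hf
  refine Submodule.sum_mem _ fun m hm => Submodule.smul_mem _ _ (Submodule.subset_span ⟨m, rfl, ?_⟩)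
  rw [Finsupp.sum, map_sum, Finset.sum_eq_single m]
  · rw [map_smul, smul_eq_mul]
    exact mul_ne_zero (Finsupp.mem_support_iff.1 hm) (J_norm hJ m)
  · intro i _ hi
    rw [map_smul, J_orth hJ hi.symm, smul_zero]
  · intro h; exact absurd hm h

lemma g_indep (hJ : IsJackFamily J) (d : ℕ) : LinearIndependent F (fun l : Sd d => gM (lN l.1)) := by
  have h1 : LinearIndependent F (fun l : Sd d => J l.1) := (J_indep hJ).comp (fun l : Sd d => l.1) Subtype.val_injective
  rw [linearIndependent_iff_card_eq_finrank_span, Set.finrank, ← J_eq_g hJ, finrank_span_eq_card h1]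

lemma J_in_g (hJ : IsJackFamily J) (l : JPartition) :
    J l ∈ Submodule.span F {f | ∃ n : JPartition, f = gM (lN n) ∧ ple (lN l) (lN n)} := by
  let U := {n : Sd (psize l) // ple (lN l) (lN n.1)}
  let bJ : U → SymA := fun n => J n.1.1
  let bg : U → SymA := fun n => gM (lN n.1.1)
  have hJi : LinearIndependent F bJ := (J_indep hJ).comp (fun n : U => n.1.1) (Subtype.val_injective.comp Subtype.val_injective)
  have hgi : LinearIndependent F bg := (g_indep hJ (psize l)).comp (fun n : U => n.1) Subtype.val_injective
  have hle : Submodule.span F (Set.range bg) ≤ Submodule.span F (Set.range bJ) := by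
    rw [Submodule.span_le]
    rintro _ ⟨n, rfl⟩
    refine Submodule.span_mono ?_ (J_expand hJ (bg n))
    rintro _ ⟨m, rfl, hm⟩
    rw [hB_comm] at hm
    have h1 := n.2.trans (J_tri hJ m n.1.1 hm)
    refine ⟨⟨⟨m, ?_⟩, h1⟩, rfl⟩
    have := h1.1
    rw [lN_size, lN_size] at this; exact this.symm
  haveI : FiniteDimensional F (Submodule.span F (Set.range bJ)) := FiniteDimensional.span_of_finite F (Set.finite_range _)
  have heq := Submodule.eq_of_le_of_finrank_le hle (by rw [finrank_span_eq_card hJi, finrank_span_eq_card hgi])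
  have : J l ∈ Submodule.span F (Set.range bJ) := Submodule.subset_span ⟨⟨⟨l, rfl⟩, ple.refl _⟩, rfl⟩
  rw [← heq] at this
  refine Submodule.span_mono ?_ this
  rintro _ ⟨n, rfl⟩
  exact ⟨n.1.1, rfl, n.2⟩

lemma J_g_exists (hJ : IsJackFamily J) (l : JPartition) (φ : SymA →ₗ[F] F) (h : φ (J l) ≠ 0) :
    ∃ n : JPartition, ple (lN l) (lN n) ∧ φ (gM (lN n)) ≠ 0 := by
  obtain ⟨_, ⟨n, rfl, h1⟩, h2⟩ := exists_of_span (J_in_g hJ l) φ h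
  exact ⟨n, h1, h2⟩

lemma D_J_aux (hJ : IsJackFamily J) (l n : JPartition) (h : hB (J n) (Dop (J l) - eM (lN l) • J l) ≠ 0) :
    ple (lN n) (lN l) ∧ n ≠ l := by
  obtain ⟨m, h1, h2⟩ := J_g_exists hJ n (hB.flip (Dop (J l) - eM (lN l) • J l)) h
  rw [LinearMap.flip_apply, map_sub, ← D_sa, map_smul, ← LinearMap.smul_apply, ← map_smul, ← LinearMap.sub_apply, ← map_sub] at h2
  have key : ple (lN m) (lN l) ∧ m ≠ l := by
    have e : Dop (gM (lN m)) - eM (lN l) • gM (lN m) = (Dop (gM (lN m)) - eM (lN m) • gM (lN m)) + (eM (lN m) - eM (lN l)) • gM (lN m) := by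
      simp only [smulS, map_sub]; ring
    rw [e, map_add, LinearMap.add_apply] at h2
    by_cases h3 : hB ((eM (lN m) - eM (lN l)) • gM (lN m)) (J l) = 0
    · rw [h3, add_zero] at h2
      obtain ⟨_, ⟨M, rfl, h4⟩, h5⟩ := exists_of_span (D_gM (lN m)) (hB.flip (J l)) h2
      obtain ⟨k, hk1, hk2⟩ := gM_lN M
      rw [hk1] at h5
      have h6 := J_tri hJ l k h5
      have h7 : ple M (lN l) := ⟨(hk2 0).trans h6.1, fun t => (hk2 t).le.trans (h6.2 t)⟩
      refine ⟨h4.1.trans h7, ?_⟩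
      rintro rfl
      have := h7.sM_le
      have := h4.2
      omega
    · rw [map_smul, LinearMap.smul_apply] at h3
      refine ⟨J_tri hJ l m (right_ne_zero_of_smul h3), ?_⟩
      rintro rfl
      simp at h3
  refine ⟨h1.trans key.1, ?_⟩
  rintro rfl
  exact key.2 (lN_antisymm key.1 h1)

lemma D_J (hJ : IsJackFamily J) (l : JPartition) : Dop (J l) = eM (lN l) • J l := by
  rw [← sub_eq_zero]
  apply J_nondeg hJ
  intro n
  by_contra h
  have h1 := D_J_aux hJ l n h
  have h2 : hB (J l) (Dop (J n) - eM (lN n) • J n) ≠ 0 := by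
    rw [map_sub, map_smul, J_orth hJ h1.2.symm, smul_zero, sub_zero, hB_comm, D_sa]
    rw [map_sub, map_smul, J_orth hJ h1.2, smul_zero, sub_zero] at h
    exact h
  have h3 := D_J_aux hJ n l h2
  exact h1.2 (lN_antisymm h1.1 h3.1)

lemma J_gdiag (hJ : IsJackFamily J) (l : JPartition) : hB (gM (lN l)) (J l) ≠ 0 := by
  obtain ⟨n, h1, h2⟩ := J_g_exists hJ l (hB.flip (J l)) (J_norm hJ l)
  have := lN_antisymm h1 (J_tri hJ l n h2)
  subst this
  exact h2

end

section
variable {J : JPartition → SymA}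

lemma mem_Iv_of_span {v : ℕ} {S : Set SymA} {f : SymA} (hf : f ∈ Submodule.span F S) (h : ∀ x ∈ S, x ∈ Iv v) : f ∈ Iv v := by
  have : Submodule.span F S ≤ (Iv v).restrictScalars F := Submodule.span_le.2 h
  exact this hf

lemma J_mem_Iv (hJ : IsJackFamily J) {v : ℕ} {l : JPartition} (h : PP (lN l) v ≠ 0) : J l ∈ Iv v := by
  refine mem_Iv_of_span (J_in_g hJ l) ?_
  rintro _ ⟨n, rfl, h1⟩
  exact gM_Iv _ _ (by have := h1.2 v; omega)

lemma Iv_iff (hJ : IsJackFamily J) (v : ℕ) (f : SymA) : f ∈ Iv v ↔ ∀ l, PP (lN l) v = 0 → hB f (J l) = 0 := by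
  constructor
  · intro hf l hl
    by_contra hn
    obtain ⟨_, ⟨M, rfl, h1⟩, h2⟩ := exists_of_span (Iv_span v f hf) (hB.flip (J l)) hn
    obtain ⟨k, hk1, hk2⟩ := gM_lN M
    rw [hk1] at h2
    have := (J_tri hJ l k h2).2 v
    have := hk2 v
    omega
  · intro h
    refine mem_Iv_of_span (J_expand hJ f) ?_
    rintro _ ⟨m, rfl, hm⟩
    refine J_mem_Iv hJ fun h0 => hm ?_
    rw [hB_comm]; exact h m h0

lemma tau_Iv (v : ℕ) (f : SymA) (hf : f ∈ Iv v) : tau (-(alpha * v)) f ∈ Iv v := by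
  induction hf using Submodule.span_induction with
  | mem x hx =>
    obtain ⟨n, hn, rfl⟩ := hx
    obtain ⟨n, rfl⟩ : ∃ n', n = n' + 1 := ⟨n - 1, by omega⟩
    rw [tau_gg]
    rcases Nat.lt_or_ge v n with h | h
    · exact smul_Iv _ (gg_Iv h)
    · have : n = v := by omega
      subst this
      rw [show alpha * (n : F) + -(alpha * n) = 0 by ring, zero_smul]; exact zero_mem _
  | zero => rw [map_zero]; exact zero_mem _
  | add x y _ _ hx hy => rw [map_add]; exact add_mem hx hy
  | smul a x hx' hx =>
    rw [smul_eq_mul, Derivation.leibniz]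
    exact add_mem (Ideal.mul_mem_left _ _ hx) (by rw [smul_eq_mul]; exact Ideal.mul_mem_right _ _ hx')

lemma gv_eig (hJ : IsJackFamily J) (v : ℕ+) (l m : JPartition) (hl : PP (lN l) v = 0) (hm : PP (lN m) v = 0)
    (h : hB (gg v * J l) (J m) ≠ 0) : eM (lN m) = eM (lN (v ::ₘ l)) := by
  have h1 := (Iv_iff hJ v _).1 (D_mod_Iv v (J l)) m hm
  have e : gg v * (Dop (J l) + (alpha * (v : ℕ) * ((v : ℕ) - 1) / 2) • J l - Eder (J l)) = eM (lN (v ::ₘ l)) • (gg v * J l) := by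
    rw [D_J hJ, J_E hJ, lN_cons, eM_cons, min_sum_of_le _ _ ((PP_eq_zero _ _).1 hl), lN_size]
    simp only [smulS, map_sub, map_add]; ring
  rw [e, map_sub, LinearMap.sub_apply, D_sa, D_J hJ, map_smul, map_smul, LinearMap.smul_apply, ← sub_smul, smul_eq_mul] at h1
  exact sub_eq_zero.1 ((mul_eq_zero.1 h1).resolve_right h)

lemma gv_J (hJ : IsJackFamily J) (v : ℕ+) (l m : JPartition) (hl : PP (lN l) v = 0) (hm : PP (lN m) v = 0)
    (h : hB (gg v * J l) (J m) ≠ 0) : m = v ::ₘ l := by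
  have he := gv_eig hJ v l m hl hm h
  obtain ⟨n, h1, h2⟩ := J_g_exists hJ l ((hB.flip (J m)) ∘ₗ LinearMap.mulLeft F (gg v)) h
  have h3 : hB (gM (lN (v ::ₘ n))) (J m) ≠ 0 := by rw [lN_cons, gM_cons]; exact h2
  have h4 := J_tri hJ m _ h3
  have h5 : ple (lN (v ::ₘ l)) (lN (v ::ₘ n)) := by
    simp only [lN_cons, ple, PP_cons]
    exact ⟨by rw [h1.1], fun t => by have := h1.2 t; omega⟩
  refine (lN_ple_eq (h5.trans h4) ?_).symm
  have := sM_of_eM (M := lN m) (N := lN (v ::ₘ l)) 0 (by rw [he]; simp)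
  omega

lemma gv_diag (hJ : IsJackFamily J) (v : ℕ+) (l : JPartition) : hB (gg v * J l) (J (v ::ₘ l)) ≠ 0 := by
  have h : J l ∈ Submodule.span F (insert (gM (lN l)) {f | ∃ n : JPartition, f = gM (lN n) ∧ ple (lN l) (lN n) ∧ n ≠ l}) := by
    refine Submodule.span_mono ?_ (J_in_g hJ l)
    rintro _ ⟨n, rfl, h⟩
    by_cases hn : n = l
    · left; rw [hn]
    · right; exact ⟨n, rfl, h, hn⟩
  rw [Submodule.mem_span_insert] at h
  obtain ⟨a, z, hz, he⟩ := h
  have h1 : hB z (J l) = 0 := by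
    by_contra hn
    obtain ⟨_, ⟨n, rfl, h2, h3⟩, h4⟩ := exists_of_span hz (hB.flip (J l)) hn
    exact h3 (lN_antisymm (J_tri hJ l n h4) h2)
  have ha : a ≠ 0 := by
    rintro rfl
    rw [zero_smul, zero_add] at he
    rw [← he] at h1
    exact J_norm hJ l h1
  have h2 : hB (gg v * z) (J (v ::ₘ l)) = 0 := by
    by_contra hn
    obtain ⟨_, ⟨n, rfl, h2, h3⟩, h4⟩ := exists_of_span hz ((hB.flip (J (v ::ₘ l))) ∘ₗ LinearMap.mulLeft F (gg v)) hn
    have h5 : hB (gM (lN (v ::ₘ n))) (J (v ::ₘ l)) ≠ 0 := by rw [lN_cons, gM_cons]; exact h4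
    have h6 := J_tri hJ _ _ h5
    simp only [lN_cons, ple, PP_cons] at h6
    exact h3 (lN_antisymm ⟨by omega, fun t => by have := h6.2 t; omega⟩ h2)
  rw [he, mul_add, map_add, LinearMap.add_apply, h2, add_zero, mul_smul_comm, map_smul, LinearMap.smul_apply, ← gM_cons, ← lN_cons]
  exact smul_ne_zero ha (J_gdiag hJ _)

lemma small_cons {v : ℕ+} {l : JPartition} (hl : PP (lN l) v = 0) : PP (lN (v ::ₘ l)) v = 0 := by
  rw [lN_cons, PP_cons, hl]; simp

lemma gv_mod (hJ : IsJackFamily J) (v : ℕ+) (l : JPartition) (hl : PP (lN l) v = 0) :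
    ∃ c : F, c ≠ 0 ∧ gg v * J l - c • J (v ::ₘ l) ∈ Iv v := by
  refine ⟨hB (gg v * J l) (J (v ::ₘ l)) / hB (J (v ::ₘ l)) (J (v ::ₘ l)), div_ne_zero (gv_diag hJ v l) (J_norm hJ _), ?_⟩
  rw [Iv_iff hJ]
  intro m hm
  rw [map_sub, map_smul, LinearMap.sub_apply, LinearMap.smul_apply]
  by_cases h : m = v ::ₘ l
  · subst h
    rw [smul_eq_mul, div_mul_cancel₀ _ (J_norm hJ _), sub_self]
  · rw [J_orth hJ (Ne.symm h), smul_zero, sub_zero]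
    by_contra hn
    exact h (gv_J hJ v l m hl hm hn)

lemma cn_one : cn 1 = 0 := by
  have : csum 1 = 0 := by simp [csum, Finset.Nat.antidiagonal_succ, pX_zero]
  rw [cn, this]; simp
lemma D_p1 (f : SymA) : Dop (pX 1 * f) = pX 1 * Dop f + alpha • dn 1 f := by
  rw [D_mul, cn_one]; simp

lemma pieri_D (hJ : IsJackFamily J) (k m : JPartition) :
    alpha * hB (dn 1 (J k)) (J m) = (eM (lN m) - eM (lN k)) * hB (pX 1 * J k) (J m) := by
  have h1 : hB (Dop (pX 1 * J k)) (J m) = eM (lN m) * hB (pX 1 * J k) (J m) := by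
    rw [D_sa, D_J hJ, map_smul, smul_eq_mul]
  rw [D_p1, D_J hJ, mul_smul_comm, map_add, map_smul, map_smul, LinearMap.add_apply, LinearMap.smul_apply, LinearMap.smul_apply, smul_eq_mul, smul_eq_mul] at h1
  linear_combination h1

lemma pieri_size (hJ : IsJackFamily J) {k m : JPartition} (h : hB (pX 1 * J k) (J m) ≠ 0) : psize m = psize k + 1 := by
  have h1 : hB (Eder (pX 1 * J k)) (J m) = (psize m : F) * hB (pX 1 * J k) (J m) := by
    rw [E_sa, J_E hJ, map_smul, smul_eq_mul]
  have h2 : Eder (pX 1 * J k) = ((psize k + 1 : ℕ) : F) • (pX 1 * J k) := by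
    rw [Derivation.leibniz, Eder_pX, J_E hJ]; simp only [smulS, smul_eq_mul, map_natCast]; push_cast; ring
  rw [h2, map_smul, LinearMap.smul_apply, smul_eq_mul] at h1
  have := mul_right_cancel₀ h h1
  exact_mod_cast this.symm

lemma q1_gM (M : Multiset ℕ) : qn 1 (gM M) ∈ Submodule.span F {f | ∃ (M' : Multiset ℕ) (x : ℕ), f = gM M' ∧ 1 ≤ x ∧ x - 1 ∈ M' ∧ ∀ t, PP M t = PP M' t + if t < x then 1 else 0} := by
  induction M using Multiset.induction_on with
  | empty => simp
  | cons y M ih =>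
    rw [gM_cons, Derivation.leibniz, qn_gg 1 one_pos, smul_eq_mul, smul_eq_mul]
    refine Submodule.add_mem _ ?_ ?_
    · have := Submodule.mem_map_of_mem (f := LinearMap.mulLeft F (gg y)) ih
      rw [Submodule.map_span] at this
      refine Submodule.span_mono ?_ this
      rintro _ ⟨_, ⟨M', x, rfl, h1, h2, h3⟩, rfl⟩
      exact ⟨y ::ₘ M', x, by simp, h1, by simp [h2], fun t => by simp only [PP_cons]; rw [h3 t]; omega⟩
    · split_ifs with hy
      · refine Submodule.subset_span ⟨(y - 1) ::ₘ M, y, by simp [mul_comm], hy, by simp, fun t => ?_⟩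
        simp only [PP_cons]
        split_ifs <;> omega
      · simp

lemma pieri_B (hJ : IsJackFamily J) (k m N : JPartition) (v : ℕ) (hP : ∀ t, PP (lN k) t = (v - t) + PP (lN N) t)
    (hk : PP (lN k) v = 0) (hm : PP (lN m) v ≠ 0) (h : hB (pX 1 * J k) (J m) ≠ 0) :
    m = Nat.succPNat v ::ₘ N ∧ eM (lN m) = eM (lN k) + alpha * v := by
  have he : eM (lN m) = eM (lN k) + alpha * v := by
    have h1 := b1_adj (-(alpha * v)) (J k) (J m)
    rw [hB_comm (J k) (tau _ (J m)), (Iv_iff hJ v _).1 (tau_Iv v _ (J_mem_Iv hJ hm)) k hk] at h1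
    have h2 := pieri_D hJ k m
    have h3 : b1 (-(alpha * v)) (J k) = (-(v : F)) • (pX 1 * J k) + dn 1 (J k) := by
      have : -(alpha * (v : F)) / alpha = -(v : F) := by field_simp [alpha_ne]
      rw [b1, this]; rfl
    have h4 := (mul_eq_zero.1 h1).resolve_left alpha_ne
    rw [h3, map_add, map_smul, LinearMap.add_apply, LinearMap.smul_apply, smul_eq_mul] at h4
    have h5 : (eM (lN m) - eM (lN k) - alpha * v) * hB (pX 1 * J k) (J m) = 0 := by linear_combination -h2 + alpha * h4
    have := (mul_eq_zero.1 h5).resolve_right h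
    linear_combination this
  refine ⟨?_, he⟩
  obtain ⟨r, h1, h2⟩ := J_g_exists hJ m (hB (pX 1 * J k)) h
  rw [hB_p] at h2
  obtain ⟨_, ⟨M', x, rfl, hx1, hx2, hx3⟩, h3⟩ := exists_of_span (q1_gM (lN r)) (hB (J k)) h2
  obtain ⟨n, hn1, hn2⟩ := gM_lN M'
  rw [hn1, hB_comm] at h3
  have h4 := J_tri hJ k n h3
  have hxv : x - 1 ≤ v := by
    have : PP M' v = 0 := by have := h4.2 v; have := hn2 v; omega
    exact (PP_eq_zero _ _).1 this _ hx2
  refine lN_ple_eq ⟨?_, fun t => ?_⟩ ?_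
  · have a1 := h1.1; have a2 := hx3 0; have a3 := hn2 0; have a4 := h4.1; have a5 := hP 0
    rw [if_pos (by omega)] at a2
    rw [lN_cons, PP_cons, Nat.succPNat_coe]; omega
  · have a1 := h1.2 t; have a2 := hx3 t; have a3 := hn2 t; have a4 := h4.2 t; have a5 := hP t
    rw [lN_cons, PP_cons, Nat.succPNat_coe]
    split_ifs at a2 <;> omega
  · have a1 := sM_of_eM v he
    have a2 : sM (lN k) = sM (v ::ₘ lN N) := by
      refine le_antisymm (ple.sM_le ⟨?_, fun t => ?_⟩) (ple.sM_le ⟨?_, fun t => ?_⟩) <;> rw [PP_cons, hP]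
    rw [sM_cons] at a2
    rw [lN_cons, sM_cons, Nat.succPNat_coe, Nat.choose_succ_succ' v 1, Nat.choose_one_right]
    have a3 : v.choose (1 + 1) = v.choose 2 := rfl
    rw [a3]
    omega

lemma pieri_A (hJ : IsJackFamily J) (v : ℕ+) (N m : JPartition) (hN : PP (lN N) v = 0) (hm : PP (lN m) v = 0)
    (h : hB (pX 1 * J (v ::ₘ N)) (J m) ≠ 0) : ∃ r, m = v ::ₘ r ∧ PP (lN r) v = 0 ∧ hB (pX 1 * J N) (J r) ≠ 0 := by
  obtain ⟨c, hc, hi⟩ := gv_mod hJ v N hN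
  have h1 := (Iv_iff hJ v _).1 (Ideal.mul_mem_left _ (pX 1) hi) m hm
  have h2 : hB (gg v * (pX 1 * J N)) (J m) ≠ 0 := by
    rw [mul_sub, mul_smul_comm, map_sub, map_smul, LinearMap.sub_apply, LinearMap.smul_apply, sub_eq_zero] at h1
    rw [mul_left_comm, h1]
    rw [smul_eq_mul]
    exact mul_ne_zero hc h
  obtain ⟨_, ⟨r, rfl, h3⟩, h4⟩ := exists_of_span (J_expand hJ (pX 1 * J N)) ((hB.flip (J m)) ∘ₗ LinearMap.mulLeft F (gg v)) h2
  have h4' : hB (gg v * J r) (J m) ≠ 0 := h4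
  have hr : PP (lN r) v = 0 := by
    by_contra hr
    exact h4' ((Iv_iff hJ v _).1 (Ideal.mul_mem_left _ _ (J_mem_Iv hJ hr)) m hm)
  exact ⟨r, gv_J hJ v r m hr hm h4', hr, by rwa [hB_comm]⟩

/-- the eigenvalue `ψ_λ(u)` -/
def psiL : List ℕ → F → F
  | [], _ => 1
  | v :: l, u => (∏ j ∈ Finset.range v, (u + alpha * j)) * psiL l (u - 1)
def psi (l : JPartition) (u : F) : F := psiL (sortedParts l) u
lemma psi_zero (u : F) : psi 0 u = 1 := by
  have : sortedParts 0 = [] := by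
    rw [← Multiset.coe_eq_zero, sp_coe]; rfl
  rw [psi, this]; rfl
lemma psi_cons (v : ℕ+) (l : JPartition) (h : PP (lN l) v = 0) (u : F) :
    psi (v ::ₘ l) u = (∏ j ∈ Finset.range v, (u + alpha * j)) * psi l (u - 1) := by
  rw [psi, sp_cons]; · rfl
  intro i hi
  exact (PP_eq_zero _ _).1 h i (Multiset.mem_map_of_mem _ hi)
lemma small_iff' (v : ℕ+) (l : JPartition) : PP (lN l) v = 0 ↔ ∀ i ∈ l, i ≤ v := by
  rw [PP_eq_zero, lN]; simp
lemma small_mono {l : JPartition} {v w : ℕ} (h : v ≤ w) (hl : PP (lN l) v = 0) : PP (lN l) w = 0 := by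
  rw [PP_eq_zero] at *; exact fun i hi => (hl i hi).trans h
lemma eM_cons' (v : ℕ+) (l : JPartition) (h : PP (lN l) v = 0) :
    eM (lN (v ::ₘ l)) = alpha * (v : ℕ) * ((v : ℕ) - 1) / 2 + eM (lN l) - psize l := by
  rw [lN_cons, eM_cons, min_sum_of_le _ _ ((PP_eq_zero _ _).1 h), lN_size]

lemma pieri (hJ : IsJackFamily J) (k : JPartition) : ∀ m, hB (pX 1 * J k) (J m) ≠ 0 →
    ∀ u, psi m u = (u + eM (lN m) - eM (lN k)) * psi k u := by
  induction k using jp_ind with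
  | h0 =>
    intro m h u
    have hs := pieri_size hJ h
    obtain ⟨h1, h2⟩ := pieri_B hJ 0 m 0 0 (fun t => by simp) (by simp) (by rw [lN_size, hs]; simp) h
    rw [h2, h1, psi_cons _ _ (by simp), psi_zero, psi_zero]
    simp
  | h1 v N hN ih =>
    intro m h u
    have hN' := (small_iff' v N).2 hN
    by_cases hm : PP (lN m) v = 0
    · obtain ⟨r, rfl, hr, h2⟩ := pieri_A hJ v N m hN' hm h
      have hs := pieri_size hJ h2
      rw [psi_cons v r hr, psi_cons v N hN', ih r h2, eM_cons' v r hr, eM_cons' v N hN', hs]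
      push_cast; ring
    · obtain ⟨h1, h2⟩ := pieri_B hJ _ m N v (fun t => by rw [lN_cons, PP_cons]) (small_cons hN') hm h
      rw [h2, psi_cons v N hN', h1, psi_cons _ N (small_mono (by rw [Nat.succPNat_coe]; omega) hN'), Nat.succPNat_coe,
        Finset.prod_range_succ]
      ring

end

section
variable {J : JPartition → SymA}

lemma fac_ne (v j k : ℕ) (h : j < v) : -(alpha * (v : F)) - (k : F) + alpha * j ≠ 0 := by
  intro h0
  have := alpha_indep ((j : ℚ) - v) k (by
    rw [map_sub, map_natCast, map_natCast, map_natCast]; linear_combination h0)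
  have h2 : (j : ℚ) = v := by linarith
  have h3 : j = v := by exact_mod_cast h2
  omega

lemma psi_small' (v : ℕ) (l : JPartition) : ∀ k : ℕ, PP (lN l) v = 0 → psi l (-(alpha * v) - k) ≠ 0 := by
  induction l using jp_ind with
  | h0 => intro k _; rw [psi_zero]; exact one_ne_zero
  | h1 w N hN ih =>
    intro k h
    have hN' := (small_iff' w N).2 hN
    rw [lN_cons, PP_cons] at h
    rw [psi_cons w N hN']
    refine mul_ne_zero (Finset.prod_ne_zero_iff.2 fun j hj => ?_) ?_
    · rw [Finset.mem_range] at hj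
      exact fac_ne v j k (by omega)
    · have := ih (k + 1) (by omega)
      rwa [show -(alpha * (v : F)) - ((k + 1 : ℕ) : F) = -(alpha * (v : F)) - k - 1 by push_cast; ring] at this
lemma psi_small (v : ℕ) (l : JPartition) (h : PP (lN l) v = 0) : psi l (-(alpha * v)) ≠ 0 := by
  have := psi_small' v l 0 h
  simpa using this
lemma psi_big (v : ℕ) (l : JPartition) (h : PP (lN l) v ≠ 0) : psi l (-(alpha * v)) = 0 := by
  induction l using jp_ind with
  | h0 => simp at h
  | h1 w N hN _ =>
    have hN' := (small_iff' w N).2 hN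
    rw [psi_cons w N hN', Finset.prod_eq_zero (i := v), zero_mul]
    · rw [Finset.mem_range]
      by_contra hw
      apply h
      rw [lN_cons, PP_cons, small_mono (by omega) hN']
      omega
    · ring

def JB (hJ : IsJackFamily J) : Module.Basis JPartition F SymA := Module.Basis.mk (J_indep hJ) (J_span hJ).ge
lemma JB_apply (hJ : IsJackFamily J) (l) : JB hJ l = J l := by rw [JB, Module.Basis.mk_apply]
def Psi (hJ : IsJackFamily J) (u : F) : SymA →ₗ[F] SymA := (JB hJ).constr F (fun l => psi l u • J l)
lemma Psi_J (hJ : IsJackFamily J) (u : F) (l) : Psi hJ u (J l) = psi l u • J l := by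
  rw [← JB_apply hJ l, Psi, Module.Basis.constr_basis, JB_apply]
lemma J_ext (hJ : IsJackFamily J) {A : Type*} [AddCommGroup A] [Module F A] {O O' : SymA →ₗ[F] A}
    (h : ∀ l, O (J l) = O' (J l)) (f : SymA) : O f = O' f := by
  have : O = O' := (JB hJ).ext fun l => by rw [JB_apply]; exact h l
  rw [this]

lemma Psi_sa (hJ : IsJackFamily J) (u : F) (f g : SymA) : hB (Psi hJ u f) g = hB f (Psi hJ u g) := by
  refine J_ext hJ (O := (hB.flip g) ∘ₗ Psi hJ u) (O' := hB.flip (Psi hJ u g)) (fun l => ?_) f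
  refine J_ext hJ (O := hB (Psi hJ u (J l))) (O' := hB (J l) ∘ₗ Psi hJ u) (fun m => ?_) g
  rw [LinearMap.comp_apply, Psi_J, Psi_J, map_smul, map_smul, LinearMap.smul_apply]
  by_cases h : l = m
  · rw [h]
  · rw [J_orth hJ h]; simp
lemma Psi_D (hJ : IsJackFamily J) (u : F) (f : SymA) : Dop (Psi hJ u f) = Psi hJ u (Dop f) := by
  refine J_ext hJ (O := Dop ∘ₗ Psi hJ u) (O' := Psi hJ u ∘ₗ Dop) (fun l => ?_) f
  rw [LinearMap.comp_apply, LinearMap.comp_apply, Psi_J, D_J hJ, map_smul, map_smul, D_J hJ, Psi_J, smul_comm]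
lemma b1_apply (u : F) (f : SymA) : b1 u f = (u / alpha) • (pX 1 * f) + dn 1 f := rfl

lemma b1_Psi (hJ : IsJackFamily J) (u : F) (f : SymA) : alpha • b1 u (Psi hJ u f) = Psi hJ u (pX 1 * f) := by
  refine J_ext hJ (O := alpha • (b1 u ∘ₗ Psi hJ u)) (O' := Psi hJ u ∘ₗ LinearMap.mulLeft F (pX 1)) (fun k => ?_) f
  change alpha • b1 u (Psi hJ u (J k)) = Psi hJ u (pX 1 * J k)
  rw [← sub_eq_zero]
  refine J_nondeg hJ _ fun m => ?_
  rw [hB_comm, map_sub, LinearMap.sub_apply, Psi_sa, Psi_J, Psi_J, map_smul, map_smul, map_smul, map_smul,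
    LinearMap.smul_apply, LinearMap.smul_apply, b1_apply, map_add, map_smul, LinearMap.add_apply, LinearMap.smul_apply]
  simp only [smul_eq_mul]
  have h1 := pieri_D hJ k m
  have h2 : alpha * (u / alpha) = u := mul_div_cancel₀ _ alpha_ne
  by_cases h : hB (pX 1 * J k) (J m) = 0
  · rw [h] at h1 ⊢
    linear_combination psi k u * h1
  · rw [pieri hJ k m h u]
    linear_combination psi k u * h1 + psi k u * hB (pX 1 * J k) (J m) * h2

lemma G_Psi (hJ : IsJackFamily J) (u : F) (f : SymA) : Gop u (Psi hJ u f) = Psi hJ u (dn 1 f) := by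
  have h : alpha • Gop u (Psi hJ u f) = alpha • Psi hJ u (dn 1 f) := by
    have h0 : Gop u (Psi hJ u f) = Dop (b1 u (Psi hJ u f)) - b1 u (Dop (Psi hJ u f)) := rfl
    have h1 : alpha • Dop (b1 u (Psi hJ u f)) = Psi hJ u (Dop (pX 1 * f)) := by
      rw [← map_smul, b1_Psi, Psi_D]
    rw [h0, smul_sub, h1, Psi_D, b1_Psi, D_p1, map_add, map_smul]
    abel
  exact alpha_smul_inj h

lemma B_Psi (hJ : IsJackFamily J) (u : F) (n : ℕ) (hn : 1 ≤ n) : ∀ f : SymA, alpha • Bop n u (Psi hJ u f) = Psi hJ u (pX n * f) := by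
  induction n, hn using Nat.le_induction with
  | base => intro f; rw [Bop_one, b1_Psi]
  | succ n hn ih =>
    intro f
    have h1 : Gop u (Bop n u (Psi hJ u f)) = Bop n u (Gop u (Psi hJ u f)) + (n : F) • Bop (n + 1) u (Psi hJ u f) :=
      LinearMap.congr_fun (G_B n u) (Psi hJ u f)
    have h2 : alpha • Gop u (Bop n u (Psi hJ u f)) = Psi hJ u (dn 1 (pX n * f)) := by
      rw [← map_smul, ih, G_Psi]
    have h3 : alpha • Bop n u (Gop u (Psi hJ u f)) = Psi hJ u (pX n * dn 1 f) := by
      rw [G_Psi, ih]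
    have h4 : (n : F) • (alpha • Bop (n + 1) u (Psi hJ u f)) = (n : F) • Psi hJ u (pX (n + 1) * f) := by
      rw [← map_smul (Psi hJ u), smul_comm, ← add_left_inj (Psi hJ u (pX n * dn 1 f)), ← h3, add_comm, ← smul_add, ← h1, h2, h3, ← map_add]
      congr 1
      rw [Derivation.leibniz, dn_pX]
      simp only [smulS, smul_eq_mul]; ring
    have hn' : (n : F) ≠ 0 := by exact_mod_cast (by omega : n ≠ 0)
    exact smul_right_injective _ hn' h4

lemma q1_Psi (hJ : IsJackFamily J) (u : F) (f : SymA) : qn 1 (Psi hJ u f) = Psi hJ u (tau u f) := by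
  rw [← sub_eq_zero]
  refine J_nondeg hJ _ fun m => ?_
  rw [map_sub, ← hB_p, ← Psi_sa, ← Psi_sa, ← b1_adj, ← b1_Psi, map_smul, LinearMap.smul_apply, smul_eq_mul, sub_self]

end

section
variable {J : JPartition → SymA}

def LL : ℕ → ℕ → Finset (List ℕ)
  | 0, N => if N = 0 then {[]} else ∅
  | k + 1, N => (Finset.HasAntidiagonal.antidiagonal N).biUnion fun x => if x.1 = 0 then ∅ else (LL k x.2).image (fun L => x.1 :: L)

lemma mem_LL (k : ℕ) : ∀ (N : ℕ) (L : List ℕ), L ∈ LL k N ↔ L.length = k ∧ L.sum = N ∧ ∀ n ∈ L, 1 ≤ n := by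
  induction k with
  | zero =>
    intro N L
    rw [LL, List.length_eq_zero_iff]
    split_ifs with h
    · subst h
      rw [Finset.mem_singleton]
      constructor
      · rintro rfl; simp
      · exact fun h => h.1
    · simp only [Finset.notMem_empty, false_iff]
      rintro ⟨rfl, h1, -⟩
      exact h h1.symm
  | succ k ih =>
    intro N L
    rw [LL, Finset.mem_biUnion]
    constructor
    · rintro ⟨⟨i, j⟩, hx, h⟩
      rw [Finset.HasAntidiagonal.mem_antidiagonal] at hx
      dsimp only at hx h
      split_ifs at h with hi
      · simp at h
      · rw [Finset.mem_image] at h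
        obtain ⟨L', h1, rfl⟩ := h
        obtain ⟨h2, h3, h4⟩ := (ih _ _).1 h1
        refine ⟨by simp [h2], by simp [h3, hx], ?_⟩
        intro n hn
        rcases List.mem_cons.1 hn with rfl | hn
        · omega
        · exact h4 n hn
    · rintro ⟨h1, h2, h3⟩
      rcases L with _ | ⟨i, L⟩
      · simp at h1
      · refine ⟨(i, L.sum), by rw [Finset.HasAntidiagonal.mem_antidiagonal]; simpa using h2, ?_⟩
        have hi := h3 i (by simp)
        dsimp only
        rw [if_neg (by omega)]
        refine Finset.mem_image_of_mem _ ((ih _ _).2 ⟨by simpa using h1, rfl, fun n hn => h3 n (by simp [hn])⟩)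

lemma sum_LL {M : Type*} [AddCommMonoid M] (k N : ℕ) (f : List ℕ → M) : ∑ L ∈ LL (k + 1) N, f L =
    ∑ x ∈ Finset.HasAntidiagonal.antidiagonal N, if x.1 = 0 then 0 else ∑ L ∈ LL k x.2, f (x.1 :: L) := by
  rw [LL, Finset.sum_biUnion]
  · refine Finset.sum_congr rfl fun x _ => ?_
    split_ifs
    · simp
    · rw [Finset.sum_image]
      intro a _ b _ h
      exact (List.cons.inj h).2
  · intro x hx y hy hxy
    rw [Function.onFun, Finset.disjoint_left]
    intro L h1 h2
    split_ifs at h1 h2 with a b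
    · simp at h1
    · simp at h1
    · simp at h2
    · rw [Finset.mem_image] at h1 h2
      obtain ⟨L1, -, rfl⟩ := h1
      obtain ⟨L2, -, h⟩ := h2
      have h3 := (List.cons.inj h).1
      apply hxy
      rw [Finset.mem_coe, Finset.HasAntidiagonal.mem_antidiagonal] at hx hy
      ext <;> omega

lemma length_le_sum (L : List ℕ) (h : ∀ n ∈ L, 1 ≤ n) : L.length ≤ L.sum := by
  induction L with
  | nil => simp
  | cons a L ih =>
    have := h a (by simp)
    have := ih fun n hn => h n (by simp [hn])
    simp; omega

lemma LL_empty {k N : ℕ} (h : N < k) : LL k N = ∅ := by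
  rw [Finset.eq_empty_iff_forall_notMem]
  intro L hL
  obtain ⟨h1, h2, h3⟩ := (mem_LL _ _ _).1 hL
  have := length_le_sum L h3
  omega

def CL (N : ℕ) : Finset (List ℕ) := (Finset.range (N + 1)).biUnion fun k => LL k N
lemma mem_CL (N : ℕ) (L : List ℕ) : L ∈ CL N ↔ L.sum = N ∧ ∀ n ∈ L, 1 ≤ n := by
  rw [CL, Finset.mem_biUnion]
  constructor
  · rintro ⟨k, -, h⟩
    exact ((mem_LL _ _ _).1 h).2
  · intro h
    refine ⟨L.length, ?_, (mem_LL _ _ _).2 ⟨rfl, h⟩⟩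
    have := length_le_sum L h.2
    rw [Finset.mem_range]; omega
lemma sum_CL {M : Type*} [AddCommMonoid M] (N : ℕ) (f : List ℕ → M) :
    ∑ L ∈ CL N, f L = ∑ k ∈ Finset.range (N + 1), ∑ L ∈ LL k N, f L := by
  rw [CL, Finset.sum_biUnion]
  intro x _ y _ hxy
  rw [Function.onFun, Finset.disjoint_left]
  intro L h1 h2
  exact hxy (((mem_LL _ _ _).1 h1).1.symm.trans ((mem_LL _ _ _).1 h2).1)

def BL (c : F) : List ℕ → Module.End F SymA
  | [] => 1
  | n :: L => Bop n c * BL c L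
lemma BnList_eq (c : F) (L : List ℕ) (f : SymA) : BnList c L f = BL c L f := by
  induction L with
  | nil => rfl
  | cons n L ih => rw [BnList, ih, Bn_eq]; rfl

def lc (L : List ℕ) : F := (L.map fun n : ℕ => (-1 : F) ^ n / (n : F)).prod
def Wo (c : F) (N : ℕ) : SymA →ₗ[F] SymA :=
  ∑ L ∈ CL N, (lc L / (Nat.factorial L.length : F)) • (BL c L : SymA →ₗ[F] SymA)

lemma expB_eq (c : F) (N : ℕ) (f : SymA) : expBcoef c N f = Wo c N f := by
  rw [expBcoef, finsum_eq_sum_of_support_subset (s := CL N)]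
  · rw [Wo, LinearMap.sum_apply]
    refine Finset.sum_congr rfl fun L hL => ?_
    rw [if_pos ((mem_CL _ _).1 hL), BnList_eq]; rfl
  · intro L hL
    rw [Finset.mem_coe, mem_CL]
    by_contra h
    exact hL (if_neg h)

def xx (n : ℕ) : SymA := ((-1 : F) ^ n / (n * alpha)) • pX n
lemma xx_zero : xx 0 = 0 := by simp [xx]
lemma BL_Psi (hJ : IsJackFamily J) (u : F) (L : List ℕ) (h : ∀ n ∈ L, 1 ≤ n) (f : SymA) :
    lc L • BL u L (Psi hJ u f) = Psi hJ u ((L.map xx).prod * f) := by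
  induction L with
  | nil => simp [lc, BL]
  | cons n L ih =>
    have ih := ih fun n hn => h n (by simp [hn])
    have e1 : lc (n :: L) = (-1 : F) ^ n / n * lc L := by simp [lc]
    have e2 : BL u (n :: L) (Psi hJ u f) = Bop n u (BL u L (Psi hJ u f)) := rfl
    rw [e1, e2, mul_smul, ← map_smul, ih, List.map_cons, List.prod_cons, mul_assoc, xx, smul_mul_assoc, map_smul,
      ← B_Psi hJ u n (h n (by simp)), smul_smul]
    congr 1
    field_simp [alpha_ne]

def TT (k N : ℕ) : SymA := ∑ L ∈ LL k N, (L.map xx).prod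
def KK (N : ℕ) : SymA := ∑ k ∈ Finset.range (N + 1), ((Nat.factorial k : F)⁻¹) • TT k N

lemma W_Psi' (hJ : IsJackFamily J) (u : F) (N : ℕ) (f : SymA) : Wo u N (Psi hJ u f) = Psi hJ u (KK N * f) := by
  rw [Wo, LinearMap.sum_apply, sum_CL, KK, Finset.sum_mul, map_sum]
  refine Finset.sum_congr rfl fun k _ => ?_
  rw [TT, smul_mul_assoc, map_smul, Finset.sum_mul, map_sum, Finset.smul_sum]
  refine Finset.sum_congr rfl fun L hL => ?_
  obtain ⟨h1, h2, h3⟩ := (mem_LL _ _ _).1 hL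
  rw [← BL_Psi hJ u L h3, LinearMap.smul_apply, h1, smul_smul, div_eq_inv_mul]

lemma TT_zero (N : ℕ) : TT 0 N = if N = 0 then 1 else 0 := by
  rw [TT, LL]; split_ifs <;> simp
lemma TT_succ (k N : ℕ) : TT (k + 1) N = ∑ x ∈ Finset.HasAntidiagonal.antidiagonal N, xx x.1 * TT k x.2 := by
  rw [TT, sum_LL]
  refine Finset.sum_congr rfl fun x _ => ?_
  split_ifs with h
  · rw [h, xx_zero, zero_mul]
  · rw [TT, Finset.mul_sum]; simp
lemma TT_big {k N : ℕ} (h : N < k) : TT k N = 0 := by rw [TT, LL_empty h, Finset.sum_empty]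
lemma TT_coeff (k : ℕ) : ∀ N, TT k N = PowerSeries.coeff N ((PowerSeries.mk xx : Ser) ^ k) := by
  induction k with
  | zero => intro N; rw [TT_zero, pow_zero, PowerSeries.coeff_one]
  | succ k ih =>
    intro N
    rw [TT_succ, pow_succ', PowerSeries.coeff_mul]
    refine Finset.sum_congr rfl fun x _ => ?_
    rw [ih, PowerSeries.coeff_mk]
lemma TT_th (k N : ℕ) : (N : SymA) * TT (k + 1) N =
    ((k + 1 : ℕ) : SymA) * ∑ x ∈ Finset.HasAntidiagonal.antidiagonal N, ((x.1 : SymA) * xx x.1) * TT k x.2 := by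
  rw [TT_coeff, ← th_coeff, Derivation.leibniz_pow, Nat.add_sub_cancel, map_nsmul, nsmul_eq_mul, smul_eq_mul, mul_comm (_ ^ k), PowerSeries.coeff_mul]
  congr 1
  refine Finset.sum_congr rfl fun x _ => ?_
  rw [th_coeff, PowerSeries.coeff_mk, TT_coeff]
lemma KK_ext {N M : ℕ} (h : N ≤ M) : KK N = ∑ k ∈ Finset.range (M + 1), ((Nat.factorial k : F)⁻¹) • TT k N := by
  rw [KK]
  refine Finset.sum_subset (fun k hk => ?_) fun k _ hk => ?_
  · rw [Finset.mem_range] at *; omega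
  · rw [Finset.mem_range] at hk
    rw [TT_big (by omega), smul_zero]
lemma KK_rec (N : ℕ) : ((N + 1 : ℕ) : SymA) * KK (N + 1) =
    ∑ x ∈ Finset.HasAntidiagonal.antidiagonal (N + 1), ((x.1 : SymA) * xx x.1) * KK x.2 := by
  have h1 : ∀ x ∈ Finset.HasAntidiagonal.antidiagonal (N + 1), ((x.1 : SymA) * xx x.1) * KK x.2 =
      ∑ k ∈ Finset.range (N + 1), ((Nat.factorial k : F)⁻¹) • (((x.1 : SymA) * xx x.1) * TT k x.2) := by
    intro x hx
    rw [Finset.HasAntidiagonal.mem_antidiagonal] at hx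
    by_cases h : x.1 = 0
    · rw [h, xx_zero]; simp
    · rw [KK_ext (M := N) (by omega), Finset.mul_sum]
      refine Finset.sum_congr rfl fun k _ => ?_
      rw [mul_smul_comm]
  rw [Finset.sum_congr rfl h1, Finset.sum_comm, KK, Finset.sum_range_succ', TT_zero, if_neg (by omega), smul_zero, add_zero, Finset.mul_sum]
  refine Finset.sum_congr rfl fun k _ => ?_
  rw [mul_smul_comm, TT_th, ← Finset.smul_sum, Nat.factorial_succ]
  have : ((k + 1 : ℕ) : F) ≠ 0 := by exact_mod_cast (by omega : k + 1 ≠ 0)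
  rw [← nsmul_eq_mul, ← Nat.cast_smul_eq_nsmul F, smul_smul]
  congr 1
  push_cast
  rw [mul_inv, mul_comm, ← mul_assoc, mul_inv_cancel₀ (by exact_mod_cast this), one_mul]

lemma KK_eq (N : ℕ) : KK N = (-1 : F) ^ N • gg N := by
  induction N using Nat.strong_induction_on with
  | _ N ih =>
    rcases N with _ | N
    · rw [KK, Finset.sum_range_one, TT_zero, gg_zero]; simp
    · have h1 := KK_rec N
      have h2 : ∑ x ∈ Finset.HasAntidiagonal.antidiagonal (N + 1), ((x.1 : SymA) * xx x.1) * KK x.2 =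
          ((-1 : F) ^ (N + 1) / alpha) • ∑ x ∈ Finset.HasAntidiagonal.antidiagonal (N + 1), pX x.1 * gg x.2 := by
        rw [Finset.smul_sum]
        refine Finset.sum_congr rfl fun x hx => ?_
        rw [Finset.HasAntidiagonal.mem_antidiagonal] at hx
        by_cases h : x.1 = 0
        · rw [h, xx_zero, pX_zero]; simp
        · have h0 : (x.1 : F) ≠ 0 := by exact_mod_cast h
          rw [ih x.2 (by omega), xx, ← hx, pow_add, ← nsmul_eq_mul, ← Nat.cast_smul_eq_nsmul F, smul_smul, smul_mul_smul_comm]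
          congr 1
          field_simp [alpha_ne]
      rw [h2, ← gg_newton, smul_smul, ← nsmul_eq_mul, ← Nat.cast_smul_eq_nsmul F] at h1
      have h3 : ((N + 1 : ℕ) : F) ≠ 0 := by exact_mod_cast (by omega : N + 1 ≠ 0)
      refine smul_right_injective _ h3 ?_
      dsimp only
      rw [h1, smul_smul]
      congr 1
      field_simp [alpha_ne]

lemma W_Psi (hJ : IsJackFamily J) (u : F) (N : ℕ) (f : SymA) : Wo u N (Psi hJ u f) = (-1 : F) ^ N • Psi hJ u (gg N * f) := by
  rw [W_Psi', KK_eq, smul_mul_assoc, map_smul]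

end

section
variable {J : JPartition → SymA}

lemma toExp_apply (l : JPartition) (i : ℕ+) : toExp l i = Multiset.count i l := by
  rw [toExp, Finsupp.finsetSum_apply]
  simp only [Finsupp.single_apply]
  rw [Finset.sum_ite_eq' ]
  split_ifs with h
  · rfl
  · rw [Multiset.mem_toFinset] at h; exact (Multiset.count_eq_zero_of_notMem h).symm
lemma toExp_inj {l m : JPartition} (h : toExp l = toExp m) : l = m := by
  refine Multiset.ext.2 fun i => ?_
  rw [← toExp_apply, ← toExp_apply, h]
lemma toExp_zero : toExp 0 = 0 := by ext i; simp [toExp_apply]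
lemma toExp_cons (i : ℕ+) (l : JPartition) : toExp (i ::ₘ l) = (toExp l + Finsupp.single i 1 : Exp) := by
  ext j
  rw [toExp_apply, Finsupp.add_apply, toExp_apply, Multiset.count_cons, Finsupp.single_apply]
  simp [eq_comm]
lemma psize_cons (i : ℕ+) (l : JPartition) : psize (i ::ₘ l) = i + psize l := by
  rw [← lN_size, ← lN_size, lN_cons, PP_cons]; simp
lemma psize_zero' : psize 0 = 0 := by rw [← lN_size]; simp
lemma wt_toExp (l : JPartition) : wt (toExp l) = psize l := by
  induction l using Multiset.induction_on with
  | empty => rw [toExp_zero, psize_zero']; simp [wt]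
  | cons i l ih => rw [toExp_cons, wt_add, ih, psize_cons, add_comm]
lemma pPow_eq (l : JPartition) : pPow l = MvPolynomial.monomial (toExp l) 1 := by
  induction l using Multiset.induction_on with
  | empty => rw [toExp_zero]; simp [pPow]
  | cons i l ih =>
    have : pPow (i ::ₘ l) = MvPolynomial.X i * pPow l := by simp [pPow]
    rw [this, ih, toExp_cons, MvPolynomial.X, MvPolynomial.monomial_mul, add_comm, mul_one]
lemma toExp_surj (m : Exp) : ∃ l, toExp l = m := by
  refine ⟨Finsupp.toMultiset m, ?_⟩
  ext i; rw [toExp_apply, Finsupp.count_toMultiset]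
lemma toExp_addOnes (l : JPartition) (k : ℕ) : toExp (addOnes l k) = (toExp l + Finsupp.single 1 k : Exp) := by
  ext j
  rw [toExp_apply, Finsupp.add_apply, toExp_apply, addOnes, Multiset.count_add, Multiset.count_replicate, Finsupp.single_apply]

def d1 : SymA →ₗ[F] SymA := (MvPolynomial.pderiv (1 : ℕ+) : Derivation F SymA SymA)
lemma d1_qn (f : SymA) : alpha • d1 f = qn 1 f := by
  have := qn_pnat 1 f
  rw [PNat.one_coe, Nat.cast_one, mul_one] at this
  rw [this]; rfl
lemma d1_coeff (k : ℕ) : ∀ (f : SymA) (m : Exp), MvPolynomial.coeff m ((d1 ^ k : Module.End F SymA) f) =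
    (((m 1 + k).descFactorial k : ℕ) : F) * MvPolynomial.coeff (m + Finsupp.single 1 k : Exp) f := by
  induction k with
  | zero => intro f m; simp
  | succ k ih =>
    intro f m
    have e : (d1 ^ (k + 1) : Module.End F SymA) f = (d1 ^ k : Module.End F SymA) (MvPolynomial.pderiv 1 f) := by
      rw [pow_succ]; rfl
    rw [e, ih, MvPolynomial.coeff_pderiv]
    have e2 : (m + Finsupp.single 1 k + Finsupp.single 1 1 : Exp) = m + Finsupp.single 1 (k + 1) := by
      rw [add_assoc, ← Finsupp.single_add]
    rw [e2, ← add_assoc (m 1), Nat.succ_descFactorial_succ, Finsupp.add_apply, Finsupp.single_eq_same]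
    push_cast; ring

def dd (k : ℕ) (f : SymA) : SymA := ((Nat.factorial k : F)⁻¹) • (d1 ^ k : Module.End F SymA) f
lemma fac_ne0 (k : ℕ) : (Nat.factorial k : F) ≠ 0 := by exact_mod_cast Nat.factorial_ne_zero k
lemma dd_coeff (k : ℕ) (f : SymA) (m : Exp) : MvPolynomial.coeff m (dd k f) =
    (((m 1 + k).choose k : ℕ) : F) * MvPolynomial.coeff (m + Finsupp.single 1 k : Exp) f := by
  rw [dd, MvPolynomial.coeff_smul, d1_coeff, Nat.descFactorial_eq_factorial_mul_choose, smul_eq_mul, Nat.cast_mul, ← mul_assoc, ← mul_assoc,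
    inv_mul_cancel₀ (fac_ne0 k), one_mul]
lemma wt_single (m : Exp) (k : ℕ) : wt (m + Finsupp.single 1 k : Exp) = wt m + k := by
  rw [wt, Finsupp.sum_add_index' (by simp) (by intros; ring), Finsupp.sum_single_index (by simp)]; simp [wt]
lemma dd_J_big (hJ : IsJackFamily J) {k : ℕ} {l : JPartition} (h : psize l < k) : dd k (J l) = 0 := by
  ext m
  rw [dd_coeff, coeff_of_E (J_E hJ l), mul_zero]; · simp
  rw [wt_single]; omega
lemma dd_J_top (hJ : IsJackFamily J) (l : JPartition) : MvPolynomial.coeff 0 (dd (psize l) (J l)) = 1 := by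
  rw [dd_coeff, zero_add, hJ.normalized]; simp

lemma theta_eq (mu l : JPartition) (h : psize mu ≤ psize l) : theta J mu l = MvPolynomial.coeff (toExp mu) (dd (psize l - psize mu) (J l)) := by
  rw [theta, if_neg (by omega), dd_coeff, toExp_addOnes, pmult, ← toExp_apply]
  congr 2
  rw [Nat.choose_symm_of_eq_add (a := toExp mu 1) (b := psize l - psize mu) (by omega), add_comm]

lemma dd_J_expand (hJ : IsJackFamily J) (l : JPartition) (d : ℕ) (hd : d ≤ psize l) :
    dd (psize l - d) (J l) = ∑ n : Sd d, theta J n.1 l • pPow n.1 := by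
  ext m
  rw [MvPolynomial.coeff_sum]
  simp only [pPow_eq, MvPolynomial.coeff_smul, MvPolynomial.coeff_monomial, smul_eq_mul]
  obtain ⟨n, rfl⟩ := toExp_surj m
  by_cases hn : psize n = d
  · rw [Finset.sum_eq_single (⟨n, hn⟩ : Sd d)]
    · rw [if_pos rfl, mul_one, theta_eq n l (by omega), hn]
    · intro b _ hb
      rw [if_neg, mul_zero]
      intro h
      exact hb (Subtype.ext (toExp_inj h))
    · simp
  · rw [Finset.sum_eq_zero]
    · rw [dd_coeff, coeff_of_E (J_E hJ l), mul_zero]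
      rw [wt_single, wt_toExp]; omega
    · intro b _
      rw [if_neg, mul_zero]
      intro h
      apply hn; rw [← toExp_inj h]; exact b.2

/-! Operators at `u = -αv` -/
lemma Psi_Iv (hJ : IsJackFamily J) (v : ℕ) (f : SymA) (hf : f ∈ Iv v) : Psi hJ (-(alpha * v)) f = 0 := by
  refine J_nondeg hJ _ fun m => ?_
  rw [← Psi_sa, Psi_J, map_smul, LinearMap.smul_apply]
  by_cases h : PP (lN m) v = 0
  · rw [hB_comm, (Iv_iff hJ v f).1 hf m h, smul_zero]
  · rw [psi_big v m h, zero_smul]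
lemma J_range (hJ : IsJackFamily J) (v : ℕ) (l : JPartition) (hl : PP (lN l) v = 0) :
    J l = Psi hJ (-(alpha * v)) ((psi l (-(alpha * v)))⁻¹ • J l) := by
  rw [map_smul, Psi_J, inv_smul_smul₀ (psi_small v l hl)]

def Vv (hJ : IsJackFamily J) (v : ℕ) : Submodule F SymA := LinearMap.range (Psi hJ (-(alpha * v)))
lemma d1_Psi (hJ : IsJackFamily J) (u : F) (f : SymA) : d1 (Psi hJ u f) = Psi hJ u (alpha⁻¹ • tau u f) := by
  rw [map_smul, ← q1_Psi, ← d1_qn, inv_smul_smul₀ alpha_ne]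
lemma d1_V (hJ : IsJackFamily J) (v : ℕ) {f : SymA} (hf : f ∈ Vv hJ v) : d1 f ∈ Vv hJ v := by
  obtain ⟨h, rfl⟩ := hf
  rw [d1_Psi]; exact ⟨_, rfl⟩
lemma d1_pow_V (hJ : IsJackFamily J) (v k : ℕ) {f : SymA} (hf : f ∈ Vv hJ v) : (d1 ^ k : Module.End F SymA) f ∈ Vv hJ v := by
  induction k with
  | zero => exact hf
  | succ k ih => rw [pow_succ']; exact d1_V hJ v ih
lemma W_big (hJ : IsJackFamily J) (v n : ℕ) (h : v < n) {f : SymA} (hf : f ∈ Vv hJ v) : Wo (-(alpha * v)) n f = 0 := by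
  obtain ⟨g, rfl⟩ := hf
  rw [W_Psi, Psi_Iv hJ v _ (Ideal.mul_mem_right _ _ (gg_Iv h)), smul_zero]
lemma W_zero (hJ : IsJackFamily J) (v : ℕ) {f : SymA} (hf : f ∈ Vv hJ v) : Wo (-(alpha * v)) 0 f = f := by
  obtain ⟨g, rfl⟩ := hf
  rw [W_Psi, gg_zero, one_mul, pow_zero, one_smul]
lemma d1_W (hJ : IsJackFamily J) (v n : ℕ) {f : SymA} (hf : f ∈ Vv hJ v) :
    d1 (Wo (-(alpha * v)) (n + 1) f) = Wo (-(alpha * v)) (n + 1) (d1 f) + ((v : F) - n) • Wo (-(alpha * v)) n f := by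
  obtain ⟨g, rfl⟩ := hf
  rw [d1_Psi, W_Psi, W_Psi, W_Psi, map_smul, d1_Psi]
  simp only [← map_smul (Psi hJ _)]
  rw [← map_add]
  congr 1
  rw [Derivation.leibniz, tau_gg]
  have : MvPolynomial.C (alpha⁻¹) * MvPolynomial.C alpha = (1 : SymA) := by
    rw [← map_mul, inv_mul_cancel₀ alpha_ne, map_one]
  simp only [smulS, smul_eq_mul, map_mul, map_add, map_neg, map_sub, pow_succ, map_one]
  linear_combination (MvPolynomial.C ((-1 : F) ^ n) * gg n * g * (MvPolynomial.C (v : F) - MvPolynomial.C (n : F))) * this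

def Al (v l : ℕ) : SymA →ₗ[F] SymA := if l ≤ v then (Nat.factorial l : F) • Wo (-(alpha * v)) (v - l) else 0
lemma d1_Al (hJ : IsJackFamily J) (v l : ℕ) {f : SymA} (hf : f ∈ Vv hJ v) : d1 (Al v l f) = Al v l (d1 f) + Al v (l + 1) f := by
  rcases lt_trichotomy l v with h | h | h
  · rw [Al, if_pos h.le, Al, if_pos (show l + 1 ≤ v from h), LinearMap.smul_apply, LinearMap.smul_apply, LinearMap.smul_apply, map_smul]
    obtain ⟨n, rfl⟩ : ∃ n, v = l + 1 + n := ⟨v - l - 1, by omega⟩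
    rw [show l + 1 + n - l = n + 1 by omega, show l + 1 + n - (l + 1) = n by omega, d1_W hJ _ _ hf, smul_add, smul_smul, Nat.factorial_succ]
    congr 2
    push_cast; ring
  · subst h
    rw [Al, if_pos le_rfl, Al, if_neg (by omega), Nat.sub_self, LinearMap.smul_apply, LinearMap.smul_apply, map_smul, W_zero hJ l hf, W_zero hJ l (d1_V hJ l hf)]
    simp
  · rw [Al, if_neg (by omega), Al, if_neg (by omega)]; simp

lemma d1_Al_pow (hJ : IsJackFamily J) (v j : ℕ) {f : SymA} (hf : f ∈ Vv hJ v) : (d1 ^ j : Module.End F SymA) (Al v 0 f) =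
    ∑ x ∈ Finset.HasAntidiagonal.antidiagonal j, j.choose x.1 • Al v x.1 ((d1 ^ x.2 : Module.End F SymA) f) := by
  induction j with
  | zero => simp
  | succ j ih =>
    have e : (d1 ^ (j + 1) : Module.End F SymA) (Al v 0 f) = d1 ((d1 ^ j : Module.End F SymA) (Al v 0 f)) := by
      rw [pow_succ']; rfl
    rw [e, ih, map_sum, Finset.sum_antidiagonal_choose_succ_nsmul (fun i k => Al v i ((d1 ^ k : Module.End F SymA) f)), ← Finset.sum_add_distrib]
    refine Finset.sum_congr rfl fun x hx => ?_
    rw [Finset.HasAntidiagonal.mem_antidiagonal] at hx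
    rw [map_nsmul, d1_Al hJ v _ (d1_pow_V hJ v _ hf), nsmul_add, Nat.choose_symm_of_eq_add hx.symm, pow_succ']
    rfl

def wl (v l : ℕ) : SymA →ₗ[F] SymA := if l ≤ v then Wo (-(alpha * v)) (v - l) else 0
lemma dd_W (hJ : IsJackFamily J) (v j : ℕ) {f : SymA} (hf : f ∈ Vv hJ v) : dd j (Wo (-(alpha * v)) v f) =
    ∑ x ∈ Finset.HasAntidiagonal.antidiagonal j, wl v x.1 (dd x.2 f) := by
  have h0 : Wo (-(alpha * v)) v f = Al v 0 f := by rw [Al, if_pos (by omega)]; simp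
  rw [dd, h0, d1_Al_pow hJ v j hf, Finset.smul_sum]
  refine Finset.sum_congr rfl fun x hx => ?_
  rw [Finset.HasAntidiagonal.mem_antidiagonal] at hx
  have h1 : Al v x.1 = (Nat.factorial x.1 : F) • wl v x.1 := by
    rw [Al, wl]; split_ifs <;> simp
  rw [h1, dd, map_smul, ← Nat.cast_smul_eq_nsmul F, LinearMap.smul_apply, smul_smul, smul_smul]
  congr 1
  have h2 := Nat.add_choose_mul_factorial_mul_factorial x.1 x.2
  rw [← Nat.choose_symm_of_eq_add rfl, hx] at h2
  have h3 : ((j.choose x.1 : ℕ) : F) * (Nat.factorial x.1 : F) * (Nat.factorial x.2 : F) = (Nat.factorial j : F) := by exact_mod_cast h2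
  rw [← h3]
  have a1 := fac_ne0 x.1
  have a2 := fac_ne0 x.2
  have a3 : ((j.choose x.1 : ℕ) : F) ≠ 0 := by
    intro h; rw [h, zero_mul, zero_mul] at h3; exact fac_ne0 j h3.symm
  field_simp

lemma Wv_J (hJ : IsJackFamily J) (v : ℕ+) (l : JPartition) (hl : PP (lN l) v = 0) :
    Wo (-(alpha * ((v : ℕ) : F))) v (J l) = J (v ::ₘ l) := by
  have hV : J l ∈ Vv hJ v := ⟨_, (J_range hJ v l hl).symm⟩
  obtain ⟨c, hc⟩ : ∃ c : F, Wo (-(alpha * ((v : ℕ) : F))) v (J l) = c • J (v ::ₘ l) := by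
    obtain ⟨c, -, h⟩ := gv_mod hJ v l hl
    have h1 := Psi_Iv hJ v _ h
    rw [map_sub, map_smul, sub_eq_zero, Psi_J] at h1
    rw [J_range hJ v l hl, W_Psi, mul_smul_comm, map_smul, h1]
    exact ⟨_, by rw [smul_smul, smul_smul, smul_smul]⟩
  have h1 := dd_W hJ v (psize (v ::ₘ l)) hV
  rw [Finset.sum_eq_single ((v : ℕ), psize l)] at h1
  · rw [hc, wl, if_pos le_rfl, Nat.sub_self] at h1
    dsimp only at h1
    rw [W_zero hJ v (by rw [dd]; exact Submodule.smul_mem _ _ (d1_pow_V hJ v _ hV))] at h1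
    have h2 := dd_J_top hJ (v ::ₘ l)
    have h3 := dd_J_top hJ l
    have h4 : dd (psize (v ::ₘ l)) (c • J (v ::ₘ l)) = c • dd (psize (v ::ₘ l)) (J (v ::ₘ l)) := by
      rw [dd, dd, map_smul, smul_comm]
    rw [← h1, h4, MvPolynomial.coeff_smul, h2, smul_eq_mul, mul_one] at h3
    rw [hc, h3, one_smul]
  · intro x hx hne
    rw [Finset.HasAntidiagonal.mem_antidiagonal, psize_cons] at hx
    rcases Nat.lt_or_ge (v : ℕ) x.1 with h | h
    · rw [wl, if_neg (by omega)]; rfl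
    · rw [dd_J_big hJ, map_zero]
      by_contra h'
      apply hne
      ext <;> dsimp only <;> omega
  · intro h
    exact absurd (by rw [Finset.HasAntidiagonal.mem_antidiagonal, psize_cons]) h

lemma theta_big {mu l : JPartition} (h : psize l < psize mu) : theta J mu l = 0 := by rw [theta, if_pos h]

lemma theta_rec (hJ : IsJackFamily J) (mu l : JPartition) (v : ℕ+) (hl : PP (lN l) v = 0) :
    theta J mu (v ::ₘ l) = ∑ d ∈ Finset.range (psize mu + 1), ∑ n : Sd d,
      MvPolynomial.coeff (toExp mu) (Wo (-(alpha * ((v : ℕ) : F))) (psize mu - d) (pPow n.1)) * theta J n.1 l := by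
  have hV : J l ∈ Vv hJ v := ⟨_, (J_range hJ v l hl).symm⟩
  have hV' : ∀ k, dd k (J l) ∈ Vv hJ v := fun k => by rw [dd]; exact Submodule.smul_mem _ _ (d1_pow_V hJ v _ hV)
  have h1 : ∀ d ∈ Finset.range (psize mu + 1), ∑ n : Sd d,
      MvPolynomial.coeff (toExp mu) (Wo (-(alpha * ((v : ℕ) : F))) (psize mu - d) (pPow n.1)) * theta J n.1 l =
      if d ≤ psize l ∧ psize mu - d ≤ v then MvPolynomial.coeff (toExp mu) (Wo (-(alpha * ((v : ℕ) : F))) (psize mu - d) (dd (psize l - d) (J l))) else 0 := by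
    intro d _
    by_cases hd : d ≤ psize l
    · have : ∑ n : Sd d, MvPolynomial.coeff (toExp mu) (Wo (-(alpha * ((v : ℕ) : F))) (psize mu - d) (pPow n.1)) * theta J n.1 l =
        MvPolynomial.coeff (toExp mu) (Wo (-(alpha * ((v : ℕ) : F))) (psize mu - d) (dd (psize l - d) (J l))) := by
        rw [dd_J_expand hJ l d hd, map_sum, MvPolynomial.coeff_sum]
        refine Finset.sum_congr rfl fun n _ => ?_
        rw [map_smul, MvPolynomial.coeff_smul, smul_eq_mul, mul_comm]
      rw [this]
      split_ifs with h
      · rfl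
      · rw [W_big hJ v _ (by omega) (hV' _), MvPolynomial.coeff_zero]
    · rw [if_neg (by tauto)]
      refine Finset.sum_eq_zero fun n _ => ?_
      rw [theta_big (by rw [n.2]; omega), mul_zero]
  rw [Finset.sum_congr rfl h1, ← Finset.sum_filter]
  by_cases hs : psize mu ≤ psize (v ::ₘ l)
  · rw [theta_eq mu _ hs, ← Wv_J hJ v l hl, dd_W hJ v _ hV, MvPolynomial.coeff_sum]
    have h2 : ∀ x ∈ Finset.HasAntidiagonal.antidiagonal (psize (v ::ₘ l) - psize mu), MvPolynomial.coeff (toExp mu) (wl v x.1 (dd x.2 (J l))) =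
        if x.1 ≤ v ∧ x.2 ≤ psize l then MvPolynomial.coeff (toExp mu) (Wo (-(alpha * ((v : ℕ) : F))) (v - x.1) (dd x.2 (J l))) else 0 := by
      intro x _
      split_ifs with h
      · rw [wl, if_pos h.1]
      · by_cases h' : x.1 ≤ v
        · rw [dd_J_big hJ (by omega), map_zero, MvPolynomial.coeff_zero]
        · rw [wl, if_neg h']; rfl
    rw [psize_cons] at *
    rw [Finset.sum_congr rfl h2, ← Finset.sum_filter]
    refine Finset.sum_nbij' (fun x => psize l - x.2) (fun d => (v + d - psize mu, psize l - d)) ?_ ?_ ?_ ?_ ?_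
    · intro x hx
      rw [Finset.mem_filter, Finset.HasAntidiagonal.mem_antidiagonal] at hx
      rw [Finset.mem_filter, Finset.mem_range]; omega
    · intro x hx
      rw [Finset.mem_filter, Finset.mem_range] at hx
      rw [Finset.mem_filter, Finset.HasAntidiagonal.mem_antidiagonal]; dsimp only; omega
    · intro x hx
      rw [Finset.mem_filter, Finset.HasAntidiagonal.mem_antidiagonal] at hx
      ext <;> dsimp only <;> omega
    · intro x hx
      rw [Finset.mem_filter, Finset.mem_range] at hx
      omega
    · intro x hx
      rw [Finset.mem_filter, Finset.HasAntidiagonal.mem_antidiagonal] at hx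
      rw [show psize mu - (psize l - x.2) = v - x.1 by omega, show psize l - (psize l - x.2) = x.2 by omega]
  · rw [theta_big (by omega), Finset.sum_eq_zero]
    intro d hd
    rw [Finset.mem_filter, Finset.mem_range] at hd
    rw [psize_cons] at hs
    omega

end

section
variable {J : JPartition → SymA}

/-- polynomial dependence on a parameter -/
def PF {M : Type} [AddCommGroup M] [Module F M] (g : F → M) : Prop :=
  g ∈ Submodule.span F {h : F → M | ∃ (k : ℕ) (m : M), h = fun c => c ^ k • m}
section
variable {M M' : Type} [AddCommGroup M] [Module F M] [AddCommGroup M'] [Module F M']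
lemma PF_const (m : M) : PF fun _ : F => m := Submodule.subset_span ⟨0, m, by simp⟩
lemma PF_add {g h : F → M} (hg : PF g) (hh : PF h) : PF fun c => g c + h c := Submodule.add_mem _ hg hh
lemma PF_smul (a : F) {g : F → M} (hg : PF g) : PF fun c => a • g c := Submodule.smul_mem _ a hg
lemma PF_sum {ι : Type} (s : Finset ι) {g : ι → F → M} (hg : ∀ i ∈ s, PF (g i)) : PF fun c => ∑ i ∈ s, g i c := by
  have : (fun c => ∑ i ∈ s, g i c) = ∑ i ∈ s, g i := by ext1 c; rw [Finset.sum_apply]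
  rw [this]; exact Submodule.sum_mem _ hg
lemma PF_map (φ : M →ₗ[F] M') {g : F → M} (hg : PF g) : PF fun c => φ (g c) := by
  have := Submodule.mem_map_of_mem (f := φ.compLeft F) hg
  rw [Submodule.map_span] at this
  refine Submodule.span_mono ?_ this
  rintro _ ⟨_, ⟨k, m, rfl⟩, rfl⟩
  exact ⟨k, φ m, by ext1 c; simp⟩
def cmul : (F → M) →ₗ[F] (F → M) where
  toFun g c := c • g c
  map_add' g h := by ext1 c; simp
  map_smul' a g := by ext1 c; simp [smul_comm c a]
lemma PF_cmul {g : F → M} (hg : PF g) : PF fun c => c • g c := by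
  have := Submodule.mem_map_of_mem (f := cmul (M := M)) hg
  rw [Submodule.map_span] at this
  refine Submodule.span_mono ?_ this
  rintro _ ⟨_, ⟨k, m, rfl⟩, rfl⟩
  exact ⟨k + 1, m, by ext1 c; simp [cmul, smul_smul, pow_succ']⟩
end
lemma PF_poly {g : F → F} (hg : PF g) : ∃ R : Polynomial F, ∀ c, Polynomial.eval c R = g c := by
  induction hg using Submodule.span_induction with
  | mem x hx =>
    obtain ⟨k, m, rfl⟩ := hx
    exact ⟨Polynomial.C m * Polynomial.X ^ k, fun c => by rw [Polynomial.eval_mul, Polynomial.eval_pow, Polynomial.eval_C, Polynomial.eval_X]; exact mul_comm _ _⟩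
  | zero => exact ⟨0, fun c => by simp⟩
  | add x y _ _ hx hy =>
    obtain ⟨R, hR⟩ := hx
    obtain ⟨S, hS⟩ := hy
    exact ⟨R + S, fun c => by rw [Polynomial.eval_add, hR, hS]; rfl⟩
  | smul a x _ hx =>
    obtain ⟨R, hR⟩ := hx
    exact ⟨Polynomial.C a * R, fun c => by rw [Polynomial.eval_mul, hR, Polynomial.eval_C]; rfl⟩

lemma PF_opK {g : F → MM} (hg : PF g) : PF fun c => opK c (g c) := by
  have : (fun c => opK c (g c)) = fun c => opS (opL (g c)) + opS (c • g c) := by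
    ext1 c
    change opS (opL (g c) + c • g c) = _
    rw [map_add]
  rw [this]
  exact PF_add (PF_map opS (PF_map opL hg)) (PF_map opS (PF_cmul hg))
lemma PF_opK_pow (n : ℕ) {g : F → MM} (hg : PF g) : PF fun c => (opK c ^ n) (g c) := by
  induction n with
  | zero => exact hg
  | succ n ih =>
    have : (fun c => (opK c ^ (n + 1)) (g c)) = fun c => opK c ((opK c ^ n) (g c)) := by
      ext1 c; rw [pow_succ']; rfl
    rw [this]; exact PF_opK ih
lemma PF_Bop (n : ℕ) {g : F → SymA} (hg : PF g) : PF fun c => Bop n c (g c) :=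
  PF_smul alpha⁻¹ (PF_map (cof 0) (PF_map opL (PF_opK_pow n (PF_map vac hg))))
lemma PF_BL (L : List ℕ) (f : SymA) : PF fun c => BL c L f := by
  induction L with
  | nil => exact PF_const f
  | cons n L ih =>
    have : (fun c => BL c (n :: L) f) = fun c => Bop n c (BL c L f) := by ext1 c; rfl
    rw [this]
    exact PF_Bop n (g := fun c => BL c L f) ih
lemma PF_Wo (N : ℕ) (f : SymA) : PF fun c => Wo c N f := by
  have : (fun c => Wo c N f) = fun c => ∑ L ∈ CL N, (lc L / (Nat.factorial L.length : F)) • BL c L f := by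
    ext1 c; rw [Wo, LinearMap.sum_apply]; rfl
  rw [this]
  exact PF_sum _ fun L _ => PF_smul _ (PF_BL L f)
lemma Wo_poly (N : ℕ) (f : SymA) (m : Exp) : ∃ R : Polynomial F, ∀ x, Polynomial.eval x R = MvPolynomial.coeff m (Wo (-(alpha * x)) N f) := by
  obtain ⟨R, hR⟩ := PF_poly (PF_map (MvPolynomial.lcoeff F m) (PF_Wo N f))
  refine ⟨R.comp (-(Polynomial.C alpha * Polynomial.X)), fun x => ?_⟩
  rw [Polynomial.eval_comp, hR]; simp

lemma sum_Sd {M : Type*} [AddCommMonoid M] (N : ℕ) (f : JPartition → M) :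
    ∃ T : Finset JPartition, (∀ n, n ∈ T ↔ psize n ≤ N) ∧ ∑ d ∈ Finset.range (N + 1), ∑ n : Sd d, f n.1 = ∑ n ∈ T, f n := by
  refine ⟨(Finset.range (N + 1)).biUnion fun d => (Sd_finite d).toFinset, fun n => ?_, ?_⟩
  · rw [Finset.mem_biUnion]
    simp only [Set.Finite.mem_toFinset, Set.mem_ofPred_eq, Finset.mem_range]
    constructor
    · rintro ⟨d, h1, h2⟩; omega
    · intro h; exact ⟨psize n, by omega, rfl⟩
  · rw [Finset.sum_biUnion]
    · refine Finset.sum_congr rfl fun d _ => ?_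
      exact (Finset.sum_subtype (p := fun l => psize l = d) _ (by simp) f).symm
    · intro x _ y _ hxy
      rw [Function.onFun, Finset.disjoint_left]
      intro l h1 h2
      simp only [Set.Finite.mem_toFinset, Set.mem_ofPred_eq] at h1 h2
      exact hxy (h1.symm.trans h2)

lemma part_le_size (l : JPartition) : ∀ i ∈ l, (i : ℕ) ≤ psize l := by
  induction l using Multiset.induction_on with
  | empty => simp
  | cons a l ih =>
    intro i hi
    rw [psize_cons]
    rcases Multiset.mem_cons.1 hi with rfl | hi
    · omega
    · have := ih i hi; omega

/-- uniqueness of coefficients -/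
lemma uniq (hJ : IsJackFamily J) (v : ℕ) (Z : JPartition → F) (S : Finset JPartition)
    (hZ : ∀ n, Z n ≠ 0 → n ∈ S)
    (h : ∀ l : JPartition, psize l ≤ v → ∑ n ∈ S, Z n * theta J n l = 0) :
    ∀ d ≤ v, ∀ n, psize n = d → Z n = 0 := by
  intro d
  induction d using Nat.strong_induction_on with
  | _ d ih =>
    intro hd n hn
    let φ : SymA →ₗ[F] F := ∑ n ∈ S, (if psize n = d then Z n else 0) • MvPolynomial.lcoeff F (toExp n)
    have hφ : ∀ f, φ f = ∑ n ∈ S, (if psize n = d then Z n else 0) * MvPolynomial.coeff (toExp n) f := by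
      intro f
      rw [LinearMap.sum_apply]; rfl
    have h0 : ∀ l, φ (J l) = (0 : SymA →ₗ[F] F) (J l) := by
      intro l
      rw [hφ, LinearMap.zero_apply]
      by_cases hl : psize l = d
      · refine Eq.trans ?_ (h l (by omega))
        refine Finset.sum_congr rfl fun m _ => ?_
        rcases lt_trichotomy (psize m) d with hm | hm | hm
        · rw [ih _ hm (by omega) m rfl]; simp
        · rw [if_pos hm, theta_eq m l (by omega), hl, hm, Nat.sub_self, dd]; simp
        · rw [theta_big (by omega), if_neg (by omega)]; simp
      · refine Finset.sum_eq_zero fun m _ => ?_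
        split_ifs with hm
        · rw [coeff_of_E (J_E hJ l), mul_zero]
          rw [wt_toExp]; omega
        · simp
    have h1 := J_ext hJ h0 (pPow n)
    rw [hφ, LinearMap.zero_apply] at h1
    by_contra hne
    rw [Finset.sum_eq_single n] at h1
    · rw [if_pos hn, pPow_eq, MvPolynomial.coeff_monomial, if_pos rfl, mul_one] at h1
      exact hne h1
    · intro m _ hm
      rw [pPow_eq, MvPolynomial.coeff_monomial, if_neg (c := toExp n = toExp m), mul_zero]
      intro e; exact hm (toExp_inj e).symm
    · intro hh; exact absurd (hZ n hne) hh

theorem statement9'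
    (J : JPartition → SymA) (hJ : IsJackFamily J)
    (Th : JPartition → JPartition → Polynomial F) (hTh : IsSkewTheta J Th)
    (mu nu : JPartition) (hsize : psize nu ≤ psize mu) (v : F) :
    Polynomial.eval v (Th mu nu) =
      MvPolynomial.coeff (toExp mu)
        (expBcoef (-(alpha * v)) (psize mu - psize nu) (pPow nu)) := by
  rw [expB_eq]
  choose R hR using fun n : JPartition => Wo_poly (psize mu - psize n) (pPow n) (toExp mu)
  rw [← hR nu v]
  have key : ∀ w : ℕ, 1 ≤ w → psize nu ≤ w → Polynomial.eval (w : F) (Th mu nu - R nu) = 0 := by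
    intro w hw1 hw
    obtain ⟨w, rfl⟩ := exists_pnat (n := w) hw1
    let Z : JPartition → F := fun n => Polynomial.eval ((w : ℕ) : F) (Th mu n) - if psize n ≤ psize mu then Polynomial.eval ((w : ℕ) : F) (R n) else 0
    have hfin := hTh.1 mu
    obtain ⟨T, hT, -⟩ := sum_Sd (M := F) (psize mu) (fun _ => 0)
    have hz := uniq hJ w Z (hfin.toFinset ∪ T) (fun n hn => ?_) (fun l hl => ?_) (psize nu) hw nu rfl
    · simp only [Z] at hz
      rw [if_pos hsize] at hz
      rw [Polynomial.eval_sub, hz]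
    · by_contra hh
      rw [Finset.mem_union, hT, Set.Finite.mem_toFinset, Set.mem_ofPred_eq, not_or, not_not] at hh
      apply hn
      simp only [Z]
      rw [if_neg hh.2, hh.1]; simp
    · have hsm : ∀ i ∈ l, i ≤ w := fun i hi => by
        have := part_le_size l i hi
        exact_mod_cast this.trans hl
      have e1 := hTh.2 mu l w hsm
      rw [theta_rec hJ mu l w ((small_iff' w l).2 hsm)] at e1
      obtain ⟨T', hT', e2⟩ := sum_Sd (psize mu) (fun n => Polynomial.eval ((w : ℕ) : F) (R n) * theta J n l)
      have hTT : T' = T := by ext n; rw [hT, hT']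
      subst hTT
      have e3 : ∑ d ∈ Finset.range (psize mu + 1), ∑ n : Sd d,
          MvPolynomial.coeff (toExp mu) (Wo (-(alpha * ((w : ℕ) : F))) (psize mu - d) (pPow n.1)) * theta J n.1 l =
          ∑ d ∈ Finset.range (psize mu + 1), ∑ n : Sd d, Polynomial.eval ((w : ℕ) : F) (R n.1) * theta J n.1 l := by
        refine Finset.sum_congr rfl fun d _ => Finset.sum_congr rfl fun n _ => ?_
        rw [hR, n.2]
      rw [e3, e2, finsum_eq_sum_of_support_subset (s := hfin.toFinset ∪ T')] at e1
      · simp only [Z, sub_mul]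
        rw [Finset.sum_sub_distrib, ← e1, sub_eq_zero]
        refine Finset.sum_subset_zero_on_sdiff Finset.subset_union_right ?_ ?_
        · intro n hn
          rw [Finset.mem_sdiff, hT] at hn
          rw [if_neg hn.2, zero_mul]
        · intro n hn
          rw [if_pos ((hT n).1 hn)]
      · intro n hn
        rw [Finset.mem_coe, Finset.mem_union, Set.Finite.mem_toFinset]
        left
        intro h0
        apply hn
        dsimp only
        rw [h0]; simp
  have hzero : Th mu nu - R nu = 0 := by
    refine Polynomial.eq_zero_of_infinite_isRoot _ ?_
    refine Set.Infinite.mono (s := (fun w : ℕ => (w : F)) '' {w | max 1 (psize nu) ≤ w}) ?_ ?_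
    · rintro _ ⟨w, hw, rfl⟩
      exact key w ((le_max_left _ _).trans hw) ((le_max_right _ _).trans hw)
    · exact (Set.infinite_of_not_bddAbove (not_bddAbove_Ici _)).image (Nat.cast_injective.injOn)
  rw [sub_eq_zero.1 hzero]

end

/-- **Proposition 4.4, Eq. (4.2).** For any partitions `μ, ν` with `|μ| ≥ |ν|`:
`θ_{μ/ν}^{(α)}(v) = [t^{|μ|-|ν|} p_μ] exp(B_∞^{(α)}(-t, p, -αv)) ⬝ p_ν`
(an identity of polynomials in `v`, stated for every value `v ∈ ℚ(α)`). -/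
theorem statement9
    (J : JPartition → SymA) (hJ : IsJackFamily J)
    (Th : JPartition → JPartition → Polynomial F) (hTh : IsSkewTheta J Th)
    (mu nu : JPartition) (hsize : psize nu ≤ psize mu) (v : F) :
    Polynomial.eval v (Th mu nu) =
      MvPolynomial.coeff (toExp mu)
        (expBcoef (-(alpha * v)) (psize mu - psize nu) (pPow nu)) := by
  exact statement9' J hJ Th hTh mu nu hsize v

end
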